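/- Let R be a complete Kleinian singularity and let M and N be finitely generated R-modules. Then Êxt^i_R(M,N) ≅ Êxt^i_R(N,M) for all i ∈ ℤ. In particular, if M and N are maximal Cohen–Macaulay, then Ext^i_R(M,N) ≅ Ext^i_R(N,M) for all i > 0. -/

import Mathlib

open CategoryTheory CategoryTheory.Limits CategoryTheory.MonoidalCategory Opposite

noncomputable section

universe u

variable (R : Type u) [CommRing R]

/-- Ordinary `Ext` of `R`-modules, via the derived functor `Ext` of Mathlib. -/
abbrev ExtMod (n : ℕ) (M N : ModuleCat.{u} R) : ModuleCat.{u} R :=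
  ((Ext R (ModuleCat.{u} R) n).obj (op M)).obj N

/-- Ordinary `Tor` of `R`-modules, via the derived functor `Tor` of Mathlib. -/
abbrev TorMod (n : ℕ) (M N : ModuleCat.{u} R) : ModuleCat.{u} R :=
  ((Tor (ModuleCat.{u} R) n).obj M).obj N

/-- A finitely generated module `M` is totally reflexive (of G-dimension zero) if the
biduality map is an isomorphism and `Ext^i(M,R) = 0 = Ext^i(M^*,R)` for all `i > 0`. -/
def IsTotallyReflexive (M : ModuleCat.{u} R) : Prop :=
  Module.Finite R M ∧
  Function.Bijective (Module.Dual.eval R M) ∧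
  (∀ i : ℕ, 0 < i → IsZero (ExtMod R i M (ModuleCat.of R R))) ∧
  (∀ i : ℕ, 0 < i → IsZero (ExtMod R i (ModuleCat.of R (Module.Dual R M)) (ModuleCat.of R R)))

/-- `M` admits a resolution `0 → G_n → ⋯ → G_0 → M → 0` by totally reflexive modules. -/
def GDimLE (M : ModuleCat.{u} R) (n : ℕ) : Prop :=
  ∃ (G : ChainComplex (ModuleCat.{u} R) ℕ) (ε : G.X 0 ⟶ M),
    (∀ i, i ≤ n → IsTotallyReflexive R (G.X i)) ∧
    (∀ i, n < i → IsZero (G.X i)) ∧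
    Epi ε ∧
    (∃ w : G.d 1 0 ≫ ε = 0, (ShortComplex.mk (G.d 1 0) ε w).Exact) ∧
    (∀ i, 0 < i → G.ExactAt i)

/-- `M` has finite Gorenstein dimension. -/
def HasFiniteGDim (M : ModuleCat.{u} R) : Prop := ∃ n, GDimLE R M n

/-- The Gorenstein dimension of `M`, as an element of `ℕ∞`. -/
def gdim (M : ModuleCat.{u} R) : ℕ∞ :=
  sInf {c : ℕ∞ | ∃ n : ℕ, c = n ∧ GDimLE R M n}

/-- `M` admits a projective resolution of length at most `n`. -/
def PdLE (M : ModuleCat.{u} R) (n : ℕ) : Prop :=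
  ∃ (G : ChainComplex (ModuleCat.{u} R) ℕ) (ε : G.X 0 ⟶ M),
    (∀ i, Projective (G.X i)) ∧
    (∀ i, n < i → IsZero (G.X i)) ∧
    Epi ε ∧
    (∃ w : G.d 1 0 ≫ ε = 0, (ShortComplex.mk (G.d 1 0) ε w).Exact) ∧
    (∀ i, 0 < i → G.ExactAt i)

/-- `M` has finite projective dimension. -/
def HasFinitePd (M : ModuleCat.{u} R) : Prop := ∃ n, PdLE R M n

/-- The projective dimension of `M`, as an element of `ℕ∞`. -/
def pdim (M : ModuleCat.{u} R) : ℕ∞ :=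
  sInf {c : ℕ∞ | ∃ n : ℕ, c = n ∧ PdLE R M n}

/-- `M` admits an injective resolution `0 → M → I^0 → ⋯ → I^n → 0`. -/
def InjDimLE (M : ModuleCat.{u} R) (n : ℕ) : Prop :=
  ∃ (I : CochainComplex (ModuleCat.{u} R) ℕ) (ι : M ⟶ I.X 0),
    (∀ i, Injective (I.X i)) ∧
    (∀ i, n < i → IsZero (I.X i)) ∧
    Mono ι ∧
    (∃ w : ι ≫ I.d 0 1 = 0, (ShortComplex.mk ι (I.d 0 1) w).Exact) ∧
    (∀ i, 0 < i → I.ExactAt i)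

/-- `M` has finite injective dimension. -/
def HasFiniteInjDim (M : ModuleCat.{u} R) : Prop := ∃ n, InjDimLE R M n

/-- A Gorenstein local ring: a commutative Noetherian local ring of finite self-injective
dimension. -/
def IsGorensteinLocalRing : Prop :=
  IsLocalRing R ∧ IsNoetherianRing R ∧ HasFiniteInjDim R (ModuleCat.of R R)

/-- The grade of a module: `grade M = inf { i | Ext^i(M,R) ≠ 0 }`. -/
def gradeM (M : ModuleCat.{u} R) : ℕ∞ :=
  sInf {c : ℕ∞ | ∃ i : ℕ, c = i ∧ ¬ IsZero (ExtMod R i M (ModuleCat.of R R))}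

/-- A module is G-perfect if its grade equals its Gorenstein dimension. -/
def IsGPerfect (M : ModuleCat.{u} R) : Prop := gradeM R M = gdim R M

/-- An ideal `c` is perfect if `grade (R/c) = pd (R/c)`. -/
def IsPerfectIdeal (c : Ideal R) : Prop :=
  gradeM R (ModuleCat.of R (R ⧸ c)) = pdim R (ModuleCat.of R (R ⧸ c))

/-- A complete resolution `T → P → M` of `M`: `P → M` is a resolution by finite projective
modules, `T` is a totally acyclic complex of finite projective modules, and `θ i` is an
isomorphism for all `i ≫ 0`. -/
structure CompleteResolution (M : ModuleCat.{u} R) where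
  T : ChainComplex (ModuleCat.{u} R) ℤ
  P : ChainComplex (ModuleCat.{u} R) ℤ
  θ : T ⟶ P
  π : P.X 0 ⟶ M
  projT : ∀ i, Projective (T.X i)
  fgT : ∀ i, Module.Finite R (T.X i)
  projP : ∀ i, Projective (P.X i)
  fgP : ∀ i, Module.Finite R (P.X i)
  zeroP : ∀ i : ℤ, i < 0 → IsZero (P.X i)
  epiπ : Epi π
  wπ : P.d 1 0 ≫ π = 0
  exact0 : (ShortComplex.mk (P.d 1 0) π wπ).Exact
  exactP : ∀ i : ℤ, 0 < i → P.ExactAt i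
  exactT : ∀ i : ℤ, T.ExactAt i
  exactTdual : ∀ i : ℤ, (T.linearYonedaObj R (ModuleCat.of R R)).ExactAt i
  iso_eventually : ∃ n₀ : ℤ, ∀ i : ℤ, n₀ ≤ i → IsIso (θ.f i)

/-- Tate cohomology `Êxt^i(M,N) = H^i(Hom(T,N))` computed from a complete resolution of `M`. -/
def TateExt {M : ModuleCat.{u} R} (C : CompleteResolution R M) (N : ModuleCat.{u} R)
    (i : ℤ) : ModuleCat.{u} R :=
  (C.T.linearYonedaObj R N).homology i

/-- Tate homology `T̂or_i(M,N) = H_i(T ⊗ N)` computed from a complete resolution of `M`. -/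
def TateTor {M : ModuleCat.{u} R} (C : CompleteResolution R M) (N : ModuleCat.{u} R)
    (i : ℤ) : ModuleCat.{u} R :=
  ((((tensoringRight (ModuleCat.{u} R)).obj N).mapHomologicalComplex _).obj C.T).homology i

/-- The depth of a module over a local ring: the supremum of the lengths of the
`M`-regular sequences contained in the maximal ideal. -/
def moduleDepth [IsLocalRing R] (M : Type u) [AddCommGroup M] [Module R M] : ℕ∞ :=
  sSup {c : ℕ∞ | ∃ rs : List R, c = rs.length ∧
    (∀ r ∈ rs, r ∈ IsLocalRing.maximalIdeal R) ∧ RingTheory.Sequence.IsRegular M rs}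

/-- `E` is an injective envelope of the residue field `k`: an injective module which is an
essential extension of `k`. -/
def IsInjectiveEnvelopeOfResidueField [IsLocalRing R] (E : Type u) [AddCommGroup E]
    [Module R E] : Prop :=
  Injective (ModuleCat.of R E) ∧
  ∃ ι : IsLocalRing.ResidueField R →ₗ[R] E,
    Function.Injective ι ∧
    ∀ N : Submodule R E, N ≠ ⊥ → N ⊓ LinearMap.range ι ≠ ⊥


/-- A minimal free resolution `⋯ → F_1 → F_0 → M → 0` of a finitely generated module over a
local ring, recorded by its Betti numbers `b n` and differentials with image inside
`m • F_n`. -/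
structure MinFreeRes [IsLocalRing R] (M : Type u) [AddCommGroup M] [Module R M] where
  b : ℕ → ℕ
  d : ∀ n : ℕ, ((Fin (b (n+1)) → R) →ₗ[R] (Fin (b n) → R))
  aug : (Fin (b 0) → R) →ₗ[R] M
  aug_surj : Function.Surjective aug
  exact_zero : LinearMap.ker aug = LinearMap.range (d 0)
  exact_succ : ∀ n, LinearMap.ker (d n) = LinearMap.range (d (n+1))
  minimal : ∀ n, LinearMap.range (d n) ≤ (IsLocalRing.maximalIdeal R) • ⊤

/-- The Betti numbers of `M` are eventually bounded by `γ · n^(c-1)`. -/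
def CxLE [IsLocalRing R] (M : Type u) [AddCommGroup M] [Module R M] (c : ℕ) : Prop :=
  ∃ (F : MinFreeRes R M) (γ : ℝ) (n₀ : ℕ),
    ∀ n : ℕ, n₀ ≤ n → (F.b n : ℝ) ≤ γ * (n : ℝ) ^ ((c : ℤ) - 1)

/-- The complexity of a module: the least `c` such that the Betti numbers are eventually
bounded by `γ · n^(c-1)` for some `γ`. -/
def complexity [IsLocalRing R] (M : Type u) [AddCommGroup M] [Module R M] : ℕ∞ :=
  sInf {e : ℕ∞ | ∃ c : ℕ, e = c ∧ CxLE R M c}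

/-- The pushout `K_η` of a map `f : Ω^{j+1} M → M` (representing a degree-`(j+1)`
homogeneous element `η` of `Ext^*(M,M)`) along the inclusion `Ω^{j+1} M ↪ F_j`: the
cokernel of `(f, -incl) : Ω^{j+1} M → M ⊕ F_j`. -/
abbrev PushoutMod [IsLocalRing R] {M : Type u} [AddCommGroup M] [Module R M]
    (F : MinFreeRes R M) (j : ℕ) (f : LinearMap.range (F.d j) →ₗ[R] M) : Type u :=
  (M × (Fin (F.b j) → R)) ⧸
    LinearMap.range (LinearMap.prod f (-(LinearMap.range (F.d j)).subtype))

/-- Auxiliary predicate: `M` has reducible complexity, with recursion depth `≤ c`. -/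
def RedCxAux [IsLocalRing R] :
    ℕ → ∀ (M : Type u) (_ : AddCommGroup M) (_ : Module R M), Prop
  | 0, M, g, m =>
      letI := g; letI := m
      HasFinitePd R (ModuleCat.of R M)
  | (c+1), M, g, m =>
      letI := g; letI := m
      HasFinitePd R (ModuleCat.of R M) ∨
      (complexity R M < ⊤ ∧ 0 < complexity R M ∧
        ∃ (j : ℕ) (F : MinFreeRes R M) (f : LinearMap.range (F.d j) →ₗ[R] M),
          complexity R (PushoutMod R F j f) < complexity R M ∧
          moduleDepth R (PushoutMod R F j f) = moduleDepth R M ∧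
          RedCxAux c (PushoutMod R F j f) inferInstance inferInstance)

/-- `M` has reducible complexity. -/
def HasReducibleComplexity [IsLocalRing R] (M : Type u) [AddCommGroup M] [Module R M] :
    Prop :=
  ∃ c : ℕ, RedCxAux R c M inferInstance inferInstance

/-- `L` is (isomorphic to) `λ N = Ω Tr N`, computed from a minimal free presentation of `N`
over the local ring `S`. -/
def IsLambdaOf (S : Type u) [CommRing S] [IsLocalRing S]
    (N L : Type u) [AddCommGroup N] [Module S N] [AddCommGroup L] [Module S L] : Prop :=
  ∃ (n₀ n₁ : ℕ) (g : (Fin n₀ → S) →ₗ[S] N) (f : (Fin n₁ → S) →ₗ[S] (Fin n₀ → S)),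
    Function.Surjective g ∧
    LinearMap.range f = LinearMap.ker g ∧
    LinearMap.ker g ≤ (IsLocalRing.maximalIdeal S) • ⊤ ∧
    LinearMap.ker f ≤ (IsLocalRing.maximalIdeal S) • ⊤ ∧
    Nonempty (L ≃ₗ[S] LinearMap.range f.dualMap)

/-- `M` and `N` are linked by the ideal `c`: both are annihilated by `c` (hence are
`R/c`-modules) and `M ≅ λ_{R/c} N`, `N ≅ λ_{R/c} M`. -/
def LinkedBy (c : Ideal R) (M N : Type u) [AddCommGroup M] [Module (R ⧸ c) M]
    [AddCommGroup N] [Module (R ⧸ c) N] [IsLocalRing (R ⧸ c)] : Prop :=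
  IsLambdaOf (R ⧸ c) N M ∧ IsLambdaOf (R ⧸ c) M N

/-- The complete Kleinian singularity `ℂ[[x,y,z]]/(f)`. -/
abbrev KleinianRing (f : MvPowerSeries (Fin 3) ℂ) : Type :=
  MvPowerSeries (Fin 3) ℂ ⧸ Ideal.span {f}

/-- `f` is one of Arnold's simple (ADE) singularities. -/
def IsKleinianPolynomial (f : MvPowerSeries (Fin 3) ℂ) : Prop :=
  (∃ n : ℕ, 1 ≤ n ∧ f = MvPowerSeries.X 0 ^ 2 + MvPowerSeries.X 1 ^ 2 +
      MvPowerSeries.X 2 ^ (n + 1)) ∨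
  (∃ n : ℕ, 4 ≤ n ∧ f = MvPowerSeries.X 0 ^ 2 + MvPowerSeries.X 1 ^ 2 * MvPowerSeries.X 2 +
      MvPowerSeries.X 2 ^ (n - 1)) ∨
  (f = MvPowerSeries.X 0 ^ 2 + MvPowerSeries.X 1 ^ 3 + MvPowerSeries.X 2 ^ 4) ∨
  (f = MvPowerSeries.X 0 ^ 2 + MvPowerSeries.X 1 ^ 3 +
      MvPowerSeries.X 1 * MvPowerSeries.X 2 ^ 3) ∨
  (f = MvPowerSeries.X 0 ^ 2 + MvPowerSeries.X 1 ^ 3 + MvPowerSeries.X 2 ^ 5)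

namespace Klein

section Stable

variable {S : Type*} [CommRing S]
variable {X Y Z W T Q : Type*} [AddCommGroup X] [Module S X] [AddCommGroup Y] [Module S Y]
  [AddCommGroup Z] [Module S Z] [AddCommGroup W] [Module S W]
  [AddCommGroup T] [Module S T] [AddCommGroup Q] [Module S Q]

/-- Maps which factor through a finite free module. -/
def PF (S : Type*) [CommRing S] (X Y : Type*) [AddCommGroup X] [Module S X]
    [AddCommGroup Y] [Module S Y] : Submodule S (X →ₗ[S] Y) :=
  Submodule.span S (Set.range fun p : (X →ₗ[S] S) × Y => p.1.smulRight p.2)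

/-- stable Hom -/
abbrev SHom (S : Type*) [CommRing S] (X Y : Type*) [AddCommGroup X] [Module S X]
    [AddCommGroup Y] [Module S Y] := (X →ₗ[S] Y) ⧸ PF S X Y

lemma smulRight_mem_PF (l : X →ₗ[S] S) (y : Y) : l.smulRight y ∈ PF S X Y :=
  Submodule.subset_span ⟨(l, y), rfl⟩

lemma PF_induction {p : (X →ₗ[S] Y) → Prop} (h1 : ∀ (l : X →ₗ[S] S) (y : Y), p (l.smulRight y)) (h0 : p 0)
    (hadd : ∀ a b, p a → p b → p (a + b)) {α : X →ₗ[S] Y} (hα : α ∈ PF S X Y) : p α := by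
  induction hα using Submodule.closure_induction with
  | zero => exact h0
  | add a b _ _ ha hb => exact hadd a b ha hb
  | smul_mem r z hz =>
    obtain ⟨⟨l, y⟩, rfl⟩ := hz
    have : r • l.smulRight y = l.smulRight (r • y) := by
      ext m; simp [smul_smul, mul_comm]
    rw [this]; exact h1 _ _

lemma PF_comp_right {α : X →ₗ[S] Y} (hα : α ∈ PF S X Y) (β : Z →ₗ[S] X) :
    α ∘ₗ β ∈ PF S Z Y := by
  refine PF_induction (p := fun α => α ∘ₗ β ∈ PF S Z Y) ?_ ?_ ?_ hα
  · intro l y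
    have : (l.smulRight y) ∘ₗ β = (l ∘ₗ β).smulRight y := by ext; simp
    rw [this]; exact smulRight_mem_PF _ _
  · simp
  · intro a b ha hb; rw [LinearMap.add_comp]; exact add_mem ha hb

lemma PF_comp_left {α : X →ₗ[S] Y} (hα : α ∈ PF S X Y) (β : Y →ₗ[S] Z) :
    β ∘ₗ α ∈ PF S X Z := by
  refine PF_induction (p := fun α => β ∘ₗ α ∈ PF S X Z) ?_ ?_ ?_ hα
  · intro l y
    have : β ∘ₗ (l.smulRight y) = l.smulRight (β y) := by ext; simp
    rw [this]; exact smulRight_mem_PF _ _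
  · simp
  · intro a b ha hb; rw [LinearMap.comp_add]; exact add_mem ha hb

lemma id_mem_PF_of_proj [Module.Finite S Q] [Module.Projective S Q] :
    (LinearMap.id : Q →ₗ[S] Q) ∈ PF S Q Q := by
  obtain ⟨n, f, hf⟩ := Module.Finite.exists_fin' S Q
  obtain ⟨s, hs⟩ := Module.projective_lifting_property f LinearMap.id hf
  rw [← hs]
  have hid : (LinearMap.id : (Fin n → S) →ₗ[S] (Fin n → S)) ∈ PF S (Fin n → S) (Fin n → S) := by
    have : (LinearMap.id : (Fin n → S) →ₗ[S] (Fin n → S)) =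
        ∑ i, (LinearMap.proj i : (Fin n → S) →ₗ[S] S).smulRight (Pi.single i (1:S)) := by
      apply LinearMap.ext
      intro v
      ext j
      simp [LinearMap.sum_apply, Finset.sum_apply, Pi.single_apply]
    rw [this]
    exact Submodule.sum_mem _ fun i _ => smulRight_mem_PF _ _
  have := PF_comp_left (PF_comp_right hid s) f
  simpa using this

lemma mem_PF_of_proj_left [Module.Finite S Q] [Module.Projective S Q] (α : Q →ₗ[S] Y) :
    α ∈ PF S Q Y := by
  simpa using PF_comp_left (id_mem_PF_of_proj (S := S) (Q := Q)) α

lemma mem_PF_of_proj_right [Module.Finite S Q] [Module.Projective S Q] (α : Y →ₗ[S] Q) :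
    α ∈ PF S Y Q := by
  simpa using PF_comp_right (id_mem_PF_of_proj (S := S) (Q := Q)) α

lemma PF_lift {α : X →ₗ[S] Y} (hα : α ∈ PF S X Y) (q : Q →ₗ[S] Y)
    (hq : Function.Surjective q) : ∃ γ : X →ₗ[S] Q, q ∘ₗ γ = α := by
  refine PF_induction (p := fun α => ∃ γ : X →ₗ[S] Q, q ∘ₗ γ = α) ?_ ?_ ?_ hα
  · intro l y
    obtain ⟨z, rfl⟩ := hq y
    exact ⟨l.smulRight z, by ext; simp⟩
  · exact ⟨0, by simp⟩
  · rintro a b ⟨c, rfl⟩ ⟨d, rfl⟩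
    exact ⟨c + d, by rw [LinearMap.comp_add]⟩

lemma PF_extend {α : X →ₗ[S] Y} (hα : α ∈ PF S X Y) (i : X →ₗ[S] T)
    (hi : ∀ l : X →ₗ[S] S, ∃ l' : T →ₗ[S] S, l' ∘ₗ i = l) :
    ∃ γ : T →ₗ[S] Y, γ ∘ₗ i = α := by
  refine PF_induction (p := fun α => ∃ γ : T →ₗ[S] Y, γ ∘ₗ i = α) ?_ ?_ ?_ hα
  · intro l y
    obtain ⟨l', rfl⟩ := hi l
    exact ⟨l'.smulRight y, by ext; simp⟩
  · exact ⟨0, by simp⟩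
  · rintro a b ⟨c, rfl⟩ ⟨d, rfl⟩
    exact ⟨c + d, by rw [LinearMap.add_comp]⟩

/-- two surjections with the same kernel -/
lemma equiv_of_ker_eq {L P₁ P₂ : Type*} [AddCommGroup L] [Module S L] [AddCommGroup P₁]
    [Module S P₁] [AddCommGroup P₂] [Module S P₂] (f : L →ₗ[S] P₁) (g : L →ₗ[S] P₂)
    (hf : Function.Surjective f) (hg : Function.Surjective g)
    (h : LinearMap.ker f = LinearMap.ker g) : Nonempty (P₁ ≃ₗ[S] P₂) :=
  ⟨(f.quotKerEquivOfSurjective hf).symm ≪≫ₗ (Submodule.quotEquivOfEq _ _ h) ≪≫ₗ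
    (g.quotKerEquivOfSurjective hg)⟩

/-- Factor through a surjection. -/
lemma exists_desc {p : T →ₗ[S] X} (hp : Function.Surjective p) (β : T →ₗ[S] Y)
    (h : LinearMap.ker p ≤ LinearMap.ker β) : ∃ γ : X →ₗ[S] Y, γ ∘ₗ p = β := by
  refine ⟨(LinearMap.ker p).liftQ β h ∘ₗ (p.quotKerEquivOfSurjective hp).symm.toLinearMap, ?_⟩
  ext t
  have : (p.quotKerEquivOfSurjective hp).symm (p t) = Submodule.Quotient.mk t := by
    rw [LinearEquiv.symm_apply_eq]; rfl
  simp [this]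

lemma exists_lift_inj {i : X →ₗ[S] T} (hi : Function.Injective i) (β : Y →ₗ[S] T)
    (h : LinearMap.range β ≤ LinearMap.range i) : ∃ γ : Y →ₗ[S] X, i ∘ₗ γ = β := by
  refine ⟨(LinearEquiv.ofInjective i hi).symm.toLinearMap ∘ₗ
    β.codRestrict (LinearMap.range i) (fun y => h ⟨y, rfl⟩), ?_⟩
  ext y
  simp

/-- The dimension-shift isomorphism for stable Hom. -/
theorem shift {X' Y' : Type*} [AddCommGroup X'] [Module S X'] [AddCommGroup Y'] [Module S Y']
    [Module.Finite S T] [Module.Projective S T] [Module.Finite S Q] [Module.Projective S Q]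
    {i : X' →ₗ[S] T} {p : T →ₗ[S] X} {j : Y' →ₗ[S] Q} {q : Q →ₗ[S] Y}
    (hip : LinearMap.range i = LinearMap.ker p)
    (hp : Function.Surjective p)
    (hj : Function.Injective j) (hjq : LinearMap.range j = LinearMap.ker q)
    (hq : Function.Surjective q)
    (hext : ∀ l : X' →ₗ[S] S, ∃ l' : T →ₗ[S] S, l' ∘ₗ i = l) :
    Nonempty (SHom S X Y ≃ₗ[S] SHom S X' Y') := by
  -- triples of compatible maps
  let L : Submodule S ((T →ₗ[S] Q) × (X →ₗ[S] Y) × (X' →ₗ[S] Y')) :=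
    { carrier := {t | q ∘ₗ t.1 = t.2.1 ∘ₗ p ∧ t.1 ∘ₗ i = j ∘ₗ t.2.2}
      add_mem' := by
        rintro a b ⟨h1, h2⟩ ⟨h3, h4⟩
        constructor
        · simp [LinearMap.comp_add, LinearMap.add_comp, h1, h3]
        · simp [LinearMap.comp_add, LinearMap.add_comp, h2, h4]
      zero_mem' := by simp
      smul_mem' := by
        rintro c a ⟨h1, h2⟩
        constructor
        · simp [LinearMap.comp_smul, LinearMap.smul_comp, h1]
        · simp [LinearMap.comp_smul, LinearMap.smul_comp, h2] }
  have hpi : p ∘ₗ i = 0 := by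
    ext m; have : i m ∈ LinearMap.ker p := hip ▸ ⟨m, rfl⟩
    simpa using this
  have hqj : q ∘ₗ j = 0 := by
    ext m; have : j m ∈ LinearMap.ker q := hjq ▸ ⟨m, rfl⟩
    simpa using this
  let f₁ : L →ₗ[S] SHom S X Y :=
    (PF S X Y).mkQ ∘ₗ (LinearMap.fst S _ _) ∘ₗ (LinearMap.snd S _ _) ∘ₗ L.subtype
  let f₂ : L →ₗ[S] SHom S X' Y' :=
    (PF S X' Y').mkQ ∘ₗ (LinearMap.snd S _ _) ∘ₗ (LinearMap.snd S _ _) ∘ₗ L.subtype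
  have mid : ∀ t : L, (∃ (γ : X →ₗ[S] Q) (δ : T →ₗ[S] Y'), t.1.1 = γ ∘ₗ p + j ∘ₗ δ) ↔
      t.1.2.1 ∈ PF S X Y := by
    rintro ⟨⟨β, α, α'⟩, h1, h2⟩
    simp only at h1 h2 ⊢
    constructor
    · rintro ⟨γ, δ, rfl⟩
      have : α = q ∘ₗ γ := by
        refine LinearMap.ext fun m => ?_
        obtain ⟨t, rfl⟩ := hp m
        have e := LinearMap.congr_fun h1 t
        have e2 := LinearMap.congr_fun hqj (δ t)
        simp at e e2
        rw [← e, e2]; simp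
      rw [this]
      exact PF_comp_left (mem_PF_of_proj_right γ) q
    · intro hα
      obtain ⟨γ, rfl⟩ := PF_lift hα q hq
      obtain ⟨δ, hδ⟩ := exists_lift_inj hj (β - γ ∘ₗ p) (by
        rintro _ ⟨t, rfl⟩
        rw [hjq]
        have e := LinearMap.congr_fun h1 t
        simp at e
        simp [e])
      exact ⟨γ, δ, by rw [hδ]; abel⟩
  have mid' : ∀ t : L, (∃ (γ : X →ₗ[S] Q) (δ : T →ₗ[S] Y'), t.1.1 = γ ∘ₗ p + j ∘ₗ δ) ↔
      t.1.2.2 ∈ PF S X' Y' := by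
    rintro ⟨⟨β, α, α'⟩, h1, h2⟩
    simp only at h1 h2 ⊢
    constructor
    · rintro ⟨γ, δ, rfl⟩
      have : α' = δ ∘ₗ i := by
        refine LinearMap.ext fun m => hj ?_
        have e := LinearMap.congr_fun h2 m
        have e2 := LinearMap.congr_fun hpi m
        simp at e e2
        rw [← e, e2]; simp
      rw [this]
      exact PF_comp_right (mem_PF_of_proj_left δ) i
    · intro hα
      obtain ⟨δ, rfl⟩ := PF_extend hα i hext
      obtain ⟨γ, hγ⟩ := exists_desc hp (β - j ∘ₗ δ) (by
        rw [← hip]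
        rintro _ ⟨m, rfl⟩
        have e := LinearMap.congr_fun h2 m
        simp at e
        simp [e])
      exact ⟨γ, δ, by rw [hγ]; abel⟩
  refine equiv_of_ker_eq f₁ f₂ ?_ ?_ ?_
  · intro a
    obtain ⟨α, rfl⟩ := Submodule.Quotient.mk_surjective _ a
    obtain ⟨β, hβ⟩ := Module.projective_lifting_property q (α ∘ₗ p) hq
    obtain ⟨α', hα'⟩ := exists_lift_inj hj (β ∘ₗ i) (by
      rintro _ ⟨m, rfl⟩
      rw [hjq]
      have e := LinearMap.congr_fun hβ (i m)
      have e2 := LinearMap.congr_fun hpi m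
      simp at e e2
      simp [e, e2])
    exact ⟨⟨(β, α, α'), hβ, hα'.symm⟩, rfl⟩
  · intro a
    obtain ⟨α', rfl⟩ := Submodule.Quotient.mk_surjective _ a
    obtain ⟨β, hβ⟩ := PF_extend (mem_PF_of_proj_right (j ∘ₗ α')) i hext
    obtain ⟨α, hα⟩ := exists_desc hp (q ∘ₗ β) (by
      rw [← hip]
      rintro _ ⟨m, rfl⟩
      have e := LinearMap.congr_fun hβ m
      have e2 := LinearMap.congr_fun hqj (α' m)
      simp at e e2
      simp [e, e2])
    exact ⟨⟨(β, α, α'), hα.symm, hβ⟩, rfl⟩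
  · ext t
    have := (mid t).symm.trans (mid' t)
    simpa [f₁, f₂, LinearMap.mem_ker] using this

/-- stable Hom is invariant under isomorphism in the second variable -/
theorem shom_congr_right (e : Y ≃ₗ[S] Z) : Nonempty (SHom S X Y ≃ₗ[S] SHom S X Z) := by
  refine ⟨Submodule.Quotient.equiv _ _ (LinearEquiv.congrRight e) ?_⟩
  apply le_antisymm
  · rintro _ ⟨α, hα, rfl⟩
    exact PF_comp_left hα e.toLinearMap
  · intro α hα
    refine ⟨e.symm.toLinearMap ∘ₗ α, PF_comp_left hα _, ?_⟩
    refine LinearMap.ext fun m => ?_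
    exact e.apply_symm_apply (α m)

end Stable

end Klein

namespace Klein

/-- `S = A ⊕ A x` with `x² = -g`, described through the `x`-coefficient `c`. -/
structure QuadData (A S : Type*) [CommRing A] [CommRing S] [Algebra A S] where
  x : S
  g : A
  c : S →ₗ[A] A
  half : A
  hhalf : 2 * half = 1
  hxx : x * x = - algebraMap A S g
  hc : ∀ r, r = algebraMap A S (c (x * r)) + algebraMap A S (c r) * x
  c1 : c 1 = 0
  cx : c x = 1

section

variable {A S : Type*} [CommRing A] [CommRing S] [Algebra A S] (D : QuadData A S)
variable {X Y : Type*} [AddCommGroup X] [Module S X] [Module A X] [IsScalarTower A S X]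
  [AddCommGroup Y] [Module S Y] [Module A Y] [IsScalarTower A S Y]

namespace QuadData

lemma smul_eq (r : S) (m : X) : r • m = D.c (D.x * r) • m + D.c r • (D.x • m) := by
  conv_lhs => rw [D.hc r]
  rw [add_smul, mul_smul, algebraMap_smul, algebraMap_smul]

lemma xx_smul (m : X) : D.x • D.x • m = - (D.g • m) := by
  rw [smul_smul, D.hxx, neg_smul, algebraMap_smul]

lemma ext_c {r s : S} (h1 : D.c r = D.c s) (h2 : D.c (D.x * r) = D.c (D.x * s)) : r = s := by
  rw [D.hc r, D.hc s, h1, h2]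

/-- an `A`-linear map commuting with `x` is `S`-linear -/
def mkLin (f : X →ₗ[A] Y) (h : ∀ m, f (D.x • m) = D.x • f m) : X →ₗ[S] Y where
  toFun := f
  map_add' := f.map_add
  map_smul' r m := by
    simp only [RingHom.id_apply]
    rw [D.smul_eq r m, D.smul_eq r (f m), map_add, map_smul, map_smul, h]

@[simp] lemma mkLin_apply (f : X →ₗ[A] Y) (h : ∀ m, f (D.x • m) = D.x • f m) (m : X) :
    D.mkLin f h m = f m := rfl

/-- an `A`-linear equivalence commuting with `x` is `S`-linear -/
def mkEquiv (f : X ≃ₗ[A] Y) (h : ∀ m, f (D.x • m) = D.x • f m) : X ≃ₗ[S] Y :=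
  { D.mkLin f.toLinearMap h with
    invFun := f.symm
    left_inv := f.left_inv
    right_inv := f.right_inv }

/-- `S`-linear functional from an `A`-linear functional -/
def ell (q : X →ₗ[A] A) : X →ₗ[S] S where
  toFun m := algebraMap A S (q m) * D.x + algebraMap A S (q (D.x • m))
  map_add' a b := by simp only [map_add, smul_add]; ring
  map_smul' r m := by
    simp only [RingHom.id_apply, smul_eq_mul]
    have e1 : q (r • m) = D.c (D.x * r) * q m + D.c r * q (D.x • m) := by
      rw [D.smul_eq r m, map_add, map_smul, map_smul]; rfl
    have e2 : q (D.x • r • m) = D.c (D.x * r) * q (D.x • m) - D.c r * (D.g * q m) := by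
      rw [D.smul_eq r m, smul_add, smul_comm D.x (D.c (D.x * r)), smul_comm D.x (D.c r),
        D.xx_smul, smul_neg, map_add, q.map_smul, q.map_neg, q.map_smul, q.map_smul]
      simp only [smul_eq_mul]; ring
    rw [e1, e2]
    conv_rhs => rw [D.hc r]
    simp only [map_add, map_mul, map_sub]
    have := D.hxx
    linear_combination (-(algebraMap A S (D.c r) * algebraMap A S (q m))) * this

lemma ell_apply (q : X →ₗ[A] A) (m : X) :
    D.ell q m = algebraMap A S (q m) * D.x + algebraMap A S (q (D.x • m)) := rfl

lemma c_alg (a : A) : D.c (algebraMap A S a) = 0 := by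
  rw [Algebra.algebraMap_eq_smul_one, map_smul, D.c1, smul_zero]

lemma c_algx (a : A) : D.c (algebraMap A S a * D.x) = a := by
  rw [← Algebra.smul_def, map_smul, D.cx, smul_eq_mul, mul_one]

@[simp] lemma c_ell (q : X →ₗ[A] A) (m : X) : D.c (D.ell q m) = q m := by
  rw [ell_apply, map_add, D.c_alg, D.c_algx, add_zero]

/-- the `A`-linear functional attached to an `S`-linear one -/
def cl (l : X →ₗ[S] S) : X →ₗ[A] A := D.c ∘ₗ l.restrictScalars A

@[simp] lemma cl_apply (l : X →ₗ[S] S) (m : X) : D.cl l m = D.c (l m) := rfl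

lemma ell_cl (l : X →ₗ[S] S) : D.ell (D.cl l) = l := by
  ext m
  rw [ell_apply, cl_apply, cl_apply, map_smul, smul_eq_mul, add_comm]
  exact (D.hc (l m)).symm

lemma cl_inj {l l' : X →ₗ[S] S} (h : D.cl l = D.cl l') : l = l' := by
  rw [← D.ell_cl l, ← D.ell_cl l', h]

lemma c_mul (a : A) (r : S) : D.c (algebraMap A S a * r) = a * D.c r := by
  rw [← Algebra.smul_def, map_smul, smul_eq_mul]

lemma ell_smul (a : A) (q : X →ₗ[A] A) : D.ell (a • q) = algebraMap A S a • D.ell q := by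
  ext m; simp only [ell_apply, LinearMap.smul_apply, smul_eq_mul, map_mul]; ring

lemma eq_zero_of_dual (D : QuadData A S) [Module.Free A X] {m : X} (h : ∀ l : X →ₗ[S] S, l m = 0) : m = 0 := by
  have b := Module.Free.chooseBasis A X
  apply b.ext_elem
  intro i
  have := congrArg D.c (h (D.ell (b.coord i)))
  simpa using this

/-- reflexivity -/
lemma reflexive (D : QuadData A S) [Module.Free A X] [Module.Finite A X] (Φ : (X →ₗ[S] S) →ₗ[S] S) :
    ∃ m : X, ∀ l : X →ₗ[S] S, Φ l = l m := by
  have b := Module.Free.chooseBasis A X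
  have key : ∀ l : X →ₗ[S] S, D.c (l (∑ i, D.c (Φ (D.ell (b.coord i))) • b i)) = D.c (Φ l) := by
    intro l
    have e : l = ∑ i, algebraMap A S (D.cl l (b i)) • D.ell (b.coord i) := by
      apply D.cl_inj
      refine b.ext fun j => ?_
      simp only [cl_apply, LinearMap.sum_apply, LinearMap.smul_apply, map_sum, smul_eq_mul, c_mul,
        c_ell, Module.Basis.coord_apply, Module.Basis.repr_self, Finsupp.single_apply]
      simp
    have e1 : D.c (Φ l) = ∑ i, D.c (l (b i)) * D.c (Φ (D.ell (b.coord i))) := by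
      conv_lhs => rw [e]
      simp only [map_sum, map_smul, smul_eq_mul, c_mul, cl_apply]
    rw [e1, ← cl_apply, map_sum]
    refine Finset.sum_congr rfl fun i _ => ?_
    rw [(D.cl l).map_smul, smul_eq_mul, cl_apply, mul_comm]
  refine ⟨∑ i, D.c (Φ (D.ell (b.coord i))) • b i, fun l => ?_⟩
  apply D.ext_c
  · exact (key l).symm
  · have := key (D.x • l)
    rw [map_smul] at this
    exact this.symm

/-- functionals extend along an inclusion with `A`-projective cokernel -/
lemma extend (D : QuadData A S) {X' T : Type*} [AddCommGroup X'] [Module S X'] [AddCommGroup T] [Module S T]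
    [Module A T] [IsScalarTower A S T] [Module.Projective A X]
    {i : X' →ₗ[S] T} {p : T →ₗ[S] X} (hi : Function.Injective i)
    (hip : LinearMap.range i = LinearMap.ker p) (hp : Function.Surjective p)
    (l : X' →ₗ[S] S) : ∃ l' : T →ₗ[S] S, l' ∘ₗ i = l := by
  let _ : Module A X' := Module.compHom X' (algebraMap A S)
  have : IsScalarTower A S X' := IsScalarTower.of_algebraMap_smul fun r m => rfl
  obtain ⟨s, hs⟩ := Module.projective_lifting_property (p.restrictScalars A)
    (LinearMap.id : X →ₗ[A] X) hp
  obtain ⟨r, hr⟩ := exists_lift_inj (S := A) (i := i.restrictScalars A) hi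
    (LinearMap.id - s ∘ₗ p.restrictScalars A) (by
      rintro _ ⟨t, rfl⟩
      have : t - s (p t) ∈ LinearMap.range i := by
        rw [hip]
        have := LinearMap.congr_fun hs (p t)
        simp at this
        simp [this]
      obtain ⟨w, hw⟩ := this
      exact ⟨w, by simpa using hw⟩)
  refine ⟨D.ell (D.cl l ∘ₗ r), ?_⟩
  have hri : ∀ m, r (i m) = m := by
    intro m
    apply hi
    have e := LinearMap.congr_fun hr (i m)
    have : p (i m) = 0 := by
      have : i m ∈ LinearMap.ker p := hip ▸ ⟨m, rfl⟩
      simpa using this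
    simpa [this] using e
  conv_rhs => rw [← D.ell_cl l]
  ext m
  simp only [LinearMap.comp_apply, ell_apply, ← map_smul i, hri]

/-- the periodic syzygy -/
lemma syzygy [Module.Free A X] [Module.Finite A X] :
    ∃ (n : ℕ) (q : (Fin n → S) →ₗ[S] X), Function.Surjective q ∧
      ∃ e : X ≃ₗ[A] LinearMap.ker q, ∀ m, e (D.x • m) = - (D.x • e m) := by
  let ι := Module.Free.ChooseBasisIndex A X
  let b0 : Module.Basis ι A X := Module.Free.chooseBasis A X
  let b := b0.reindex (Fintype.equivFin ι)
  let q : (Fin (Fintype.card ι) → S) →ₗ[S] X := Fintype.linearCombination S b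
  have hq : ∀ r, q r = ∑ i, r i • b i := fun r => rfl
  let e0 : X →ₗ[A] (Fin (Fintype.card ι) → S) :=
    { toFun := fun m i => algebraMap A S (b.repr m i) * D.x -
        algebraMap A S (b.repr (D.x • m) i)
      map_add' := by intro a c; ext i; simp; ring
      map_smul' := by
        intro a m; ext i
        simp only [smul_comm D.x a m]
        simp [Algebra.smul_def]; ring }
  have he0 : ∀ m i, e0 m i = algebraMap A S (b.repr m i) * D.x -
        algebraMap A S (b.repr (D.x • m) i) := fun _ _ => rfl
  have hmem : ∀ m, e0 m ∈ LinearMap.ker q := by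
    intro m
    rw [LinearMap.mem_ker, hq]
    simp only [he0, sub_smul, Finset.sum_sub_distrib, algebraMap_smul, b.sum_repr]
    rw [sub_eq_zero]
    conv_rhs => rw [← b.sum_repr m]
    rw [Finset.smul_sum]
    refine Finset.sum_congr rfl fun i _ => ?_
    rw [mul_comm, mul_smul, algebraMap_smul]
  let e1 : X →ₗ[A] LinearMap.ker q :=
    { toFun := fun m => ⟨e0 m, hmem m⟩
      map_add' := fun a c => by ext1; exact e0.map_add a c
      map_smul' := fun a m => by ext1; exact e0.map_smul a m }
  have hbij : Function.Bijective e1 := by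
    constructor
    · rw [← LinearMap.ker_eq_bot, LinearMap.ker_eq_bot']
      intro m hm
      have h0 : e0 m = 0 := congrArg Subtype.val hm
      apply b.ext_elem
      intro i
      have := congrArg D.c (congrFun h0 i)
      rw [he0, map_sub, D.c_alg, D.c_algx] at this
      simpa using this
    · rintro ⟨r, hr⟩
      refine ⟨∑ i, D.c (r i) • b i, ?_⟩
      rw [LinearMap.mem_ker, hq] at hr
      have h1 : ∑ i, D.c (D.x * r i) • b i + D.x • ∑ i, D.c (r i) • b i = 0 := by
        rw [← hr, Finset.smul_sum, ← Finset.sum_add_distrib]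
        refine Finset.sum_congr rfl fun i _ => ?_
        rw [D.smul_eq (r i) (b i), smul_comm D.x]
      have h2 : D.x • ∑ i, D.c (r i) • b i = ∑ i, (-D.c (D.x * r i)) • b i := by
        rw [eq_neg_of_add_eq_zero_right h1, ← Finset.sum_neg_distrib]
        simp
      ext1
      ext i
      change e0 _ i = r i
      rw [he0, h2, b.repr_sum_self, b.repr_sum_self]
      conv_rhs => rw [D.hc (r i)]
      simp; ring
  refine ⟨_, q, ?_, LinearEquiv.ofBijective e1 hbij, ?_⟩
  · intro m
    refine ⟨fun i => algebraMap A S (b.repr m i), ?_⟩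
    rw [hq]
    simp [b.sum_repr]
  · intro m
    ext1
    ext i
    change e0 (D.x • m) i = - (D.x • e0 m) i
    rw [Pi.smul_apply, he0, he0, D.xx_smul]
    simp only [smul_eq_mul, map_neg, map_smul, Finsupp.neg_apply, Finsupp.smul_apply, map_mul]
    linear_combination (algebraMap A S (b.repr m i)) * D.hxx

/-- the conjugation -/
def sg : S →ₗ[A] S := LinearMap.id - (2 : A) • (LinearMap.toSpanSingleton A S D.x) ∘ₗ D.c

lemma sg_apply (r : S) : D.sg r = r - 2 * (algebraMap A S (D.c r) * D.x) := by
  simp [sg, Algebra.smul_def, map_ofNat]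

lemma sg_x (r : S) : D.sg (D.x * r) = - (D.x * D.sg r) := by
  rw [sg_apply, sg_apply]
  linear_combination (2 * D.x) * (D.hc r)

/-- an antisemilinear map -/
lemma anti_smul (τ : X →ₗ[A] Y) (h : ∀ m, τ (D.x • m) = - (D.x • τ m)) (r : S) (m : X) :
    τ (r • m) = D.sg r • τ m := by
  rw [D.smul_eq r m, map_add, map_smul, map_smul, h, sg_apply]
  conv_rhs => rw [sub_smul, D.smul_eq r (τ m), mul_smul, mul_smul, algebraMap_smul]
  rw [two_smul, smul_neg]; abel

lemma two_x_mem [Module.Free A X] [Module.Finite A X] :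
    (2 * D.x) • (LinearMap.id : X →ₗ[S] X) ∈ PF S X X := by
  have b := Module.Free.chooseBasis A X
  have : (2 * D.x) • (LinearMap.id : X →ₗ[S] X) = ∑ i, (D.ell (b.coord i)).smulRight (b i) := by
    ext m
    simp only [LinearMap.smul_apply, LinearMap.id_apply, LinearMap.sum_apply,
      LinearMap.smulRight_apply, ell_apply, add_smul, Finset.sum_add_distrib, Module.Basis.coord_apply,
      algebraMap_smul, b.sum_repr]
    rw [mul_smul, two_smul]
    congr 1
    conv_lhs => rw [← b.sum_repr m]
    rw [Finset.smul_sum]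
    refine Finset.sum_congr rfl fun i _ => ?_
    rw [mul_comm, mul_smul, algebraMap_smul]
  rw [this]
  exact Submodule.sum_mem _ fun i _ => smulRight_mem_PF _ _

lemma x_mem {Y : Type*} [AddCommGroup Y] [Module S Y] [Module.Free A X] [Module.Finite A X]
    (α : X →ₗ[S] Y) : D.x • α ∈ PF S X Y := by
  have h := PF_comp_left (D.two_x_mem (X := X)) α
  have h2 := (PF S X Y).smul_mem (algebraMap A S D.half) h
  convert h2 using 1
  ext m
  simp only [LinearMap.smul_apply, LinearMap.comp_apply, LinearMap.id_apply, map_smul]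
  rw [smul_smul, ← mul_assoc]
  have : algebraMap A S D.half * 2 = 1 := by
    rw [mul_comm, ← map_ofNat (algebraMap A S) 2, ← map_mul, D.hhalf, map_one]
  rw [this, one_mul]

lemma x_smul_shom {Y : Type*} [AddCommGroup Y] [Module S Y] [Module.Free A X]
    [Module.Finite A X] (z : SHom S X Y) : D.x • z = 0 := by
  obtain ⟨α, rfl⟩ := Submodule.Quotient.mk_surjective _ z
  rw [← Submodule.Quotient.mk_smul, Submodule.Quotient.mk_eq_zero]
  exact D.x_mem α

end QuadData

end

end Klein

namespace Klein

namespace QuadData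

section
variable {A S : Type*} [CommRing A] [CommRing S] [Algebra A S] (D : QuadData A S)
variable {X Y : Type*} [AddCommGroup X] [Module S X] [Module A X] [IsScalarTower A S X]
  [AddCommGroup Y] [Module S Y] [Module A Y] [IsScalarTower A S Y]

/-- `X` is anti-isomorphic to its dual -/
def HasTau (X : Type*) [AddCommGroup X] [Module S X] [Module A X] [IsScalarTower A S X] : Prop :=
  ∃ τ : X ≃ₗ[A] (X →ₗ[S] S), ∀ m, τ (D.x • m) = - (D.x • τ m)

lemma anti_symm {τ : X ≃ₗ[A] Y} (h : ∀ m, τ (D.x • m) = - (D.x • τ m)) (m : Y) :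
    τ.symm (D.x • m) = - (D.x • τ.symm m) := by
  rw [LinearEquiv.symm_apply_eq, map_neg, h, LinearEquiv.apply_symm_apply, neg_neg]

theorem symm_shom [Module.Free A X] [Module.Finite A X] [Module.Free A Y] [Module.Finite A Y]
    (hX : D.HasTau X) (hY : D.HasTau Y) : Nonempty (SHom S X Y ≃ₗ[S] SHom S Y X) := by
  obtain ⟨τX, hτX⟩ := hX
  obtain ⟨τY, hτY⟩ := hY
  have hτX' := D.anti_symm hτX
  have hτY' := D.anti_symm hτY
  let F0 (α : X →ₗ[S] Y) : Y →ₗ[A] X :=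
    { toFun := fun y => τX.symm (τY y ∘ₗ α)
      map_add' := fun a b => by rw [map_add, LinearMap.add_comp, map_add]
      map_smul' := fun a b => by rw [map_smul, LinearMap.smul_comp, map_smul]; rfl }
  have hF0 : ∀ α m, F0 α (D.x • m) = D.x • F0 α m := by
    intro α m
    change τX.symm (τY (D.x • m) ∘ₗ α) = D.x • τX.symm (τY m ∘ₗ α)
    rw [hτY, LinearMap.neg_comp, LinearMap.smul_comp, map_neg, hτX', neg_neg]
  let F : (X →ₗ[S] Y) →ₗ[A] (Y →ₗ[S] X) :=
    { toFun := fun α => D.mkLin (F0 α) (hF0 α)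
      map_add' := by
        intro a b; ext y
        change τX.symm (τY y ∘ₗ (a + b)) = τX.symm (τY y ∘ₗ a) + τX.symm (τY y ∘ₗ b)
        rw [LinearMap.comp_add, map_add]
      map_smul' := by
        intro a b; ext y
        change τX.symm (τY y ∘ₗ (a • b)) = a • τX.symm (τY y ∘ₗ b)
        rw [← map_smul]
        congr 1
        ext m
        simp only [LinearMap.comp_apply, LinearMap.smul_apply]
        rw [← algebraMap_smul S, map_smul, algebraMap_smul] }
  have hF : ∀ α y, F α y = τX.symm (τY y ∘ₗ α) := fun _ _ => rfl
  have Finj : Function.Injective F := by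
    rw [← LinearMap.ker_eq_bot, LinearMap.ker_eq_bot']
    intro α hα
    ext m
    apply D.eq_zero_of_dual
    intro l
    have h1 : F α (τY.symm l) = 0 := by rw [hα]; rfl
    rw [hF, LinearEquiv.apply_symm_apply, LinearEquiv.map_eq_zero_iff] at h1
    exact LinearMap.congr_fun h1 m
  have Fsurj : Function.Surjective F := by
    intro β
    -- functional attached to m
    let P0 (m : X) : (Y →ₗ[S] S) →ₗ[A] S :=
      { toFun := fun l => τX (β (τY.symm l)) m
        map_add' := fun a b => by simp only [map_add, LinearMap.add_apply]
        map_smul' := fun a b => by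
          rw [map_smul, ← algebraMap_smul S a (τY.symm b), map_smul, algebraMap_smul, map_smul]
          rfl }
    have hP0 : ∀ m l, P0 m (D.x • l) = D.x • P0 m l := by
      intro m l
      change τX (β (τY.symm (D.x • l))) m = D.x • τX (β (τY.symm l)) m
      rw [hτY', map_neg, map_neg, map_smul, hτX, neg_neg]; rfl
    have hex : ∀ m, ∃ y, ∀ l, P0 m l = l y := fun m => D.reflexive (D.mkLin (P0 m) (hP0 m))
    choose a ha using hex
    have ha' : ∀ m l, l (a m) = τX (β (τY.symm l)) m := fun m l => (ha m l).symm
    let α : X →ₗ[S] Y :=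
      { toFun := a
        map_add' := by
          intro m m'
          rw [← sub_eq_zero]
          apply D.eq_zero_of_dual
          intro l
          rw [map_sub, map_add, ha', ha', ha', map_add, sub_self]
        map_smul' := by
          intro r m
          rw [← sub_eq_zero]
          apply D.eq_zero_of_dual
          intro l
          rw [map_sub, map_smul, ha', ha', map_smul, RingHom.id_apply, sub_self] }
    refine ⟨α, ?_⟩
    ext y
    rw [hF, LinearEquiv.symm_apply_eq]
    ext m
    change τY y (a m) = _
    rw [ha', LinearEquiv.symm_apply_apply]
  have lin_sg : ∀ (q : Y →ₗ[A] S) (_ : ∀ m, q (D.x • m) = - (D.x • q m)), ∃ l : Y →ₗ[S] S,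
      ∀ m, l m = D.sg (q m) := by
    intro q hq
    refine ⟨D.mkLin (D.sg ∘ₗ q) ?_, fun m => rfl⟩
    intro m
    rw [LinearMap.comp_apply, hq, map_neg, smul_eq_mul, D.sg_x, neg_neg]; rfl
  have sgsg : ∀ r, D.sg (D.sg r) = r := by
    intro r
    have h : D.c (D.sg r) = - D.c r := by
      rw [D.sg_apply, map_sub, ← map_ofNat (algebraMap A S) 2, D.c_mul, D.c_algx]; ring
    rw [D.sg_apply (D.sg r), h, D.sg_apply, map_neg]; ring
  have Fsmul : ∀ (l : X →ₗ[S] S) (y : Y) (y' : Y), F (l.smulRight y) y' =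
      D.sg (τY y' y) • τX.symm l := by
    intro l y y'
    rw [hF]
    have : τY y' ∘ₗ l.smulRight y = (τY y' y) • l := by
      ext m; simp [mul_comm]
    rw [this]
    exact D.anti_smul τX.symm.toLinearMap hτX' _ _
  let E := LinearEquiv.ofBijective F ⟨Finj, Fsurj⟩
  have hmap : ((PF S X Y).restrictScalars A).map E.toLinearMap = (PF S Y X).restrictScalars A := by
    apply le_antisymm
    · rintro _ ⟨α, hα, rfl⟩
      refine PF_induction (p := fun α => F α ∈ PF S Y X) ?_ ?_ ?_ hα
      · intro l y
        let q : Y →ₗ[A] S :=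
          { toFun := fun y' => τY y' y
            map_add' := fun a b => by rw [map_add]; rfl
            map_smul' := fun a b => by rw [map_smul]; rfl }
        obtain ⟨l', hl'⟩ := lin_sg q (fun m => by
          change τY (D.x • m) y = - (D.x • τY m y); rw [hτY]; rfl)
        have : F (l.smulRight y) = l'.smulRight (τX.symm l) := by
          ext y'
          rw [Fsmul, LinearMap.smulRight_apply, hl']; rfl
        rw [this]; exact smulRight_mem_PF _ _
      · rw [map_zero]; exact zero_mem _
      · intro a b ha hb; rw [map_add]; exact add_mem ha hb
    · intro β hβ
      refine PF_induction (p := fun β => β ∈ ((PF S X Y).restrictScalars A).map E.toLinearMap)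
        ?_ ?_ ?_ hβ
      · intro l' m
        let q : (Y →ₗ[S] S) →ₗ[A] S :=
          D.sg ∘ₗ (l'.restrictScalars A) ∘ₗ τY.symm.toLinearMap
        have hq : ∀ l, q (D.x • l) = D.x • q l := by
          intro l
          change D.sg (l' (τY.symm (D.x • l))) = D.x • D.sg (l' (τY.symm l))
          rw [hτY', map_neg, map_neg, map_smul, smul_eq_mul, D.sg_x, neg_neg, smul_eq_mul]
        obtain ⟨y, hy⟩ := D.reflexive (D.mkLin q hq)
        refine ⟨(τX m).smulRight y, smulRight_mem_PF _ _, ?_⟩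
        change F _ = _
        ext y'
        rw [Fsmul, ← hy]
        change D.sg (D.sg (l' (τY.symm (τY y')))) • τX.symm (τX m) = _
        rw [sgsg, LinearEquiv.symm_apply_apply, LinearEquiv.symm_apply_apply,
          LinearMap.smulRight_apply]
      · exact zero_mem _
      · intro a b ha hb; exact add_mem ha hb
  let E2 : SHom S X Y ≃ₗ[A] SHom S Y X :=
    (Submodule.Quotient.restrictScalarsEquiv A (PF S X Y)).symm ≪≫ₗ
      Submodule.Quotient.equiv _ _ E hmap ≪≫ₗ
      (Submodule.Quotient.restrictScalarsEquiv A (PF S Y X))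
  refine ⟨D.mkEquiv E2 ?_⟩
  intro m
  rw [D.x_smul_shom, D.x_smul_shom, map_zero]

/-- two-periodicity of the stable Hom in the second variable -/
theorem period (D : QuadData A S) {W W₁ W₂ T₀ T₁ X₁ X₂ Q₀ Q₁ : Type*}
    [AddCommGroup W] [Module S W] [Module A W] [IsScalarTower A S W]
    [AddCommGroup W₁] [Module S W₁] [Module A W₁] [IsScalarTower A S W₁]
    [AddCommGroup W₂] [Module S W₂]
    [AddCommGroup T₀] [Module S T₀] [Module A T₀] [IsScalarTower A S T₀]
    [AddCommGroup T₁] [Module S T₁] [Module A T₁] [IsScalarTower A S T₁]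
    [AddCommGroup X₁] [Module S X₁]
    [AddCommGroup X₂] [Module S X₂] [AddCommGroup Q₀] [Module S Q₀] [AddCommGroup Q₁] [Module S Q₁]
    [Module.Finite S T₀] [Module.Projective S T₀] [Module.Finite S T₁] [Module.Projective S T₁]
    [Module.Finite S Q₀] [Module.Projective S Q₀] [Module.Finite S Q₁] [Module.Projective S Q₁]
    [Module.Projective A W] [Module.Projective A W₁] [Module.Free A X] [Module.Finite A X]
    {i₀ : W₁ →ₗ[S] T₀} {p₀ : T₀ →ₗ[S] W} {i₁ : W₂ →ₗ[S] T₁} {p₁ : T₁ →ₗ[S] W₁}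
    (hi₀ : Function.Injective i₀) (hip₀ : LinearMap.range i₀ = LinearMap.ker p₀)
    (hp₀ : Function.Surjective p₀)
    (hi₁ : Function.Injective i₁) (hip₁ : LinearMap.range i₁ = LinearMap.ker p₁)
    (hp₁ : Function.Surjective p₁)
    {j₀ : X₁ →ₗ[S] Q₀} {q₀ : Q₀ →ₗ[S] X} {j₁ : X₂ →ₗ[S] Q₁} {q₁ : Q₁ →ₗ[S] X₁}
    (hj₀ : Function.Injective j₀) (hjq₀ : LinearMap.range j₀ = LinearMap.ker q₀)
    (hq₀ : Function.Surjective q₀)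
    (hj₁ : Function.Injective j₁) (hjq₁ : LinearMap.range j₁ = LinearMap.ker q₁)
    (hq₁ : Function.Surjective q₁) :
    Nonempty (SHom S W₂ X₂ ≃ₗ[S] SHom S W₂ X) := by
  obtain ⟨a1⟩ := shift hip₀ hp₀ hj₀ hjq₀ hq₀ (D.extend hi₀ hip₀ hp₀)
  obtain ⟨a2⟩ := shift hip₁ hp₁ hj₁ hjq₁ hq₁ (D.extend hi₁ hip₁ hp₁)
  obtain ⟨n, q, hq, e, he⟩ := D.syzygy (X := X)
  have : Module.Free A (LinearMap.ker q) := Module.Free.of_equiv e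
  have : Module.Finite A (LinearMap.ker q) := Module.Finite.equiv e
  obtain ⟨n', q', hq', e', he'⟩ := D.syzygy (X := LinearMap.ker q)
  obtain ⟨b1⟩ := shift hip₀ hp₀ (j := (LinearMap.ker q).subtype) (q := q)
    Subtype.val_injective (Submodule.range_subtype _) hq (D.extend hi₀ hip₀ hp₀)
  obtain ⟨b2⟩ := shift hip₁ hp₁ (j := (LinearMap.ker q').subtype) (q := q')
    Subtype.val_injective (Submodule.range_subtype _) hq' (D.extend hi₁ hip₁ hp₁)
  let E : X ≃ₗ[S] LinearMap.ker q' := D.mkEquiv (e ≪≫ₗ e') (by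
    intro m
    simp only [LinearEquiv.trans_apply, he, map_neg, he', neg_neg])
  obtain ⟨b3⟩ := shom_congr_right (X := W₂) E
  exact ⟨a2.symm ≪≫ₗ a1.symm ≪≫ₗ b1 ≪≫ₗ b2 ≪≫ₗ b3.symm⟩

end

end QuadData

end Klein

namespace Klein

/-- The homology of `Hom(T, N)` is a stable Hom. -/
lemma homology_sc {S : Type} [CommRing S] {α : Type} [AddRightCancelSemigroup α] [One α]
    (T : ChainComplex (ModuleCat.{0} S) α) (N : ModuleCat.{0} S) (i j k : α)
    (hi : (ComplexShape.up α).prev j = i) (hk : (ComplexShape.up α).next j = k)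
    (hex : LinearMap.range (T.d k j).hom = LinearMap.ker (T.d j i).hom)
    [Module.Finite S (T.X i)] [Module.Projective S (T.X i)]
    (hext : ∀ l : LinearMap.range (T.d j i).hom →ₗ[S] S, ∃ l' : T.X i →ₗ[S] S,
      l' ∘ₗ (LinearMap.range (T.d j i).hom).subtype = l) :
    Nonempty ((T.linearYonedaObj S N).homology j ≃ₗ[S] SHom S (LinearMap.range (T.d j i).hom) N) := by
  let C := (T.linearYonedaObj S N).sc' i j k
  let e : (T.linearYonedaObj S N).homology j ≃ₗ[S]
      (LinearMap.ker C.g.hom ⧸ LinearMap.range C.moduleCatToCycles) :=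
    (((T.linearYonedaObj S N).homologyIsoSc' i j k hi hk) ≪≫ C.moduleCatHomologyIso).toLinearEquiv
  let p : T.X j →ₗ[S] LinearMap.range (T.d j i).hom := (T.d j i).hom.rangeRestrict
  have hp : Function.Surjective p := LinearMap.surjective_rangeRestrict _
  let F0 : (LinearMap.range (T.d j i).hom →ₗ[S] N) →ₗ[S] (T.X j ⟶ N) :=
    { toFun := fun a => ModuleCat.ofHom (a ∘ₗ p)
      map_add' := fun a b => by rw [LinearMap.add_comp]; rfl
      map_smul' := fun a b => by rw [LinearMap.smul_comp]; rfl }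
  let F1 : (LinearMap.range (T.d j i).hom →ₗ[S] N) →ₗ[S] LinearMap.ker C.g.hom :=
    LinearMap.codRestrict (LinearMap.ker C.g.hom) F0 (by
      intro a
      change T.d k j ≫ F0 a = 0
      ext t
      change a (p (T.d k j t)) = 0
      have : p (T.d k j t) = 0 := by
        apply Subtype.ext
        change (T.d j i).hom ((T.d k j).hom t) = 0
        rw [← LinearMap.mem_ker, ← hex]; exact ⟨t, rfl⟩
      rw [this, map_zero])
  have hF1 : Function.Surjective F1 := by
    rintro ⟨φ, hφ⟩
    have hφ' : T.d k j ≫ (show T.X j ⟶ N from φ) = 0 := hφ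
    obtain ⟨γ, hγ⟩ := exists_desc hp (show T.X j ⟶ N from φ).hom (by
      intro t ht
      have ht' : t ∈ LinearMap.range (T.d k j).hom := by
        rw [hex]; exact congrArg Subtype.val ht
      obtain ⟨s, rfl⟩ := ht'
      exact LinearMap.congr_fun (congrArg ModuleCat.Hom.hom hφ') s)
    refine ⟨γ, Subtype.ext ?_⟩
    change ModuleCat.ofHom (γ ∘ₗ p) = (show T.X j ⟶ N from φ)
    rw [hγ]; rfl
  obtain ⟨E⟩ := equiv_of_ker_eq ((LinearMap.range C.moduleCatToCycles).mkQ ∘ₗ F1) (PF S _ N).mkQ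
    ((Submodule.mkQ_surjective _).comp hF1) (Submodule.mkQ_surjective _) (by
      rw [LinearMap.ker_comp, Submodule.ker_mkQ, Submodule.ker_mkQ]
      ext a
      constructor
      · rintro ⟨β, hβ⟩
        have h1 : T.d j i ≫ (show T.X i ⟶ N from β) = F0 a := congrArg Subtype.val hβ
        have h2 : a = (show T.X i ⟶ N from β).hom ∘ₗ (LinearMap.range (T.d j i).hom).subtype := by
          refine LinearMap.ext fun z => ?_
          obtain ⟨t, rfl⟩ := hp z
          exact (LinearMap.congr_fun (congrArg ModuleCat.Hom.hom h1) t).symm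
        rw [h2]
        exact PF_comp_right (mem_PF_of_proj_left _) _
      · intro ha
        obtain ⟨γ, rfl⟩ := PF_extend ha _ hext
        refine ⟨(ModuleCat.ofHom γ : T.X i ⟶ N), Subtype.ext ?_⟩
        change T.d j i ≫ ModuleCat.ofHom γ = ModuleCat.ofHom _
        ext t
        rfl)
  exact ⟨e ≪≫ₗ E⟩

/-- exactness of a module complex -/
lemma exact_of_exactAt {S : Type} [CommRing S] {α : Type} [AddRightCancelSemigroup α] [One α]
    (T : ChainComplex (ModuleCat.{0} S) α) (i j k : α)
    (hi : (ComplexShape.down α).prev j = k) (hk : (ComplexShape.down α).next j = i)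
    (h : T.ExactAt j) : LinearMap.range (T.d k j).hom = LinearMap.ker (T.d j i).hom := by
  rw [T.exactAt_iff' k j i hi hk] at h
  exact (ShortComplex.moduleCat_exact_iff_range_eq_ker _).1 h

end Klein

namespace Klein

section
variable {A S : Type} [CommRing A] [CommRing S] [Algebra A S] (D : QuadData A S)

/-- finite free over `A`, and anti-isomorphic to its dual -/
def MCM (X : Type) [AddCommGroup X] [Module S X] : Prop :=
  letI : Module A X := Module.compHom X (algebraMap A S)
  letI : IsScalarTower A S X := IsScalarTower.of_algebraMap_smul fun _ _ => rfl
  Module.Free A X ∧ Module.Finite A X ∧ D.HasTau X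

variable {X Y X' Y' T Q W W₁ W₂ T₀ T₁ X₁ X₂ Q₀ Q₁ : Type}
  [AddCommGroup X] [Module S X] [AddCommGroup Y] [Module S Y]
  [AddCommGroup X'] [Module S X'] [AddCommGroup Y'] [Module S Y']
  [AddCommGroup T] [Module S T] [AddCommGroup Q] [Module S Q]
  [AddCommGroup W] [Module S W] [AddCommGroup W₁] [Module S W₁] [AddCommGroup W₂] [Module S W₂]
  [AddCommGroup T₀] [Module S T₀] [AddCommGroup T₁] [Module S T₁]
  [AddCommGroup X₁] [Module S X₁] [AddCommGroup X₂] [Module S X₂]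
  [AddCommGroup Q₀] [Module S Q₀] [AddCommGroup Q₁] [Module S Q₁]

variable {D}

lemma MCM.ext (hX : MCM D X) {i : X' →ₗ[S] T} {p : T →ₗ[S] X} (hi : Function.Injective i)
    (hip : LinearMap.range i = LinearMap.ker p) (hp : Function.Surjective p)
    (l : X' →ₗ[S] S) : ∃ l' : T →ₗ[S] S, l' ∘ₗ i = l := by
  let : Module A X := Module.compHom X (algebraMap A S)
  let : IsScalarTower A S X := IsScalarTower.of_algebraMap_smul fun _ _ => rfl
  let : Module A T := Module.compHom T (algebraMap A S)
  let : IsScalarTower A S T := IsScalarTower.of_algebraMap_smul fun _ _ => rfl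
  have : Module.Free A X := hX.1
  exact D.extend hi hip hp l

lemma MCM.symm (hX : MCM D X) (hY : MCM D Y) : Nonempty (SHom S X Y ≃ₗ[S] SHom S Y X) := by
  let : Module A X := Module.compHom X (algebraMap A S)
  let : IsScalarTower A S X := IsScalarTower.of_algebraMap_smul fun _ _ => rfl
  let : Module A Y := Module.compHom Y (algebraMap A S)
  let : IsScalarTower A S Y := IsScalarTower.of_algebraMap_smul fun _ _ => rfl
  have : Module.Free A X := hX.1
  have : Module.Finite A X := hX.2.1
  have : Module.Free A Y := hY.1
  have : Module.Finite A Y := hY.2.1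
  exact D.symm_shom hX.2.2 hY.2.2

lemma MCM.period (hX : MCM D X) (hW : MCM D W) (hW₁ : MCM D W₁)
    [Module.Finite S T₀] [Module.Projective S T₀] [Module.Finite S T₁] [Module.Projective S T₁]
    [Module.Finite S Q₀] [Module.Projective S Q₀] [Module.Finite S Q₁] [Module.Projective S Q₁]
    {i₀ : W₁ →ₗ[S] T₀} {p₀ : T₀ →ₗ[S] W} {i₁ : W₂ →ₗ[S] T₁} {p₁ : T₁ →ₗ[S] W₁}
    (hi₀ : Function.Injective i₀) (hip₀ : LinearMap.range i₀ = LinearMap.ker p₀)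
    (hp₀ : Function.Surjective p₀)
    (hi₁ : Function.Injective i₁) (hip₁ : LinearMap.range i₁ = LinearMap.ker p₁)
    (hp₁ : Function.Surjective p₁)
    {j₀ : X₁ →ₗ[S] Q₀} {q₀ : Q₀ →ₗ[S] X} {j₁ : X₂ →ₗ[S] Q₁} {q₁ : Q₁ →ₗ[S] X₁}
    (hj₀ : Function.Injective j₀) (hjq₀ : LinearMap.range j₀ = LinearMap.ker q₀)
    (hq₀ : Function.Surjective q₀)
    (hj₁ : Function.Injective j₁) (hjq₁ : LinearMap.range j₁ = LinearMap.ker q₁)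
    (hq₁ : Function.Surjective q₁) :
    Nonempty (SHom S W₂ X₂ ≃ₗ[S] SHom S W₂ X) := by
  let : Module A X := Module.compHom X (algebraMap A S)
  let : IsScalarTower A S X := IsScalarTower.of_algebraMap_smul fun _ _ => rfl
  let : Module A W := Module.compHom W (algebraMap A S)
  let : IsScalarTower A S W := IsScalarTower.of_algebraMap_smul fun _ _ => rfl
  let : Module A W₁ := Module.compHom W₁ (algebraMap A S)
  let : IsScalarTower A S W₁ := IsScalarTower.of_algebraMap_smul fun _ _ => rfl
  let : Module A T₀ := Module.compHom T₀ (algebraMap A S)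
  let : IsScalarTower A S T₀ := IsScalarTower.of_algebraMap_smul fun _ _ => rfl
  let : Module A T₁ := Module.compHom T₁ (algebraMap A S)
  let : IsScalarTower A S T₁ := IsScalarTower.of_algebraMap_smul fun _ _ => rfl
  have : Module.Free A X := hX.1
  have : Module.Finite A X := hX.2.1
  have : Module.Free A W := hW.1
  have : Module.Free A W₁ := hW₁.1
  exact D.period hi₀ hip₀ hp₀ hi₁ hip₁ hp₁ hj₀ hjq₀ hq₀ hj₁ hjq₁ hq₁

/-- A doubly infinite exact sequence of f.g. projectives, with MCM syzygies. -/
structure Seq (D : QuadData A S) where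
  T : ℤ → Type
  [acg : ∀ i, AddCommGroup (T i)]
  [mod : ∀ i, Module S (T i)]
  [fin : ∀ i, Module.Finite S (T i)]
  [proj : ∀ i, Module.Projective S (T i)]
  d : ∀ i, T (i + 1) →ₗ[S] T i
  ex : ∀ i, LinearMap.range (d (i + 1)) = LinearMap.ker (d i)
  mcm : ∀ i, MCM D (LinearMap.range (d i))

attribute [instance] Seq.acg Seq.mod Seq.fin Seq.proj

namespace Seq

abbrev Z (U : Seq D) (i : ℤ) : Submodule S (U.T i) := LinearMap.range (U.d i)

abbrev p (U : Seq D) (i : ℤ) : U.T (i + 1) →ₗ[S] U.Z i := (U.d i).rangeRestrict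

lemma p_surj (U : Seq D) (i : ℤ) : Function.Surjective (U.p i) := LinearMap.surjective_rangeRestrict _

lemma ip (U : Seq D) (i : ℤ) : LinearMap.range (U.Z (i + 1)).subtype = LinearMap.ker (U.p i) := by
  rw [Submodule.range_subtype, LinearMap.ker_rangeRestrict]; exact U.ex i

lemma ext1 (U : Seq D) (i : ℤ) (l : U.Z (i + 1) →ₗ[S] S) :
    ∃ l' : U.T (i + 1) →ₗ[S] S, l' ∘ₗ (U.Z (i + 1)).subtype = l :=
  (U.mcm i).ext Subtype.val_injective (U.ip i) (U.p_surj i) l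

lemma ext0 (U : Seq D) (i : ℤ) (l : U.Z i →ₗ[S] S) :
    ∃ l' : U.T i →ₗ[S] S, l' ∘ₗ (U.Z i).subtype = l := by
  obtain ⟨k, rfl⟩ : ∃ k, i = k + 1 := ⟨i - 1, by ring⟩
  exact U.ext1 k l

/-- stable equivalence -/
def sh (U V : Seq D) (a b a' b' : ℤ) : Prop :=
  Nonempty (SHom S (U.Z a) (V.Z b) ≃ₗ[S] SHom S (U.Z a') (V.Z b'))

lemma sh_succ (U V : Seq D) (a b : ℤ) : sh U V a b (a + 1) (b + 1) :=
  shift (U.ip a) (U.p_surj a) (Subtype.val_injective) (V.ip b) (V.p_surj b) (U.ext1 a)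

lemma sh_trans {U V : Seq D} {a b a' b' a'' b'' : ℤ} (h : sh U V a b a' b') (h' : sh U V a' b' a'' b'') :
    sh U V a b a'' b'' := by
  obtain ⟨e⟩ := h
  obtain ⟨e'⟩ := h'
  exact ⟨e ≪≫ₗ e'⟩

lemma sh_symm {U V : Seq D} {a b a' b' : ℤ} (h : sh U V a b a' b') : sh U V a' b' a b := by
  obtain ⟨e⟩ := h
  exact ⟨e.symm⟩

lemma sh_refl (U V : Seq D) (a b : ℤ) : sh U V a b a b := ⟨LinearEquiv.refl _ _⟩

lemma sh_add (U V : Seq D) (a b : ℤ) (n : ℕ) : sh U V a b (a + n) (b + n) := by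
  induction n with
  | zero => simpa using sh_refl U V a b
  | succ n ih =>
    have := sh_trans ih (sh_succ U V (a + n) (b + n))
    convert this using 1 <;> push_cast <;> ring

lemma sh_period (U V : Seq D) (a b : ℤ) : sh U V a (b + 1 + 1) a b := by
  obtain ⟨k, rfl⟩ : ∃ k, a = k + 1 + 1 := ⟨a - 2, by ring⟩
  exact (V.mcm b).period (U.mcm k) (U.mcm (k+1)) Subtype.val_injective (U.ip k) (U.p_surj k)
    Subtype.val_injective (U.ip (k+1)) (U.p_surj (k+1)) Subtype.val_injective (V.ip b) (V.p_surj b)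
    Subtype.val_injective (V.ip (b+1)) (V.p_surj (b+1))

lemma sh_periods (U V : Seq D) (a b : ℤ) (n : ℕ) : sh U V a (b + 2 * n) a b := by
  induction n with
  | zero => simpa using sh_refl U V a b
  | succ n ih =>
    have := sh_trans (sh_period U V a (b + 2 * n)) ih
    convert this using 1; push_cast; ring

lemma sh_swap (U V : Seq D) (n : ℤ) (j : ℤ) : sh U V j (n + j) (n + j) j := by
  rcases le_total 0 n with h | h
  · obtain ⟨m, rfl⟩ := Int.eq_ofNat_of_zero_le h
    have h1 := sh_add U V j (-m + j) m
    have h2 := sh_periods U V j (-m + j) m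
    have := sh_trans h2 h1
    convert this using 1 <;> ring
  · obtain ⟨m, hm⟩ := Int.eq_ofNat_of_zero_le (neg_nonneg.2 h)
    obtain rfl : n = -m := by omega
    have h1 := sh_add U V (-m + j) j m
    have h2 := sh_periods U V j (-m + j) m
    exact sh_symm (sh_trans h1 (by convert h2 using 1 <;> ring))

end Seq

end

end Klein

namespace Klein

section
variable {A S : Type} [CommRing A] [CommRing S] [Algebra A S] {D : QuadData A S}

/-- kernels of maps of f.g. projectives are MCM -/
def KerMCM (D : QuadData A S) : Prop :=
  ∀ (T₁ T₀ : Type) [AddCommGroup T₁] [Module S T₁] [AddCommGroup T₀] [Module S T₀]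
    [Module.Finite S T₁] [Module.Projective S T₁] [Module.Finite S T₀] [Module.Projective S T₀]
    (f : T₁ →ₗ[S] T₀), MCM D (LinearMap.ker f)

lemma proj_of (X : ModuleCat.{0} S) (h : Projective X) : Module.Projective S X :=
  (IsProjective.iff_projective X).2 h

def seqOf (hK : KerMCM D) {M : ModuleCat.{0} S} (C : CompleteResolution S M) : Seq D :=
  have := C.fgT
  have := fun i => proj_of (C.T.X i) (C.projT i)
  have hex : ∀ i : ℤ, LinearMap.range (C.T.d (i + 1 + 1) (i + 1)).hom =
      LinearMap.ker (C.T.d (i + 1) i).hom :=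
    fun i => exact_of_exactAt C.T i (i + 1) (i + 1 + 1) (by simp) (by simp) (C.exactT _)
  { T := fun i => C.T.X i
    d := fun i => (C.T.d (i + 1) i).hom
    ex := hex
    mcm := fun i => by
      obtain ⟨k, rfl⟩ : ∃ k, i = k + 1 := ⟨i - 1, by ring⟩
      rw [hex]
      exact hK _ _ _ }

lemma tate_eq (hK : KerMCM D) {M : ModuleCat.{0} S} (C : CompleteResolution S M) (N : ModuleCat.{0} S)
    (i : ℤ) : Nonempty (TateExt S C N (i + 1) ≃ₗ[S] SHom S ((seqOf hK C).Z i) N) := by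
  have := C.fgT i
  have := proj_of (C.T.X i) (C.projT i)
  exact homology_sc C.T N i (i + 1) (i + 1 + 1) (by simp) (by simp) ((seqOf hK C).ex i)
    ((seqOf hK C).ext0 i)

lemma shift_P (U : Seq D) {N : ModuleCat.{0} S} (C : CompleteResolution S N) (k : ℤ) (j : ℕ) (a : ℤ)
    (ha : a = k + 1 + j) : Nonempty (SHom S (U.Z k) N ≃ₗ[S] SHom S (U.Z a)
      (LinearMap.range (C.P.d ((j : ℤ) + 1) (j : ℤ)).hom)) := by
  have := C.fgP
  have := fun i => proj_of (C.P.X i) (C.projP i)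
  induction j generalizing a with
  | zero =>
    obtain rfl : a = k + 1 := by simpa using ha
    have h1 := (ShortComplex.moduleCat_exact_iff_range_eq_ker _).1 C.exact0
    have h2 := (ModuleCat.epi_iff_surjective _).1 C.epiπ
    have := shift (U.ip k) (U.p_surj k) (j := (LinearMap.range (C.P.d 1 0).hom).subtype)
      (q := C.π.hom) Subtype.val_injective (by rw [Submodule.range_subtype]; exact h1) h2 (U.ext1 k)
    exact this
  | succ j ih =>
    obtain ⟨e⟩ := ih (k + 1 + j) rfl
    obtain rfl : a = k + 1 + j + 1 := by push_cast at ha; linarith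
    obtain ⟨e'⟩ := shift (U.ip (k + 1 + j)) (U.p_surj (k + 1 + j))
      (j := (LinearMap.range (C.P.d ((j : ℤ) + 1 + 1) ((j : ℤ) + 1)).hom).subtype)
      (q := (C.P.d ((j : ℤ) + 1) (j : ℤ)).hom.rangeRestrict) Subtype.val_injective (by
        rw [Submodule.range_subtype, LinearMap.ker_rangeRestrict]
        exact exact_of_exactAt C.P j (j + 1) (j + 1 + 1) (by simp) (by simp)
          (C.exactP _ (by positivity)))
      (LinearMap.surjective_rangeRestrict _) (U.ext1 _)
    exact ⟨e ≪≫ₗ e'⟩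

lemma range_equiv {N : ModuleCat.{0} S} (C : CompleteResolution S N) (j : ℤ)
    [IsIso (C.θ.f j)] [IsIso (C.θ.f (j + 1))] :
    Nonempty (LinearMap.range (C.P.d (j + 1) j).hom ≃ₗ[S] LinearMap.range (C.T.d (j + 1) j).hom) := by
  let e := (asIso (C.θ.f j)).toLinearEquiv
  let e' := (asIso (C.θ.f (j + 1))).toLinearEquiv
  have h : ∀ t, e ((C.T.d (j + 1) j).hom t) = (C.P.d (j + 1) j).hom (e' t) := fun t =>
    (LinearMap.congr_fun (congrArg ModuleCat.Hom.hom (C.θ.comm (j + 1) j)) t).symm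
  refine ⟨(LinearEquiv.ofSubmodules e _ _ ?_).symm⟩
  ext z
  constructor
  · rintro ⟨_, ⟨t, rfl⟩, rfl⟩
    exact ⟨e' t, (h t).symm⟩
  · rintro ⟨t, rfl⟩
    refine ⟨_, ⟨e'.symm t, rfl⟩, ?_⟩
    have := h (e'.symm t)
    rw [LinearEquiv.apply_symm_apply] at this
    exact this

lemma tate_stable (hK : KerMCM D) {M N : ModuleCat.{0} S} (CM : CompleteResolution S M)
    (CN : CompleteResolution S N) (i : ℤ) : ∃ n₀ : ℕ, ∀ j : ℕ, n₀ ≤ j →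
      Nonempty (TateExt S CM N (i + 1) ≃ₗ[S]
        SHom S ((seqOf hK CM).Z (i + 1 + j)) ((seqOf hK CN).Z j)) := by
  obtain ⟨n₀, hn⟩ := CN.iso_eventually
  refine ⟨n₀.toNat, fun j hj => ?_⟩
  have := hn j (by omega)
  have := hn (j + 1) (by omega)
  obtain ⟨e⟩ := range_equiv CN j
  obtain ⟨a⟩ := tate_eq hK CM N i
  obtain ⟨b⟩ := shift_P (seqOf hK CM) CN i j _ rfl
  obtain ⟨c⟩ := shom_congr_right (X := (seqOf hK CM).Z (i + 1 + j)) e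
  exact ⟨a ≪≫ₗ b ≪≫ₗ c⟩

theorem tate_symm (hK : KerMCM D) {M N : ModuleCat.{0} S} (CM : CompleteResolution S M)
    (CN : CompleteResolution S N) (i : ℤ) :
    Nonempty (TateExt S CM N i ≃ₗ[S] TateExt S CN M i) := by
  obtain ⟨k, rfl⟩ : ∃ k, i = k + 1 := ⟨i - 1, by ring⟩
  obtain ⟨n₁, h₁⟩ := tate_stable hK CM CN k
  obtain ⟨n₂, h₂⟩ := tate_stable hK CN CM k
  obtain ⟨a⟩ := h₁ (max n₁ n₂) (le_max_left _ _)
  obtain ⟨b⟩ := h₂ (max n₁ n₂) (le_max_right _ _)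
  obtain ⟨c⟩ := ((seqOf hK CM).mcm (k + 1 + (max n₁ n₂ : ℕ))).symm ((seqOf hK CN).mcm (max n₁ n₂ : ℕ))
  obtain ⟨d⟩ := Seq.sh_swap (seqOf hK CN) (seqOf hK CM) (k + 1) (max n₁ n₂ : ℕ)
  exact ⟨a ≪≫ₗ c ≪≫ₗ d ≪≫ₗ b.symm⟩

end

end Klein

namespace Klein

section
variable {A S : Type} [CommRing A] [CommRing S] [Algebra A S] {D : QuadData A S}

/-- all finite `A`-free modules are anti-isomorphic to their duals -/
def AllTau (D : QuadData A S) : Prop :=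
  ∀ (X : Type) [AddCommGroup X] [Module S X] [Module A X] [IsScalarTower A S X],
    Module.Free A X → Module.Finite A X → D.HasTau X

lemma AllTau.mcm (h : AllTau D) (X : Type) [AddCommGroup X] [Module S X] [inst : Module A X]
    [IsScalarTower A S X] (h1 : Module.Free A X) (h2 : Module.Finite A X) : MCM D X := by
  have : inst = Module.compHom X (algebraMap A S) := by
    refine Module.ext' _ _ fun r m => ?_
    exact (algebraMap_smul S r m).symm
  subst this
  exact ⟨h1, h2, @h X _ _ (_) (_) h1 h2⟩

lemma AllTau.step (h : AllTau D) (X : Type) [AddCommGroup X] [Module S X] (hX : MCM D X) :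
    ∃ (n : ℕ) (q : (Fin n → S) →ₗ[S] X), Function.Surjective q ∧ MCM D (LinearMap.ker q) := by
  let : Module A X := Module.compHom X (algebraMap A S)
  let : IsScalarTower A S X := IsScalarTower.of_algebraMap_smul fun _ _ => rfl
  have : Module.Free A X := hX.1
  have : Module.Finite A X := hX.2.1
  obtain ⟨n, q, hq, e, -⟩ := D.syzygy (X := X)
  exact ⟨n, q, hq, h.mcm _ (Module.Free.of_equiv e) (Module.Finite.equiv e)⟩

/-- bundled MCM module -/
structure MX (D : QuadData A S) where
  X : Type
  [acg : AddCommGroup X]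
  [mod : Module S X]
  h : MCM D X

attribute [instance] MX.acg MX.mod

namespace MX

variable (hT : AllTau D)

def b (X : MX D) : ℕ := (hT.step X.X X.h).choose
def q (X : MX D) : (Fin (X.b hT) → S) →ₗ[S] X.X := (hT.step X.X X.h).choose_spec.choose
lemma q_surj (X : MX D) : Function.Surjective (X.q hT) := (hT.step X.X X.h).choose_spec.choose_spec.1
def next (X : MX D) : MX D where
  X := LinearMap.ker (X.q hT)
  acg := (LinearMap.ker (X.q hT)).addCommGroup
  mod := (LinearMap.ker (X.q hT)).module
  h := (hT.step X.X X.h).choose_spec.choose_spec.2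

def K (X : MX D) : ℕ → MX D
  | 0 => X
  | n + 1 => (X.K n).next hT

abbrev F (X : MX D) (n : ℕ) : ModuleCat.{0} S := ModuleCat.of S (Fin ((X.K hT n).b hT) → S)

abbrev inc (X : MX D) (n : ℕ) : (X.K hT (n+1)).X →ₗ[S] (Fin ((X.K hT n).b hT) → S) :=
  (LinearMap.ker ((X.K hT n).q hT)).subtype

lemma inc_inj (X : MX D) (n : ℕ) : Function.Injective (X.inc hT n) := Subtype.val_injective

lemma range_inc (X : MX D) (n : ℕ) : LinearMap.range (X.inc hT n) = LinearMap.ker ((X.K hT n).q hT) :=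
  Submodule.range_subtype _

def d (X : MX D) (n : ℕ) : (Fin ((X.K hT (n+1)).b hT) → S) →ₗ[S] (Fin ((X.K hT n).b hT) → S) :=
  X.inc hT n ∘ₗ (X.K hT (n + 1)).q hT

lemma range_d (X : MX D) (n : ℕ) : LinearMap.range (X.d hT n) = LinearMap.ker ((X.K hT n).q hT) := by
  rw [d, LinearMap.range_comp_of_range_eq_top _ (LinearMap.range_eq_top.2 (q_surj hT _)), range_inc]

lemma ker_d (X : MX D) (n : ℕ) : LinearMap.ker (X.d hT n) = LinearMap.ker ((X.K hT (n+1)).q hT) := by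
  rw [d, LinearMap.ker_comp_of_ker_eq_bot _ (LinearMap.ker_eq_bot.2 (inc_inj hT _ _))]

lemma ex (X : MX D) (n : ℕ) : LinearMap.range (X.d hT (n+1)) = LinearMap.ker (X.d hT n) := by
  rw [range_d, ker_d]

def cx (X : MX D) : ChainComplex (ModuleCat.{0} S) ℕ :=
  ChainComplex.of (X.F hT) (fun n => ModuleCat.ofHom (X.d hT n)) (fun n => by
    rw [← ModuleCat.ofHom_comp, LinearMap.range_le_ker_iff.1 (X.ex hT n).le]; rfl)

lemma cx_d (X : MX D) (n : ℕ) : (X.cx hT).d (n + 1) n = ModuleCat.ofHom (X.d hT n) :=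
  ChainComplex.of_d (X.F hT) (fun n => ModuleCat.ofHom (X.d hT n)) n

def aug (X : MX D) : (X.cx hT).X 0 ⟶ ModuleCat.of S X.X := ModuleCat.ofHom (X.q hT)

lemma w_aug (X : MX D) : (X.cx hT).d 1 0 ≫ X.aug hT = 0 := by
  rw [cx_d]
  refine ModuleCat.hom_ext ?_
  exact LinearMap.range_le_ker_iff.1 (X.range_d hT 0).le

def res (X : MX D) : ProjectiveResolution (ModuleCat.of S X.X) where
  complex := X.cx hT
  projective n := (IsProjective.iff_projective _).1 (inferInstanceAs
    (Module.Projective S (Fin ((X.K hT n).b hT) → S)))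
  π := (ChainComplex.toSingle₀Equiv _ _).symm ⟨X.aug hT, X.w_aug hT⟩
  quasiIso := ⟨fun n => by
    cases n with
    | zero =>
      rw [ChainComplex.quasiIsoAt₀_iff, ShortComplex.quasiIso_iff_of_zeros']
      · refine (ShortComplex.exact_and_epi_g_iff_of_iso
          (S₂ := ShortComplex.mk ((X.cx hT).d 1 0) (X.aug hT) (X.w_aug hT)) ?_).2 ⟨?_, ?_⟩
        · exact ShortComplex.isoMk (Iso.refl _) (Iso.refl _) (Iso.refl _)
            ((Category.id_comp _).trans (Category.comp_id _).symm)
            ((Category.id_comp _).trans (Category.comp_id _).symm)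
        · rw [ShortComplex.moduleCat_exact_iff_range_eq_ker]
          change LinearMap.range ((X.cx hT).d 1 0).hom = LinearMap.ker (X.q hT)
          rw [cx_d]
          exact X.range_d hT 0
        · rw [ModuleCat.epi_iff_surjective]
          exact X.q_surj hT
      all_goals rfl
    | succ n =>
      rw [quasiIsoAt_iff_exactAt']
      · rw [HomologicalComplex.exactAt_iff' _ (n + 2) (n + 1) n (by simp) (by simp)]
        rw [ShortComplex.moduleCat_exact_iff_range_eq_ker]
        change LinearMap.range ((X.cx hT).d (n + 1 + 1) (n + 1)).hom =
          LinearMap.ker ((X.cx hT).d (n + 1) n).hom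
        rw [cx_d, cx_d]
        exact X.ex hT n
      · apply ChainComplex.exactAt_succ_single_obj⟩

lemma K_ext (X : MX D) (k : ℕ) (l : (X.K hT (k + 1)).X →ₗ[S] S) :
    ∃ l' : (Fin ((X.K hT k).b hT) → S) →ₗ[S] S, l' ∘ₗ X.inc hT k = l :=
  (X.K hT k).h.ext (X.inc_inj hT k) (X.range_inc hT k) ((X.K hT k).q_surj hT) l

lemma ext_eq (X : MX D) (N : ModuleCat.{0} S) (k : ℕ) :
    Nonempty (ExtMod S (k + 1) (ModuleCat.of S X.X) N ≃ₗ[S] SHom S (X.K hT (k + 1)).X N) := by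
  have e := ((X.res hT).isoExt (R := S) (k + 1) N).toLinearEquiv
  have h0 : LinearMap.range ((X.cx hT).d (k + 1) k).hom = LinearMap.ker ((X.K hT k).q hT) := by
    rw [cx_d]; exact X.range_d hT k
  have : Module.Finite S ((X.cx hT).X k) :=
    inferInstanceAs (Module.Finite S (Fin ((X.K hT k).b hT) → S))
  have : Module.Projective S ((X.cx hT).X k) :=
    inferInstanceAs (Module.Projective S (Fin ((X.K hT k).b hT) → S))
  obtain ⟨e'⟩ := homology_sc (X.cx hT) N k (k + 1) (k + 1 + 1) (by simp) (by simp)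
    (by rw [cx_d, cx_d]; exact X.ex hT k) (by
      rw [h0]
      exact X.K_ext hT k)
  rw [h0] at e'
  exact ⟨e ≪≫ₗ e'⟩

/-- stable equivalence -/
def sh (U V : MX D) (a b a' b' : ℕ) : Prop :=
  Nonempty (SHom S (U.K hT a).X (V.K hT b).X ≃ₗ[S] SHom S (U.K hT a').X (V.K hT b').X)

variable {hT}

lemma sh_succ (U V : MX D) (a b : ℕ) : sh hT U V a b (a + 1) (b + 1) :=
  shift (U.range_inc hT a) ((U.K hT a).q_surj hT) (V.inc_inj hT b) (V.range_inc hT b)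
    ((V.K hT b).q_surj hT) (U.K_ext hT a)

lemma sh_trans {U V : MX D} {a b a' b' a'' b'' : ℕ} (h : sh hT U V a b a' b')
    (h' : sh hT U V a' b' a'' b'') : sh hT U V a b a'' b'' := by
  obtain ⟨e⟩ := h
  obtain ⟨e'⟩ := h'
  exact ⟨e ≪≫ₗ e'⟩

lemma sh_symm {U V : MX D} {a b a' b' : ℕ} (h : sh hT U V a b a' b') : sh hT U V a' b' a b := by
  obtain ⟨e⟩ := h
  exact ⟨e.symm⟩

lemma sh_refl (U V : MX D) (a b : ℕ) : sh hT U V a b a b := ⟨LinearEquiv.refl _ _⟩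

lemma sh_add (U V : MX D) (a b : ℕ) (n : ℕ) : sh hT U V a b (a + n) (b + n) := by
  induction n with
  | zero => exact sh_refl U V a b
  | succ n ih => exact sh_trans ih (sh_succ U V (a + n) (b + n))

lemma sh_period (U V : MX D) (k b : ℕ) : sh hT U V (k + 1 + 1) (b + 1 + 1) (k + 1 + 1) b :=
  (V.K hT b).h.period (U.K hT k).h (U.K hT (k+1)).h (U.inc_inj hT k) (U.range_inc hT k)
    ((U.K hT k).q_surj hT) (U.inc_inj hT (k+1)) (U.range_inc hT (k+1))
    ((U.K hT (k+1)).q_surj hT) (V.inc_inj hT b) (V.range_inc hT b)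
    ((V.K hT b).q_surj hT) (V.inc_inj hT (b+1)) (V.range_inc hT (b+1))
    ((V.K hT (b+1)).q_surj hT)

lemma sh_periods (U V : MX D) (k b : ℕ) (n : ℕ) : sh hT U V (k + 1 + 1) (b + 2 * n) (k + 1 + 1) b := by
  induction n with
  | zero => exact sh_refl U V _ b
  | succ n ih => exact sh_trans (sh_period U V k (b + 2 * n)) ih

lemma sh_swap (U V : MX D) (i : ℕ) : sh hT U V 0 i i 0 := by
  have h1 := sh_add (hT := hT) U V 0 i (i + 2)
  have h2 := sh_periods (hT := hT) U V i 2 i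
  have h3 := sh_add (hT := hT) U V i 0 2
  refine sh_trans h1 (sh_trans ?_ (sh_symm h3))
  convert h2 using 1 <;> ring

end MX

theorem ext_symm (hT : AllTau D) {M N : Type} [AddCommGroup M] [Module S M] [AddCommGroup N]
    [Module S N] (hM : MCM D M) (hN : MCM D N) (i : ℕ) (hi : 0 < i) :
    Nonempty (ExtMod S i (ModuleCat.of S M) (ModuleCat.of S N) ≃ₗ[S]
      ExtMod S i (ModuleCat.of S N) (ModuleCat.of S M)) := by
  obtain ⟨k, rfl⟩ : ∃ k, i = k + 1 := ⟨i - 1, by omega⟩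
  let U : MX D := ⟨M, hM⟩
  let V : MX D := ⟨N, hN⟩
  obtain ⟨a⟩ := U.ext_eq hT (ModuleCat.of S N) k
  obtain ⟨b⟩ := V.ext_eq hT (ModuleCat.of S M) k
  obtain ⟨c⟩ := (U.K hT (k + 1)).h.symm hN
  obtain ⟨d⟩ := MX.sh_swap (hT := hT) V U (k + 1)
  exact ⟨a ≪≫ₗ c ≪≫ₗ d ≪≫ₗ b.symm⟩

end

end Klein

namespace Klein

section
variable {A : Type*} [CommRing A]

/-- `s, t` is a (weakly) regular sequence on `X` -/
structure TwoReg (s t : A) (X : Type*) [AddCommGroup X] [Module A X] : Prop where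
  inj : ∀ m : X, s • m = 0 → m = 0
  div : ∀ p q : X, t • p = s • q → ∃ r : X, p = s • r

variable {X Y : Type*} [AddCommGroup X] [Module A X] [AddCommGroup Y] [Module A Y] {s t : A}

lemma TwoReg.ker (hX : TwoReg s t X) (hY : ∀ m : Y, s • m = 0 → m = 0) (f : X →ₗ[A] Y) :
    TwoReg s t (LinearMap.ker f) := by
  refine ⟨fun m hm => ?_, fun p q h => ?_⟩
  · have := hX.inj m.1 (congrArg Subtype.val hm)
    exact Subtype.ext this
  · obtain ⟨r, hr⟩ := hX.div p.1 q.1 (congrArg Subtype.val h)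
    refine ⟨⟨r, ?_⟩, Subtype.ext hr⟩
    rw [LinearMap.mem_ker]
    apply hY
    rw [← map_smul, ← hr, p.2]

lemma TwoReg.equiv (hX : TwoReg s t X) (e : X ≃ₗ[A] Y) : TwoReg s t Y := by
  refine ⟨fun m hm => ?_, fun p q h => ?_⟩
  · apply e.symm.injective
    rw [map_zero]
    apply hX.inj
    rw [← map_smul, hm, map_zero]
  · obtain ⟨r, hr⟩ := hX.div (e.symm p) (e.symm q) (by rw [← map_smul, h, map_smul])
    refine ⟨e r, e.symm.injective ?_⟩
    rw [hr, map_smul, e.symm_apply_apply]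

lemma TwoReg.pi {ι : Type*} (h : TwoReg s t X) : TwoReg s t (ι → X) := by
  refine ⟨fun m hm => funext fun i => h.inj _ (congrFun hm i), fun p q hpq => ?_⟩
  choose r hr using fun i => h.div (p i) (q i) (congrFun hpq i)
  exact ⟨r, funext hr⟩

lemma TwoReg.of_free (h : TwoReg s t A) [Module.Free A X] [Module.Finite A X] : TwoReg s t X :=
  (h.pi (ι := Module.Free.ChooseBasisIndex A X)).equiv
    (Module.Free.chooseBasis A X).equivFun.symm

lemma TwoReg.of_inj_proj (h : TwoReg s t Y) (i : X →ₗ[A] Y) (p : Y →ₗ[A] X)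
    (hpi : ∀ x, p (i x) = x) : TwoReg s t X := by
  refine ⟨fun m hm => ?_, fun a b hab => ?_⟩
  · rw [← hpi m, h.inj (i m) (by rw [← map_smul, hm, map_zero]), map_zero]
  · obtain ⟨r, hr⟩ := h.div (i a) (i b) (by rw [← map_smul, hab, map_smul])
    exact ⟨p r, by rw [← map_smul, ← hr, hpi]⟩

/-- Hom into a regular module is regular -/
lemma TwoReg.hom {S M : Type*} [CommRing S] [AddCommGroup M] [Module S M] [Module S Y]
    [SMulCommClass S A Y] (h : TwoReg s t Y) : TwoReg s t (M →ₗ[S] Y) := by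
  refine ⟨fun m hm => LinearMap.ext fun x => h.inj _ (LinearMap.congr_fun hm x), fun p q hpq => ?_⟩
  choose r hr using fun x => h.div (p x) (q x) (LinearMap.congr_fun hpq x)
  have inj : ∀ a b : Y, s • a = s • b → a = b := fun a b hab => by
    rw [← sub_eq_zero]
    apply h.inj
    rw [smul_sub, hab, sub_self]
  refine ⟨{ toFun := r, map_add' := fun x y => inj _ _ ?_, map_smul' := fun c x => inj _ _ ?_ },
    LinearMap.ext hr⟩
  · rw [smul_add, ← hr, ← hr, ← hr, map_add]
  · rw [RingHom.id_apply, ← smul_comm c s, ← hr, ← hr, map_smul]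

open TensorProduct in
lemma TwoReg.free [IsLocalRing A] [IsNoetherianRing A]
    (hm : IsLocalRing.maximalIdeal A = Ideal.span {s, t}) [Module.Finite A X]
    (h : TwoReg s t X) : Module.Free A X := by
  have := Module.finitePresentation_of_finite A X
  apply Module.free_of_maximalIdeal_rTensor_injective
  have hs : s ∈ IsLocalRing.maximalIdeal A := hm ▸ Ideal.subset_span (by simp)
  have ht : t ∈ IsLocalRing.maximalIdeal A := hm ▸ Ideal.subset_span (by simp)
  have key : ∀ w : (IsLocalRing.maximalIdeal A) ⊗[A] X, ∃ p q : X,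
      w = (⟨s, hs⟩ : IsLocalRing.maximalIdeal A) ⊗ₜ[A] p + (⟨t, ht⟩ : IsLocalRing.maximalIdeal A) ⊗ₜ[A] q := by
    intro w
    induction w with
    | zero => exact ⟨0, 0, by simp⟩
    | tmul a x =>
      obtain ⟨a, ha⟩ := a
      obtain ⟨b, c, hbc⟩ := Ideal.mem_span_pair.1 (hm ▸ ha)
      refine ⟨b • x, c • x, ?_⟩
      rw [TensorProduct.tmul_smul, TensorProduct.tmul_smul, TensorProduct.smul_tmul',
        TensorProduct.smul_tmul', ← TensorProduct.add_tmul]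
      congr 1
      exact Subtype.ext hbc.symm
    | add x y hx hy =>
      obtain ⟨p, q, rfl⟩ := hx
      obtain ⟨p', q', rfl⟩ := hy
      refine ⟨p + p', q + q', ?_⟩
      rw [TensorProduct.tmul_add, TensorProduct.tmul_add]
      abel
  rw [injective_iff_map_eq_zero]
  intro w hw
  obtain ⟨p, q, rfl⟩ := key w
  have hw' : s • p + t • q = 0 := by
    have := congrArg (TensorProduct.lid A X) hw
    simpa using this
  obtain ⟨r, rfl⟩ := h.div q (-p) (by rw [smul_neg, eq_neg_iff_add_eq_zero, add_comm, hw'])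
  have hp : p = - (t • r) := by
    rw [← sub_eq_zero]
    apply h.inj
    rw [sub_neg_eq_add, smul_add, smul_comm s t, hw']
  subst hp
  rw [← smul_neg, TensorProduct.tmul_smul, TensorProduct.tmul_smul, TensorProduct.smul_tmul',
    TensorProduct.smul_tmul', TensorProduct.tmul_neg, neg_add_eq_zero]
  congr 1
  exact Subtype.ext (mul_comm _ _)

end

section
variable {S : Type*} [CommRing S] [IsLocalRing S] [IsNoetherianRing S]
variable {M : Type*} [AddCommGroup M] [Module S M] [Module.Finite S M]

lemma depth_aux {y z a b : S} (hy : y ∈ IsLocalRing.maximalIdeal S)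
    (hz : z ∈ IsLocalRing.maximalIdeal S)
    (ha : a * a ∈ Ideal.span {y, z}) (hb : b * b ∈ Ideal.span {y, z})
    (ra : ∀ m : M, a • m = 0 → m = 0)
    (rb : ∀ p q : M, b • p = a • q → ∃ r, p = a • r) : TwoReg y z M := by
  obtain ⟨a1, a2, ha⟩ := Ideal.mem_span_pair.1 ha
  obtain ⟨b1, b2, hb⟩ := Ideal.mem_span_pair.1 hb
  have raa : ∀ p q : M, (a * a) • p = (a * a) • q → p = q := fun p q h => by
    rw [← sub_eq_zero]
    apply ra
    apply ra
    rw [smul_smul, smul_sub, h, sub_self]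
  have ra' : ∀ p q : M, a • p = a • q → p = q := fun p q h => by
    rw [← sub_eq_zero]
    apply ra
    rw [smul_sub, h, sub_self]
  have rbb : ∀ p q : M, (b * b) • p = a • q → ∃ r, p = a • r := fun p q h => by
    obtain ⟨r, hr⟩ := rb (b • p) q (by rw [smul_smul, h])
    exact rb p r hr
  have rbb2 : ∀ p q : M, (b * b) • p = (a * a) • q → ∃ r, p = (a * a) • r := fun p q h => by
    obtain ⟨r, hr⟩ := rbb p (a • q) (by rw [smul_smul, h])
    obtain ⟨r', hr'⟩ := rbb r q (ra' _ _ (by rw [smul_comm a, ← hr, h, smul_smul]))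
    exact ⟨r', by rw [hr, hr', smul_smul]⟩
  have h2 : ∀ m : M, y • m = 0 → z • m = 0 → m = 0 := fun m h1 h2 => by
    apply raa
    rw [← ha, add_smul, mul_smul, mul_smul, h1, h2]
    simp
  have H1 : ∀ p q : M, y • p = z • q → ∃ r, p = z • r ∧ q = y • r := fun p q h => by
    obtain ⟨r, hr⟩ : ∃ r, r = a1 • q + a2 • p := ⟨_, rfl⟩
    obtain ⟨r', hr'⟩ : ∃ r, r = b1 • q + b2 • p := ⟨_, rfl⟩
    have e1 : (a * a) • p = z • r := by
      rw [← ha, hr, add_smul, mul_smul, mul_smul, h]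
      simp only [smul_add, smul_smul]; congr 2 <;> ring
    have e2 : (a * a) • q = y • r := by
      rw [← ha, hr, add_smul, mul_smul, mul_smul, ← h]
      simp only [smul_add, smul_smul]; congr 2 <;> ring
    have e1' : (b * b) • p = z • r' := by
      rw [← hb, hr', add_smul, mul_smul, mul_smul, h]
      simp only [smul_add, smul_smul]; congr 2 <;> ring
    have e2' : (b * b) • q = y • r' := by
      rw [← hb, hr', add_smul, mul_smul, mul_smul, ← h]
      simp only [smul_add, smul_smul]; congr 2 <;> ring
    have e : (b * b) • r - (a * a) • r' = 0 := by
      apply h2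
      · rw [smul_sub, smul_comm y, smul_comm y, ← e2, ← e2', smul_comm, sub_self]
      · rw [smul_sub, smul_comm z, smul_comm z, ← e1, ← e1', smul_comm, sub_self]
    obtain ⟨w, rfl⟩ := rbb2 r r' (sub_eq_zero.1 e)
    refine ⟨w, raa _ _ ?_, raa _ _ ?_⟩
    · rw [e1, smul_comm]
    · rw [e2, smul_comm]
  have K0 : LinearMap.ker (LinearMap.lsmul S M y) = ⊥ := by
    refine Submodule.eq_bot_of_le_smul_of_le_jacobson_bot (IsLocalRing.maximalIdeal S) _
      (IsNoetherian.noetherian _) ?_ (by rw [IsLocalRing.jacobson_eq_maximalIdeal _ bot_ne_top])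
    intro m hm
    obtain ⟨r, hr, hr'⟩ := H1 m 0 (by rw [smul_zero]; exact hm)
    rw [hr]
    exact Submodule.smul_mem_smul hz hr'.symm
  refine ⟨fun m hm => ?_, fun p q h => ?_⟩
  · have : m ∈ LinearMap.ker (LinearMap.lsmul S M y) := hm
    rw [K0] at this
    exact this
  · obtain ⟨r, -, hr⟩ := H1 q p h.symm
    exact ⟨r, hr⟩

end

lemma depth_two {S : Type} [CommRing S] [IsLocalRing S] {M : Type} [AddCommGroup M] [Module S M]
    (h : moduleDepth S M = 2) : ∃ a b : S, a ∈ IsLocalRing.maximalIdeal S ∧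
      b ∈ IsLocalRing.maximalIdeal S ∧ (∀ m : M, a • m = 0 → m = 0) ∧
      (∀ p q : M, b • p = a • q → ∃ r, p = a • r) := by
  have : ∃ c ∈ {c : ℕ∞ | ∃ rs : List S, c = rs.length ∧
    (∀ r ∈ rs, r ∈ IsLocalRing.maximalIdeal S) ∧ RingTheory.Sequence.IsRegular M rs}, 1 < c := by
    rw [← lt_sSup_iff]
    change 1 < moduleDepth S M
    rw [h]; norm_num
  obtain ⟨c, ⟨rs, rfl, hm, hr⟩, hc⟩ := this
  match rs, hm, hr, hc with
  | [], _, _, hc => simp at hc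
  | [a], _, _, hc => simp at hc
  | a :: b :: l, hm, hr, _ =>
    have h1 := hr.toIsWeaklyRegular
    rw [RingTheory.Sequence.isWeaklyRegular_cons_iff] at h1
    obtain ⟨h1, h2⟩ := h1
    rw [RingTheory.Sequence.isWeaklyRegular_cons_iff] at h2
    obtain ⟨h2, -⟩ := h2
    refine ⟨a, b, hm _ (by simp), hm _ (by simp), fun m hm => ?_, fun p q h => ?_⟩
    · exact h1 (by simpa using hm)
    · have : (Submodule.Quotient.mk p : QuotSMulTop a M) = 0 := by
        apply h2
        change b • _ = b • _
        rw [smul_zero, ← Submodule.Quotient.mk_smul, Submodule.Quotient.mk_eq_zero, h]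
        exact Submodule.smul_mem_pointwise_smul _ _ _ trivial
      rw [Submodule.Quotient.mk_eq_zero, Submodule.mem_smul_pointwise_iff_exists] at this
      obtain ⟨r, -, hr⟩ := this
      exact ⟨r, hr.symm⟩

end Klein

namespace Klein

section
variable {A : Type*} [CommRing A] [Nontrivial A] {I : Ideal A} [IsAdicComplete I A] {g : A}

lemma weier_order (hI : I ≠ ⊤) (hg : g ∈ I) :
    (((PowerSeries.X ^ 2 + PowerSeries.C g : PowerSeries A)).map (Ideal.Quotient.mk I)).order.toNat = 2 := by
  have : Nontrivial (A ⧸ I) := Ideal.Quotient.nontrivial_iff.2 hI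
  rw [map_add, map_pow, PowerSeries.map_X, PowerSeries.map_C, Ideal.Quotient.eq_zero_iff_mem.2 hg,
    map_zero, add_zero, PowerSeries.order_X_pow]
  rfl

lemma weier_div (hI : I ≠ ⊤) (hg : g ∈ I) :
    ((PowerSeries.X ^ 2 + PowerSeries.C g : PowerSeries A)).IsWeierstrassDivisorAt I := by
  unfold PowerSeries.IsWeierstrassDivisorAt
  rw [weier_order hI hg]
  simp [PowerSeries.coeff_X_pow, PowerSeries.coeff_C]

lemma weier_exists (hI : I ≠ ⊤) (hg : g ∈ I) (f : PowerSeries A) : ∃ (q : PowerSeries A) (a b : A),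
    f = (PowerSeries.X ^ 2 + PowerSeries.C g) * q + (PowerSeries.C a + PowerSeries.C b * PowerSeries.X) := by
  have h := (weier_div hI hg).isWeierstrassDivisionAt_div_mod f
  have h1 := h.degree_lt
  rw [weier_order hI hg] at h1
  refine ⟨(weier_div hI hg).div f, ((weier_div hI hg).mod f).coeff 0, ((weier_div hI hg).mod f).coeff 1, h.eq_mul_add.trans ?_⟩
  congr 1
  have := Polynomial.eq_X_add_C_of_degree_le_one (p := (weier_div hI hg).mod f)
    (Order.le_of_lt_succ h1)
  conv_lhs => rw [this]
  simp [add_comm]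

lemma weier_unique (hI : I ≠ ⊤) (hg : g ∈ I) (q : PowerSeries A) (a b : A)
    (h : (PowerSeries.X ^ 2 + PowerSeries.C g) * q = PowerSeries.C a + PowerSeries.C b * PowerSeries.X) :
    a = 0 ∧ b = 0 := by
  have := (weier_div hI hg).eq_zero_of_mul_eq (q := q) (r := Polynomial.C b * Polynomial.X + Polynomial.C a)
    (by rw [weier_order hI hg]; exact Polynomial.degree_linear_lt) (by rw [h]; simp [add_comm])
  constructor
  · simpa using congrArg (Polynomial.coeff · 0) this.2
  · simpa using congrArg (Polynomial.coeff · 1) this.2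

end

/-- `ℂ[[y,z]]` -/
abbrev P2 : Type := MvPowerSeries (Fin 2) ℂ

lemma mem_maxIdeal {p : P2} : p ∈ IsLocalRing.maximalIdeal P2 ↔ MvPowerSeries.constantCoeff p = 0 := by
  rw [IsLocalRing.mem_maximalIdeal, mem_nonunits_iff, MvPowerSeries.isUnit_iff_constantCoeff,
    isUnit_iff_ne_zero, not_not]

/-- part of a power series free of `X 0` -/
def part (p : P2) : P2 := fun m => if m 0 = 0 then MvPowerSeries.coeff m p else 0

lemma part_spec (p : P2) : MvPowerSeries.X 0 ∣ p - part p := by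
  rw [MvPowerSeries.X_dvd_iff]
  intro m hm
  rw [map_sub, sub_eq_zero]
  change _ = (if m 0 = 0 then MvPowerSeries.coeff m p else 0)
  rw [if_pos hm]

lemma fin2_zero (m : Fin 2 →₀ ℕ) (h0 : m 0 = 0) (h1 : m 1 = 0) : m = 0 := by
  ext i; fin_cases i <;> simp [h0, h1]

lemma exists_decomp {p : P2} (hp : MvPowerSeries.constantCoeff p = 0) :
    ∃ a b : P2, p = a * MvPowerSeries.X 0 + b * MvPowerSeries.X 1 := by
  obtain ⟨a, ha⟩ := part_spec p
  obtain ⟨b, hb⟩ : MvPowerSeries.X 1 ∣ part p := by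
    rw [MvPowerSeries.X_dvd_iff]
    intro m hm
    change (if m 0 = 0 then MvPowerSeries.coeff m p else 0) = 0
    split_ifs with h
    · rw [fin2_zero m h hm]; exact hp
    · rfl
  exact ⟨a, b, by rw [mul_comm a, mul_comm b, ← ha, ← hb]; ring⟩

lemma maxIdeal_eq : IsLocalRing.maximalIdeal P2 = Ideal.span {MvPowerSeries.X 0, MvPowerSeries.X 1} := by
  apply le_antisymm
  · intro p hp
    obtain ⟨a, b, rfl⟩ := exists_decomp (mem_maxIdeal.1 hp)
    exact Ideal.mem_span_pair.2 ⟨a, b, rfl⟩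
  · rw [Ideal.span_le]
    rintro _ (rfl | rfl)
    · exact mem_maxIdeal.2 (by simp)
    · exact mem_maxIdeal.2 (by simp)

lemma span_range_X : Ideal.span (Set.range (MvPowerSeries.X : Fin 2 → P2)) = IsLocalRing.maximalIdeal P2 := by
  rw [maxIdeal_eq]
  congr 1
  ext p
  simp [eq_comm]

instance : IsAdicComplete (IsLocalRing.maximalIdeal P2) P2 := by
  rw [← span_range_X]; infer_instance

lemma twoReg_P2 : TwoReg (MvPowerSeries.X 0 : P2) (MvPowerSeries.X 1) P2 := by
  have hX : (MvPowerSeries.X 0 : P2) ≠ 0 := fun h => by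
    have := congrArg (MvPowerSeries.coeff (Finsupp.single 0 1)) h
    simp at this
  refine ⟨fun m hm => (mul_eq_zero.1 hm).resolve_left hX, fun p q h => ?_⟩
  rw [smul_eq_mul, smul_eq_mul] at h
  change MvPowerSeries.X 0 ∣ p
  rw [MvPowerSeries.X_dvd_iff]
  intro m hm
  have := (MvPowerSeries.X_dvd_iff (s := (0 : Fin 2)) (φ := MvPowerSeries.X 1 * p)).1 ⟨q, h⟩
    (m + Finsupp.single 1 1) (by simp [hm])
  rwa [add_comm, MvPowerSeries.X, MvPowerSeries.coeff_add_monomial_mul, one_mul] at this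

section kring
variable (f : MvPowerSeries (Fin 3) ℂ)

def kmap : P2 →+* KleinianRing f :=
  (Ideal.Quotient.mk _).comp ((MvPowerSeries.finSuccEquiv ℂ 2).symm.toRingEquiv.toRingHom.comp PowerSeries.C)

instance kAlg : Algebra P2 (KleinianRing f) := (kmap f).toAlgebra

/-- the class of `x` -/
def kx : KleinianRing f := Ideal.Quotient.mk _ (MvPowerSeries.X 0)

lemma kmap_X (i : Fin 2) : algebraMap P2 (KleinianRing f) (MvPowerSeries.X i) =
    Ideal.Quotient.mk _ (MvPowerSeries.X i.succ) := by
  change Ideal.Quotient.mk _ ((MvPowerSeries.finSuccEquiv ℂ 2).symm (PowerSeries.C (MvPowerSeries.X i))) = _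
  rw [← MvPowerSeries.finSuccEquiv_X_succ, AlgEquiv.symm_apply_apply]

/-- `f = x² + g(y,z)` -/
structure KHyp (f : MvPowerSeries (Fin 3) ℂ) (g : P2) : Prop where
  hg : MvPowerSeries.constantCoeff g = 0
  h : MvPowerSeries.finSuccEquiv ℂ 2 f = PowerSeries.X ^ 2 + PowerSeries.C g

variable {f} {g : P2}

lemma comb_eq (a b : P2) : algebraMap P2 (KleinianRing f) a + algebraMap P2 (KleinianRing f) b * kx f =
    Ideal.Quotient.mk _ ((MvPowerSeries.finSuccEquiv ℂ 2).symm
      (PowerSeries.C a + PowerSeries.C b * PowerSeries.X)) := by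
  rw [map_add, map_mul, ← MvPowerSeries.finSuccEquiv_X_zero, AlgEquiv.symm_apply_apply, map_add, map_mul]
  rfl

lemma symm_eq (H : KHyp f g) : (MvPowerSeries.finSuccEquiv ℂ 2).symm (PowerSeries.X ^ 2 + PowerSeries.C g) = f := by
  rw [← H.h, AlgEquiv.symm_apply_apply]

lemma k_exists (H : KHyp f g) (r : KleinianRing f) : ∃ a b : P2,
    r = algebraMap P2 _ a + algebraMap P2 _ b * kx f := by
  obtain ⟨r, rfl⟩ := Ideal.Quotient.mk_surjective r
  obtain ⟨q, a, b, hq⟩ := weier_exists (IsLocalRing.maximalIdeal.isMaximal P2).ne_top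
    (mem_maxIdeal.2 H.hg) (MvPowerSeries.finSuccEquiv ℂ 2 r)
  refine ⟨a, b, ?_⟩
  rw [comb_eq, Ideal.Quotient.mk_eq_mk_iff_sub_mem, Ideal.mem_span_singleton]
  refine ⟨(MvPowerSeries.finSuccEquiv ℂ 2).symm q, ?_⟩
  rw [← symm_eq H, ← map_mul, ← AlgEquiv.symm_apply_apply (MvPowerSeries.finSuccEquiv ℂ 2) r, hq, map_add]
  simp

lemma k_unique (H : KHyp f g) (a b : P2) (hab : algebraMap P2 (KleinianRing f) a + algebraMap P2 _ b * kx f = 0) :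
    a = 0 ∧ b = 0 := by
  rw [comb_eq, Ideal.Quotient.eq_zero_iff_mem, Ideal.mem_span_singleton] at hab
  obtain ⟨q, hq⟩ := hab
  refine weier_unique (IsLocalRing.maximalIdeal.isMaximal P2).ne_top
    (mem_maxIdeal.2 H.hg) (MvPowerSeries.finSuccEquiv ℂ 2 q) a b ?_
  rw [← H.h, ← map_mul, ← hq, AlgEquiv.apply_symm_apply]

lemma kx_sq (H : KHyp f g) : kx f * kx f = - algebraMap P2 (KleinianRing f) g := by
  rw [eq_neg_iff_add_eq_zero]
  have : kx f * kx f + algebraMap P2 (KleinianRing f) g =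
    Ideal.Quotient.mk _ ((MvPowerSeries.finSuccEquiv ℂ 2).symm (PowerSeries.X ^ 2 + PowerSeries.C g)) := by
    rw [map_add, map_pow, ← MvPowerSeries.finSuccEquiv_X_zero, AlgEquiv.symm_apply_apply, map_add, map_pow, sq]
    rfl
  rw [this, symm_eq H, Ideal.Quotient.eq_zero_iff_mem]
  exact Ideal.mem_span_singleton_self _

lemma k_unique' (H : KHyp f g) {a b a' b' : P2} (hab : algebraMap P2 (KleinianRing f) a + algebraMap P2 _ b * kx f =
    algebraMap P2 (KleinianRing f) a' + algebraMap P2 _ b' * kx f) : a = a' ∧ b = b' := by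
  have := k_unique H (a - a') (b - b') (by
    rw [map_sub, map_sub]; linear_combination hab)
  exact ⟨sub_eq_zero.1 this.1, sub_eq_zero.1 this.2⟩

def ka (H : KHyp f g) (r : KleinianRing f) : P2 := (k_exists H r).choose
def kb (H : KHyp f g) (r : KleinianRing f) : P2 := (k_exists H r).choose_spec.choose
lemma kab (H : KHyp f g) (r : KleinianRing f) : r = algebraMap P2 _ (ka H r) + algebraMap P2 _ (kb H r) * kx f :=
  (k_exists H r).choose_spec.choose_spec

lemma kb_eq (H : KHyp f g) {a b : P2} {r : KleinianRing f} (hr : r = algebraMap P2 _ a + algebraMap P2 _ b * kx f) :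
    kb H r = b := (k_unique' H ((kab H r).symm.trans hr)).2

def kQuad (H : KHyp f g) : QuadData P2 (KleinianRing f) where
  x := kx f
  g := g
  c := 
    { toFun := kb H
      map_add' := fun r s => kb_eq H (a := ka H r + ka H s) (by
        conv_lhs => rw [kab H r, kab H s]
        rw [map_add, map_add]; ring)
      map_smul' := fun c r => kb_eq H (a := c * ka H r) (by
        conv_lhs => rw [kab H r]
        rw [RingHom.id_apply, smul_eq_mul, map_mul, map_mul, Algebra.smul_def]; ring) }
  half := MvPowerSeries.C (1/2)
  hhalf := by
    rw [show (2 : P2) = MvPowerSeries.C 2 from (map_ofNat MvPowerSeries.C 2).symm, ← map_mul]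
    norm_num
  hxx := kx_sq H
  hc := fun r => by
    have : kb H (kx f * r) = ka H r := kb_eq H (a := - g * kb H r) (by
      conv_lhs => rw [kab H r]
      rw [map_mul, map_neg, ← kx_sq H]; ring)
    change r = algebraMap P2 _ (kb H (kx f * r)) + algebraMap P2 _ (kb H r) * kx f
    rw [this]
    exact kab H r
  c1 := kb_eq H (a := 1) (by simp)
  cx := kb_eq H (a := 0) (by simp)

lemma k_basis (H : KHyp f g) (r : KleinianRing f) : r ∈ Submodule.span P2 {1, kx f} := by
  rw [Submodule.mem_span_pair]
  refine ⟨ka H r, kb H r, ?_⟩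
  conv_rhs => rw [kab H r]
  rw [Algebra.smul_def, Algebra.smul_def, mul_one]

lemma k_finite (H : KHyp f g) : Module.Finite P2 (KleinianRing f) :=
  Module.finite_def.2 (Submodule.fg_def.2 ⟨{1, kx f}, by simp, by
    rw [eq_top_iff]
    intro r _
    exact k_basis H r⟩)

lemma k_twoReg (H : KHyp f g) : TwoReg (MvPowerSeries.X 0 : P2) (MvPowerSeries.X 1) (KleinianRing f) := by
  have e : (Fin 2 → P2) ≃ₗ[P2] KleinianRing f :=
    LinearEquiv.ofBijective (
      { toFun := fun v => algebraMap P2 (KleinianRing f) (v 0) + algebraMap P2 (KleinianRing f) (v 1) * kx f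
        map_add' := fun v w => by rw [Pi.add_apply, Pi.add_apply, map_add, map_add]; ring
        map_smul' := fun c v => by
          rw [Pi.smul_apply, Pi.smul_apply, smul_eq_mul, smul_eq_mul, map_mul, map_mul,
            RingHom.id_apply, Algebra.smul_def]; ring } : (Fin 2 → P2) →ₗ[P2] KleinianRing f) (by
      constructor
      · rw [injective_iff_map_eq_zero]
        intro v hv
        have := k_unique H _ _ hv
        ext i; fin_cases i <;> simp [this.1, this.2]
      · intro r
        refine ⟨![ka H r, kb H r], ?_⟩
        exact (kab H r).symm)
  exact (twoReg_P2.pi).equiv e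

lemma k_kerMCM (H : KHyp f g) (hT : AllTau (kQuad H)) : KerMCM (kQuad H) := by
  intro T₁ T₀ _ _ _ _ _ _ _ _ F
  let : Module P2 T₁ := Module.compHom T₁ (algebraMap P2 (KleinianRing f))
  let : IsScalarTower P2 (KleinianRing f) T₁ := IsScalarTower.of_algebraMap_smul fun _ _ => rfl
  let : Module P2 T₀ := Module.compHom T₀ (algebraMap P2 (KleinianRing f))
  let : IsScalarTower P2 (KleinianRing f) T₀ := IsScalarTower.of_algebraMap_smul fun _ _ => rfl
  have := k_finite H
  have : Module.Finite P2 T₁ := Module.Finite.trans (KleinianRing f) T₁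
  have tr : ∀ (T : Type) [AddCommGroup T] [Module (KleinianRing f) T] [Module P2 T]
      [IsScalarTower P2 (KleinianRing f) T]
      [Module.Finite (KleinianRing f) T] [Module.Projective (KleinianRing f) T],
      TwoReg (MvPowerSeries.X 0 : P2) (MvPowerSeries.X 1) T := by
    intro T _ _ _ _ _ _
    obtain ⟨n, p, i, -, -, hpi⟩ := Module.Finite.exists_comp_eq_id_of_projective (KleinianRing f) T
    exact ((k_twoReg H).pi (ι := Fin n)).of_inj_proj (i.restrictScalars P2) (p.restrictScalars P2)
      (fun x => LinearMap.congr_fun hpi x)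
  have e : LinearMap.ker (F.restrictScalars P2) ≃ₗ[P2] LinearMap.ker F :=
    { toFun := fun x => ⟨x.1, x.2⟩
      invFun := fun x => ⟨x.1, x.2⟩
      map_add' := fun _ _ => rfl
      map_smul' := fun _ _ => rfl
      left_inv := fun _ => rfl
      right_inv := fun _ => rfl }
  have tk : TwoReg (MvPowerSeries.X 0 : P2) (MvPowerSeries.X 1) (LinearMap.ker F) :=
    ((tr T₁).ker (tr T₀).inj (F.restrictScalars P2)).equiv e
  have fin : Module.Finite P2 (LinearMap.ker F) := Module.Finite.equiv e
  exact hT.mcm _ (tk.free maxIdeal_eq) fin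

lemma k_depth (H : KHyp f g) [IsLocalRing (KleinianRing f)] (hT : AllTau (kQuad H))
    (M : Type) [AddCommGroup M] [Module (KleinianRing f) M] [Module.Finite (KleinianRing f) M]
    (hd : moduleDepth (KleinianRing f) M = 2) : MCM (kQuad H) M := by
  let : Module P2 M := Module.compHom M (algebraMap P2 (KleinianRing f))
  let : IsScalarTower P2 (KleinianRing f) M := IsScalarTower.of_algebraMap_smul fun _ _ => rfl
  have := k_finite H
  have : Module.Finite P2 M := Module.Finite.trans (KleinianRing f) M
  obtain ⟨a, b, ha, hb, ra, rb⟩ := depth_two hd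
  have nilp : ∀ a ∈ IsLocalRing.maximalIdeal (KleinianRing f), a * a ∈
      Ideal.span {algebraMap P2 (KleinianRing f) (MvPowerSeries.X 0),
        algebraMap P2 (KleinianRing f) (MvPowerSeries.X 1)} := by
    intro a ha
    have hα : MvPowerSeries.constantCoeff (ka H a) = 0 := by
      by_contra hne
      refine ha ?_
      have hu : IsUnit ((ka H a) ^ 2 + (kb H a) ^ 2 * g) := by
        rw [MvPowerSeries.isUnit_iff_constantCoeff]
        simp [H.hg, hne]
      have hu' := hu.map (algebraMap P2 (KleinianRing f))
      have : algebraMap P2 (KleinianRing f) ((ka H a) ^ 2 + (kb H a) ^ 2 * g) =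
          a * (algebraMap P2 _ (ka H a) - algebraMap P2 _ (kb H a) * kx f) := by
        have h3 := kab H a
        rw [map_add, map_mul, map_pow, map_pow]
        generalize algebraMap P2 (KleinianRing f) (ka H a) = α at *
        generalize algebraMap P2 (KleinianRing f) (kb H a) = β at *
        rw [h3]
        linear_combination β ^ 2 * kx_sq H
      rw [this] at hu'
      exact isUnit_of_mul_isUnit_left hu'
    obtain ⟨p, q, h1⟩ := exists_decomp hα
    obtain ⟨p', q', h2⟩ := exists_decomp H.hg
    have h1 := congrArg (algebraMap P2 (KleinianRing f)) h1
    have h2 := congrArg (algebraMap P2 (KleinianRing f)) h2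
    have h3 := kab H a
    simp only [map_add, map_mul] at h1 h2
    rw [Ideal.mem_span_pair]
    generalize algebraMap P2 (KleinianRing f) (ka H a) = α at *
    generalize algebraMap P2 (KleinianRing f) (kb H a) = β at *
    have h4 := kx_sq H
    have : a * a = α * (α + 2 * β * kx f) - β * β * algebraMap P2 _ g := by
      rw [h3]; linear_combination β ^ 2 * h4
    refine ⟨algebraMap P2 _ p * (α + 2 * β * kx f) - β * β * algebraMap P2 _ p',
      algebraMap P2 _ q * (α + 2 * β * kx f) - β * β * algebraMap P2 _ q', ?_⟩
    rw [this]
    linear_combination - (α + 2 * β * kx f) * h1 + β * β * h2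
  have nu : ∀ i : Fin 2, algebraMap P2 (KleinianRing f) (MvPowerSeries.X i) ∈
      IsLocalRing.maximalIdeal (KleinianRing f) := by
    intro i hu
    obtain ⟨r, hr⟩ := hu.exists_right_inv
    have := k_unique' H (a := MvPowerSeries.X i * ka H r) (b := MvPowerSeries.X i * kb H r)
      (a' := 1) (b' := 0) (by
        conv_lhs at hr => rw [kab H r]
        rw [map_mul, map_mul, map_one, map_zero, ← hr]; ring)
    have h2 := congrArg MvPowerSeries.constantCoeff this.1
    simp at h2
  have : IsNoetherianRing (KleinianRing f) := IsNoetherianRing.of_finite P2 _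
  have tk' := depth_aux (M := M) (nu 0) (nu 1) (nilp a ha) (nilp b hb) ra rb
  have tk : TwoReg (MvPowerSeries.X 0 : P2) (MvPowerSeries.X 1) M := ⟨tk'.inj, tk'.div⟩
  exact hT.mcm _ (tk.free maxIdeal_eq) inferInstance

/-- the main theorem, given the duality -/
lemma k_main [IsLocalRing (KleinianRing f)] (H : KHyp f g) (hT : AllTau (kQuad H))
    (M N : Type) [AddCommGroup M] [Module (KleinianRing f) M]
    [Module.Finite (KleinianRing f) M]
    [AddCommGroup N] [Module (KleinianRing f) N] [Module.Finite (KleinianRing f) N] :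
    (∀ (CM : CompleteResolution (KleinianRing f) (ModuleCat.of (KleinianRing f) M))
      (CN : CompleteResolution (KleinianRing f) (ModuleCat.of (KleinianRing f) N)) (i : ℤ),
      Nonempty ((TateExt (KleinianRing f) CM (ModuleCat.of (KleinianRing f) N) i) ≃ₗ[KleinianRing f]
        (TateExt (KleinianRing f) CN (ModuleCat.of (KleinianRing f) M) i))) ∧
    (moduleDepth (KleinianRing f) M = 2 → moduleDepth (KleinianRing f) N = 2 →
      ∀ i : ℕ, 0 < i →
        Nonempty ((ExtMod (KleinianRing f) i (ModuleCat.of (KleinianRing f) M)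
            (ModuleCat.of (KleinianRing f) N)) ≃ₗ[KleinianRing f]
          (ExtMod (KleinianRing f) i (ModuleCat.of (KleinianRing f) N)
            (ModuleCat.of (KleinianRing f) M)))) :=
  ⟨fun CM CN i => tate_symm (k_kerMCM H hT) CM CN i, fun hM hN i hi =>
    ext_symm hT (k_depth H hT M hM) (k_depth H hT N hN) i hi⟩

end kring

end Klein

namespace Klein

section rep
variable {G : Type*} [Group G]

/-- trace of a group element on a module over the group algebra -/
def chr (V : Type*) [AddCommGroup V] [Module ℂ V] [Module (MonoidAlgebra ℂ G) V]
    [IsScalarTower ℂ (MonoidAlgebra ℂ G) V] (g : G) : ℂ :=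
  (Representation.ofModule' (G := G) (k := ℂ) V).character g

lemma ofModule'_apply {V : Type*} [AddCommGroup V] [Module ℂ V] [Module (MonoidAlgebra ℂ G) V]
    [IsScalarTower ℂ (MonoidAlgebra ℂ G) V] (g : G) (v : V) :
    Representation.ofModule' (G := G) (k := ℂ) V g v = MonoidAlgebra.single g (1 : ℂ) • v := by
  simp [Representation.ofModule']

variable {V W : Type*} [AddCommGroup V] [Module ℂ V] [Module (MonoidAlgebra ℂ G) V]
    [IsScalarTower ℂ (MonoidAlgebra ℂ G) V] [AddCommGroup W] [Module ℂ W]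
    [Module (MonoidAlgebra ℂ G) W] [IsScalarTower ℂ (MonoidAlgebra ℂ G) W]

lemma chr_equiv (e : V ≃ₗ[MonoidAlgebra ℂ G] W) (g : G) :
    chr V g = chr W g := by
  unfold chr Representation.character
  have : Representation.ofModule' (G := G) (k := ℂ) W g =
      (e.restrictScalars ℂ).conj (Representation.ofModule' (G := G) (k := ℂ) V g) := by
    ext w
    rw [LinearEquiv.conj_apply_apply, ofModule'_apply, ofModule'_apply]
    change _ = e (_ • e.symm w)
    rw [map_smul, LinearEquiv.apply_symm_apply]
  rw [this, LinearMap.trace_conj']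

lemma chr_prod [FiniteDimensional ℂ V] [FiniteDimensional ℂ W] (g : G) :
    chr (V × W) g = chr V g + chr W g := by
  unfold chr Representation.character
  have : Representation.ofModule' (G := G) (k := ℂ) (V × W) g =
      LinearMap.prodMap (Representation.ofModule' (G := G) (k := ℂ) V g)
        (Representation.ofModule' (G := G) (k := ℂ) W g) := by
    refine LinearMap.ext fun w => ?_
    rw [LinearMap.prodMap_apply, ofModule'_apply, ofModule'_apply, ofModule'_apply]
    rfl
  rw [this, LinearMap.trace_prodMap']

variable [Finite G]

lemma exists_hom_ne [FiniteDimensional ℂ V] [FiniteDimensional ℂ W] [Nontrivial V]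
    (h : ∀ g : G, chr V g = chr W g) : ∃ f : V →ₗ[MonoidAlgebra ℂ G] W, f ≠ 0 := by
  have := Fintype.ofFinite G
  have hne : (Nat.card G : ℂ) ≠ 0 := by
    simp [Nat.card_pos.ne']
  letI : Invertible (Nat.card G : ℂ) := invertibleOfNonzero hne
  have h1 := Representation.card_inv_mul_sum_char_mul_char_eq_finrank
    (Representation.ofModule' (G := G) (k := ℂ) V) (Representation.ofModule' (G := G) (k := ℂ) W)
  have h2 := Representation.card_inv_mul_sum_char_mul_char_eq_finrank
    (Representation.ofModule' (G := G) (k := ℂ) V) (Representation.ofModule' (G := G) (k := ℂ) V)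
  have h3 : ∀ g, (Representation.ofModule' (G := G) (k := ℂ) V).character g =
    (Representation.ofModule' (G := G) (k := ℂ) W).character g := h
  simp only [h3] at h1 h2
  rw [h1] at h2
  have h2 := Nat.cast_injective (R := ℂ) h2
  have hfd : FiniteDimensional ℂ (Representation.IntertwiningMap
      (Representation.ofModule' (G := G) (k := ℂ) V) (Representation.ofModule' (G := G) (k := ℂ) V)) := by
    refine Module.Finite.of_injective (Representation.IntertwiningMap.toLinearMapl _ _ :
      _ →ₗ[ℂ] (V →ₗ[ℂ] V)) ?_
    intro a b hab
    exact Representation.IntertwiningMap.ext hab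
  have hnt : Nontrivial (Representation.IntertwiningMap
      (Representation.ofModule' (G := G) (k := ℂ) V) (Representation.ofModule' (G := G) (k := ℂ) V)) := by
    obtain ⟨v, hv⟩ := exists_ne (0 : V)
    refine ⟨⟨⟨LinearMap.id, fun g => rfl⟩, 0, fun h => hv ?_⟩⟩
    have := congrArg (fun f => f.toLinearMap v) h
    exact this
  have h5 := Module.finrank_pos (R := ℂ) (M := Representation.IntertwiningMap
      (Representation.ofModule' (G := G) (k := ℂ) V) (Representation.ofModule' (G := G) (k := ℂ) V))
  rw [← h2] at h5
  have h6 := Module.nontrivial_of_finrank_pos h5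
  obtain ⟨f, hf⟩ := exists_ne (0 : (Representation.IntertwiningMap
      (Representation.ofModule' (G := G) (k := ℂ) V) (Representation.ofModule' (G := G) (k := ℂ) W)))
  refine ⟨MonoidAlgebra.equivariantOfLinearOfComm f.toLinearMap fun g v => ?_, fun h0 => hf ?_⟩
  · have := LinearMap.congr_fun (f.isIntertwining' g) v
    simp only [LinearMap.comp_apply, ofModule'_apply] at this
    exact this
  · refine Representation.IntertwiningMap.ext (LinearMap.ext fun v => ?_)
    exact LinearMap.congr_fun h0 v

lemma exists_iso (n : ℕ) : ∀ (V W : Type) [AddCommGroup V] [Module ℂ V] [Module (MonoidAlgebra ℂ G) V]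
    [IsScalarTower ℂ (MonoidAlgebra ℂ G) V] [AddCommGroup W] [Module ℂ W]
    [Module (MonoidAlgebra ℂ G) W] [IsScalarTower ℂ (MonoidAlgebra ℂ G) W]
    [FiniteDimensional ℂ V] [FiniteDimensional ℂ W]
    (_ : Module.finrank ℂ V = n) (_ : ∀ g : G, chr V g = chr W g),
    Nonempty (V ≃ₗ[MonoidAlgebra ℂ G] W) := by
  induction n using Nat.strong_induction_on with
  | _ n ih =>
  intro V W _ _ _ _ _ _ _ _ _ _ hn h
  have hVW : Module.finrank ℂ V = Module.finrank ℂ W := by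
    have := h 1
    unfold chr at this
    rw [Representation.char_one, Representation.char_one] at this
    exact_mod_cast this
  rcases subsingleton_or_nontrivial V with hV | hV
  · have : Subsingleton W := by
      rw [← Module.finrank_zero_iff (R := ℂ), ← hVW, Module.finrank_zero_iff]; exact hV
    exact ⟨⟨0, 0, fun _ => Subsingleton.elim _ _, fun _ => Subsingleton.elim _ _⟩⟩
  · obtain ⟨f, hf⟩ := exists_hom_ne h
    have hne : NeZero (Nat.card G : ℂ) := ⟨by simp [Nat.card_pos.ne']⟩
    obtain ⟨C, hC⟩ := exists_isCompl (LinearMap.ker f)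
    obtain ⟨W', hW'⟩ := exists_isCompl (LinearMap.range f)
    let eV := Submodule.prodEquivOfIsCompl _ _ hC
    let eW := Submodule.prodEquivOfIsCompl _ _ hW'
    let e : C ≃ₗ[MonoidAlgebra ℂ G] LinearMap.range f :=
      (Submodule.quotientEquivOfIsCompl _ _ hC).symm ≪≫ₗ f.quotKerEquivRange
    have fd : ∀ P : Submodule (MonoidAlgebra ℂ G) V, FiniteDimensional ℂ P := fun P =>
      FiniteDimensional.of_injective (P.subtype.restrictScalars ℂ) Subtype.val_injective
    have fd' : ∀ P : Submodule (MonoidAlgebra ℂ G) W, FiniteDimensional ℂ P := fun P =>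
      FiniteDimensional.of_injective (P.subtype.restrictScalars ℂ) Subtype.val_injective
    have := fd C
    have := fd (LinearMap.ker f)
    have := fd' W'
    have := fd' (LinearMap.range f)
    have hc : ∀ g : G, chr (LinearMap.ker f) g = chr W' g := by
      intro g
      have h1 := chr_equiv eV g
      have h2 := chr_equiv eW g
      rw [chr_prod] at h1 h2
      have h3 := chr_equiv e g
      linear_combination h1 - h2 + h g - h3
    have hlt : Module.finrank ℂ (LinearMap.ker f) < n := by
      rw [← hn]
      have h1 : Module.finrank ℂ (LinearMap.ker (f.restrictScalars ℂ)) < Module.finrank ℂ V := by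
        apply Submodule.finrank_lt
        intro ht
        apply hf
        ext v
        have : v ∈ LinearMap.ker (f.restrictScalars ℂ) := by rw [ht]; trivial
        exact this
      exact h1
    obtain ⟨e2⟩ := ih _ hlt _ _ rfl hc
    exact ⟨eV.symm ≪≫ₗ LinearEquiv.prodCongr e2 e ≪≫ₗ LinearEquiv.prodComm _ _ _ ≪≫ₗ eW⟩

end rep

/-- representations with equal characters are conjugate -/
lemma matrix_conj {G : Type*} [Group G] [Finite G] {r : ℕ}
    (ρ₁ ρ₂ : G →* Matrix (Fin r) (Fin r) ℂ) (h : ∀ g, (ρ₁ g).trace = (ρ₂ g).trace) :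
    ∃ P Q : Matrix (Fin r) (Fin r) ℂ, P * Q = 1 ∧ Q * P = 1 ∧ ∀ g, ρ₁ g * P = P * ρ₂ g := by
  let R1 : Representation ℂ G (Fin r → ℂ) :=
    { toFun := fun g => Matrix.toLin' (ρ₁ g)
      map_one' := by simp; rfl
      map_mul' := fun a b => by rw [map_mul, Matrix.toLin'_mul]; rfl }
  let R2 : Representation ℂ G (Fin r → ℂ) :=
    { toFun := fun g => Matrix.toLin' (ρ₂ g)
      map_one' := by simp; rfl
      map_mul' := fun a b => by rw [map_mul, Matrix.toLin'_mul]; rfl }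
  have hR1 : ∀ g v, R1 g v = (ρ₁ g).mulVec v := fun g v => rfl
  have hR2 : ∀ g v, R2 g v = (ρ₂ g).mulVec v := fun g v => rfl
  have c1 : ∀ g, chr (G := G) R1.asModule g = (ρ₁ g).trace := by
    intro g
    rw [← Matrix.trace_toLin'_eq]
    unfold chr Representation.character
    congr 1
    ext v
    rw [ofModule'_apply]
    simp [Representation.single_smul]
    rfl
  have c2 : ∀ g, chr (G := G) R2.asModule g = (ρ₂ g).trace := by
    intro g
    rw [← Matrix.trace_toLin'_eq]
    unfold chr Representation.character
    congr 1
    ext v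
    rw [ofModule'_apply]
    simp [Representation.single_smul]
    rfl
  have : FiniteDimensional ℂ R1.asModule := inferInstanceAs (FiniteDimensional ℂ (Fin r → ℂ))
  have : FiniteDimensional ℂ R2.asModule := inferInstanceAs (FiniteDimensional ℂ (Fin r → ℂ))
  obtain ⟨e⟩ := exists_iso (G := G) _ R2.asModule R1.asModule rfl (fun g => by rw [c1, c2, h])
  let e' : (Fin r → ℂ) ≃ₗ[ℂ] (Fin r → ℂ) := e.restrictScalars ℂ
  refine ⟨LinearMap.toMatrix' e'.toLinearMap, LinearMap.toMatrix' e'.symm.toLinearMap, ?_, ?_, ?_⟩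
  · rw [← LinearMap.toMatrix'_comp]; simp
  · rw [← LinearMap.toMatrix'_comp]; simp
  · intro g
    apply Matrix.toLin'.injective
    rw [Matrix.toLin'_mul, Matrix.toLin'_mul, Matrix.toLin'_toMatrix']
    refine LinearMap.ext fun v => ?_
    have key : ∀ v : R2.asModule, e (MonoidAlgebra.single g (1 : ℂ) • v) =
        MonoidAlgebra.single g (1 : ℂ) • e v := fun v => e.map_smul _ v
    simp only [Representation.single_smul, one_smul] at key
    have this := key v
    exact this.symm

end Klein

namespace Klein

section eqbasis

variable {B : Type*} [CommRing B] [Algebra ℂ B] {r : ℕ}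

/-- complex matrices acting on vectors with entries in `B` -/
def mv (M : Matrix (Fin r) (Fin r) ℂ) (c : Fin r → B) : Fin r → B := fun i => ∑ j, M i j • c j

lemma mv_mv (M N : Matrix (Fin r) (Fin r) ℂ) (c : Fin r → B) : mv M (mv N c) = mv (M * N) c := by
  ext i
  simp only [mv, Finset.smul_sum, Matrix.mul_apply, Finset.sum_smul, mul_smul]
  exact Finset.sum_comm

lemma mv_one (c : Fin r → B) : mv 1 c = c := by
  ext i
  simp [mv, Matrix.one_apply, ite_smul]

lemma mv_map (M : Matrix (Fin r) (Fin r) ℂ) (c : Fin r → B) (f : B ≃ₐ[ℂ] B) :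
    (fun i => f (mv M c i)) = mv M (fun i => f (c i)) := by
  ext i
  simp [mv, map_sum, map_smul]

lemma mv_add (M : Matrix (Fin r) (Fin r) ℂ) (c d : Fin r → B) : mv M (c + d) = mv M c + mv M d := by
  ext i
  simp [mv, Finset.sum_add_distrib]

lemma mv_mul (M : Matrix (Fin r) (Fin r) ℂ) (b : B) (c : Fin r → B) :
    mv M (fun i => b * c i) = fun i => b * mv M c i := by
  ext i
  simp [mv, Finset.mul_sum]

variable {G : Type*} [Group G] [Finite G] (act : G →* (B ≃ₐ[ℂ] B)) (κ : B →ₐ[ℂ] ℂ)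
  {Ψ : Type*} [AddCommGroup Ψ] [Module B Ψ]

lemma equivariant_basis (hκ : ∀ b, κ b ≠ 0 → IsUnit b) (hact : ∀ g b, κ (act g b) = κ b)
    (b : Module.Basis (Fin r) B Ψ) (σ : G → Ψ →+ Ψ)
    (hσ : ∀ g c φ, σ g (c • φ) = act g c • σ g φ) (h1 : ∀ φ, σ 1 φ = φ)
    (hmul : ∀ g h φ, σ (g * h) φ = σ g (σ h φ)) :
    ∃ (ρ : G →* Matrix (Fin r) (Fin r) ℂ) (ψ : Module.Basis (Fin r) B Ψ),
      ∀ g i, σ g (ψ i) = ∑ k, algebraMap ℂ B (ρ g k i) • ψ k := by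
  have := Fintype.ofFinite G
  have hσb : ∀ g i, σ g (b i) = ∑ j, b.repr (σ g (b i)) j • b j := fun g i => (b.sum_repr _).symm
  let ρ : G →* Matrix (Fin r) (Fin r) ℂ :=
    { toFun := fun g => Matrix.of fun j i => κ (b.repr (σ g (b i)) j)
      map_one' := by
        ext j i
        simp [h1, Matrix.one_apply, Finsupp.single_apply, eq_comm]
      map_mul' := by
        intro g h
        ext k i
        rw [Matrix.mul_apply]
        simp only [Matrix.of_apply]
        conv_lhs => rw [hmul, hσb h i, map_sum]
        simp only [hσ, map_sum, map_smul, Finsupp.coe_finset_sum, Finset.sum_apply,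
          Finsupp.smul_apply, smul_eq_mul, map_mul, hact]
        exact Finset.sum_congr rfl fun _ _ => mul_comm _ _ }
  have hρ : ∀ g j i, ρ g j i = κ (b.repr (σ g (b i)) j) := fun _ _ _ => rfl
  have hN : (Fintype.card G : ℂ) ≠ 0 := by simp
  let ψ0 : Fin r → Ψ := fun i => algebraMap ℂ B (Fintype.card G : ℂ)⁻¹ •
    ∑ g : G, ∑ j, algebraMap ℂ B (ρ g⁻¹ j i) • σ g (b j)
  let s : Matrix (Fin r) (Fin r) B := Matrix.of fun k i => b.repr (ψ0 i) k
  have hs : κ.toRingHom.mapMatrix s = 1 := by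
    ext k i
    have : κ (s k i) = (Fintype.card G : ℂ)⁻¹ * ∑ g : G, ∑ j, ρ g⁻¹ j i * ρ g k j := by
      simp only [s, ψ0, Matrix.of_apply, map_smul, map_sum, Finsupp.coe_finset_sum, Finset.sum_apply,
          Finsupp.smul_apply, smul_eq_mul, map_mul, hρ, AlgHom.commutes]
      simp
    change κ (s k i) = _
    rw [this]
    have : ∀ g : G, ∑ j, ρ g⁻¹ j i * ρ g k j = (1 : Matrix (Fin r) (Fin r) ℂ) k i := by
      intro g
      rw [← map_one ρ, ← mul_inv_cancel g, map_mul, Matrix.mul_apply]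
      exact Finset.sum_congr rfl fun _ _ => mul_comm _ _
    simp only [this]
    simp
  have hdet : IsUnit s.det := by
    apply hκ
    have : κ s.det = 1 := by
      have := RingHom.map_det κ.toRingHom s
      rw [hs, Matrix.det_one] at this
      exact this
    rw [this]; exact one_ne_zero
  have hdet' : IsUnit (LinearMap.toMatrix b b (Matrix.toLin b b s)).det := by
    rwa [LinearMap.toMatrix_toLin]
  let e : Ψ ≃ₗ[B] Ψ := LinearEquiv.ofIsUnitDet hdet'
  have he : ∀ i, (b.map e) i = ψ0 i := by
    intro i
    rw [Module.Basis.map_apply]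
    change Matrix.toLin b b s (b i) = _
    rw [Matrix.toLin_self]
    exact b.sum_repr _
  refine ⟨ρ, b.map e, fun g0 i => ?_⟩
  simp only [he]
  have hC : ∀ g (c : ℂ), act g (algebraMap ℂ B c) = algebraMap ℂ B c := fun g c => (act g).commutes c
  simp only [ψ0, hσ, map_sum, hC]
  simp only [smul_smul, Finset.smul_sum, ← map_mul, ← hmul]
  conv_rhs => rw [Finset.sum_comm]
  refine Fintype.sum_equiv (Equiv.mulLeft g0) _ _ fun g => ?_
  conv_rhs => rw [Finset.sum_comm]
  refine Finset.sum_congr rfl fun j _ => ?_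
  simp only [Equiv.coe_mulLeft]
  rw [← Finset.sum_smul, ← map_sum]
  congr 2
  have : g⁻¹ = (g0 * g)⁻¹ * g0 := by group
  conv_lhs => rw [this, map_mul, Matrix.mul_apply]
  rw [Finset.mul_sum]
  exact Finset.sum_congr rfl fun _ _ => by ring

end eqbasis

end Klein

namespace Klein

lemma QuadData.two_x_eq {A S X : Type*} [CommRing A] [CommRing S] [Algebra A S] (D : QuadData A S)
    [AddCommGroup X] [Module S X] [Module A X] [IsScalarTower A S X] {ι : Type*} [Fintype ι]
    (b : Module.Basis ι A X) (m : X) :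
    (2 * D.x) • m = ∑ i, D.ell (b.coord i) m • b i := by
  simp only [D.ell_apply, add_smul, Finset.sum_add_distrib, Module.Basis.coord_apply,
      algebraMap_smul, b.sum_repr]
  rw [mul_smul, two_smul]
  congr 1
  conv_lhs => rw [← b.sum_repr m]
  rw [Finset.smul_sum]
  refine Finset.sum_congr rfl fun i _ => ?_
  rw [mul_comm, mul_smul, algebraMap_smul]

theorem allTau_of_group {A S B : Type} [CommRing A] [Nontrivial A] [CommRing S] [Algebra A S]
    (D : QuadData A S) [CommRing B] [IsDomain B] [IsLocalRing B] [IsNoetherianRing B] [Algebra ℂ B]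
    [Algebra S B] {u v : B} (hm : IsLocalRing.maximalIdeal B = Ideal.span {u, v})
    (hreg : TwoReg u v B) (κ : B →ₐ[ℂ] ℂ) (hκ : ∀ b, κ b ≠ 0 → IsUnit b)
    {Γ : Type} [Group Γ] [Finite Γ] (act : Γ →* (B ≃ₐ[ℂ] B)) (hact : ∀ g b, κ (act g b) = κ b)
    (sg : Γ →* ℂ) (hι : Function.Injective (algebraMap S B))
    (hA : ∀ γ a, act γ (algebraMap S B (algebraMap A S a)) = algebraMap S B (algebraMap A S a))
    (hx : ∀ γ, act γ (algebraMap S B D.x) = sg γ • algebraMap S B D.x)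
    (hinv : ∀ b, (∀ γ, sg γ = 1 → act γ b = b) → ∃ s, algebraMap S B s = b)
    (k : Γ) (hk : sg k = -1) (hconj : ∀ g, sg g = 1 → ∃ k, sg k = -1 ∧ k * g * k⁻¹ = g⁻¹) :
    AllTau D := by
  intro X _ _ _ _ hfree hfin
  let G := sg.ker
  have hGS : ∀ (g : G) (s : S), act g (algebraMap S B s) = algebraMap S B s := by
    intro g s
    rw [D.hc s]
    have : sg g = 1 := g.2
    simp [hA, hx, this]
  have hkS : ∀ (s : S), act k (algebraMap S B (D.x * s)) = - (algebraMap S B D.x * act k (algebraMap S B s)) := by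
    intro s
    rw [map_mul, map_mul, hx, hk]; simp
  have : Module.Finite S X := Module.Finite.of_restrictScalars_finite A S X
  have fin : Module.Finite B (X →ₗ[S] B) := by
    obtain ⟨n, q, hq⟩ := Module.Finite.exists_fin' S X
    let ev : (X →ₗ[S] B) →ₗ[B] (Fin n → B) :=
      { toFun := fun φ i => φ (q (Pi.single i 1))
        map_add' := fun _ _ => rfl
        map_smul' := fun _ _ => rfl }
    refine Module.Finite.of_injective ev ?_
    intro φ φ' h
    have : φ ∘ₗ q = φ' ∘ₗ q := by
      refine LinearMap.pi_ext' fun i => ?_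
      ext
      exact congrFun h i
    refine LinearMap.ext fun m => ?_
    obtain ⟨y, rfl⟩ := hq m
    exact LinearMap.congr_fun this y
  have free : Module.Free B (X →ₗ[S] B) := TwoReg.free hm (TwoReg.hom hreg)
  let b := Module.finBasis B (X →ₗ[S] B)
  let σ : G → (X →ₗ[S] B) →+ (X →ₗ[S] B) := fun g =>
    { toFun := fun φ =>
        { toFun := fun m => act g (φ m)
          map_add' := fun m n => by simp
          map_smul' := fun s m => by
            simp [Algebra.smul_def, hGS] }
      map_zero' := by ext; simp
      map_add' := fun φ φ' => by ext; simp }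
  have hσ : ∀ g φ m, σ g φ m = act g (φ m) := fun _ _ _ => rfl
  obtain ⟨ρ, ψ, hψ⟩ := equivariant_basis (act.comp G.subtype) κ hκ (fun g => hact g) b σ
    (fun g c φ => by
      ext m; simp [hσ])
    (fun φ => by ext m; simp [hσ]) (fun g h φ => by ext m; simp [hσ])
  clear_value b
  clear b
  generalize Module.finrank B (X →ₗ[S] B) = r at ρ ψ hψ
  have hι0 : ∀ s : S, algebraMap S B s = 0 → s = 0 := fun s h => hι (by rw [h, map_zero])
  -- evaluation vectors
  let ev : X → Fin r → B := fun m i => ψ i m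
  let ac : Γ → (Fin r → B) → Fin r → B := fun g c i => act g (c i)
  have ac_mul : ∀ g h c, ac (g * h) c = ac g (ac h c) := fun g h c => by
    ext i; simp [ac]
  have ac_mv : ∀ g M c, ac g (mv M c) = mv M (ac g c) := fun g M c => mv_map M c (act g)
  have hE : ∀ (g : G) m, ac g (ev m) = mv (ρ g).transpose (ev m) := by
    intro g m
    ext i
    have := LinearMap.congr_fun (hψ g i) m
    rw [hσ] at this
    simp only [ac, ev, mv, Matrix.transpose_apply, Algebra.smul_def]
    rw [this]
    simp [Algebra.smul_def]
  -- linear combinations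
  let co : (Fin r → B) → (X →ₗ[S] B) := fun d => ∑ i, d i • ψ i
  have hco : ∀ (g : G) d, σ g (co d) = co (mv (ρ g) (ac g d)) := by
    intro g d
    have : σ g (co d) = ∑ i, act g (d i) • σ g (ψ i) := by
      ext m
      simp only [hσ, co, LinearMap.sum_apply, map_sum, LinearMap.smul_apply, smul_eq_mul, map_mul]
    rw [this]
    simp only [hψ, co, mv, ac, Finset.smul_sum, Finset.sum_smul]
    rw [Finset.sum_comm]
    refine Finset.sum_congr rfl fun i _ => Finset.sum_congr rfl fun j _ => ?_
    rw [smul_smul, Algebra.smul_def, mul_comm]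
  have co_inj : ∀ d d', co d = co d' → d = d' := by
    intro d d' h
    have h1 : ∀ d i, ψ.repr (co d) i = d i := fun d i => by
      simp [co, map_sum, Finsupp.single_apply, Finset.sum_ite_eq']
    ext i
    rw [← h1 d, h, h1]
  -- invariant functionals
  let jj : (X →ₗ[S] S) → (X →ₗ[S] B) := fun l => Algebra.linearMap S B ∘ₗ l
  have hjj : ∀ l m, jj l m = algebraMap S B (l m) := fun _ _ => rfl
  have jj_inj : ∀ l l', jj l = jj l' → l = l' := fun l l' h => by
    ext m
    exact hι (LinearMap.congr_fun h m)
  have jj_σ : ∀ (g : G) l, σ g (jj l) = jj l := fun g l => by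
    ext m
    rw [hσ, hjj, hGS]
  have jj_surj : ∀ φ, (∀ g : G, σ g φ = φ) → ∃ l, jj l = φ := by
    intro φ hφ
    have : ∀ m, ∃ s, algebraMap S B s = φ m := fun m => hinv _ fun γ hγ => by
      rw [← hσ ⟨γ, hγ⟩, hφ]
    choose l hl using this
    refine ⟨{ toFun := l, map_add' := fun m n => hι ?_, map_smul' := fun s m => hι ?_ }, ?_⟩
    · rw [map_add, hl, hl, hl, map_add]
    · rw [smul_eq_mul, map_mul, hl, RingHom.id_apply, hl, map_smul, Algebra.smul_def]
    · ext m; exact hl m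
  -- the twist
  have hkinv : sg k⁻¹ = -1 := by
    have : sg k⁻¹ * sg k = 1 := by rw [← map_mul]; simp
    rw [hk] at this; linear_combination -this
  let θ : G → G := fun g => ⟨k⁻¹ * g * k, by
    have : sg g = 1 := g.2
    rw [MonoidHom.mem_ker, map_mul, map_mul, hk, hkinv, this]; norm_num⟩
  have θ_surj : ∀ g : G, ∃ g', θ g' = g := fun g => ⟨⟨k * g * k⁻¹, by
    have : sg g = 1 := g.2
    rw [MonoidHom.mem_ker, map_mul, map_mul, hk, hkinv, this]; norm_num⟩, by
      ext; simp [θ, mul_assoc]⟩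
  have hθ : ∀ (g : G) c, ac g (ac k c) = ac k (ac (θ g) c) := fun g c => by
    rw [← ac_mul, ← ac_mul]
    congr 1
    simp [θ, mul_assoc]
  have θ_mul : ∀ g h : G, θ (g * h) = θ g * θ h := fun g h => by
    ext; simp [θ, mul_assoc]
  have θ_one : θ 1 = 1 := by
    ext; simp [θ]
  let ρ' : G →* Matrix (Fin r) (Fin r) ℂ :=
    { toFun := fun g => (ρ (θ g)⁻¹).transpose
      map_one' := by simp [θ_one]
      map_mul' := fun g h => by rw [θ_mul, mul_inv_rev, map_mul, Matrix.transpose_mul] }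
  obtain ⟨P, Q, hPQ, hQP, hP⟩ := matrix_conj ρ ρ' (by
    intro g
    change _ = (ρ (θ g)⁻¹).transpose.trace
    rw [Matrix.trace_transpose]
    obtain ⟨k', hk', hk2⟩ := hconj g g.2
    let γ : G := ⟨k⁻¹ * k', by rw [MonoidHom.mem_ker, map_mul, hkinv, hk']; norm_num⟩
    have : (θ g)⁻¹ = γ * g * γ⁻¹ := by
      ext
      simp only [θ, γ, Subgroup.coe_inv, Subgroup.coe_mul]
      have h3 : (g : Γ) = k' ⁻¹ * (g : Γ)⁻¹ * k' := by rw [← hk2]; group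
      conv_rhs => rw [h3]
      group
    rw [this, map_mul, Matrix.trace_mul_comm, ← map_mul]
    congr 2
    group)
  have hP : ∀ g, ρ g * P * (ρ (θ g)).transpose = P := by
    intro g
    rw [hP]
    change P * (ρ (θ g)⁻¹).transpose * _ = P
    rw [mul_assoc, ← Matrix.transpose_mul, ← map_mul]
    simp
  have hQ : ∀ g, (ρ (θ g)).transpose * Q * ρ g = Q := by
    intro g
    have h1 : (ρ g * P) * ((ρ (θ g)).transpose * Q) = 1 := by
      rw [← mul_assoc, hP, hPQ]
    have h2 := mul_eq_one_comm.mp h1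
    calc _ = (ρ (θ g)).transpose * Q * ρ g * (P * Q) := by rw [hPQ, mul_one]
      _ = ((ρ (θ g)).transpose * Q * (ρ g * P)) * Q := by simp only [mul_assoc]
      _ = Q := by rw [h2, one_mul]
  let F : X → (X →ₗ[S] B) := fun m => co (mv P (ac k (ev m)))
  have F_inv : ∀ m (g : G), σ g (F m) = F m := by
    intro m g
    simp only [F]
    rw [hco, ac_mv, hθ, hE, ac_mv, mv_mv, mv_mv, hP]
  have co_add : ∀ d d', co (d + d') = co d + co d' := fun d d' => by
    simp [co, add_smul, Finset.sum_add_distrib]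
  have co_smul : ∀ (s : B) d, co (fun i => s * d i) = s • co d := fun s d => by
    simp [co, mul_smul, Finset.smul_sum]
  have F_add : ∀ m n, F (m + n) = F m + F n := by
    intro m n
    simp only [F]
    rw [← co_add, ← mv_add]
    congr 2
    ext i
    simp [ac, ev]
  have F_A : ∀ (a : A) m, F (a • m) = algebraMap S B (algebraMap A S a) • F m := by
    intro a m
    simp only [F]
    rw [← co_smul, ← mv_mul]
    congr 2
    ext i
    simp only [ac, ev]
    rw [← algebraMap_smul S, map_smul, Algebra.smul_def, map_mul, hA]
  have F_x : ∀ m, F (D.x • m) = (- algebraMap S B D.x) • F m := by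
    intro m
    simp only [F]
    rw [← co_smul, ← mv_mul]
    congr 2
    ext i
    simp only [ac, ev]
    rw [map_smul, Algebra.smul_def, map_mul, hx, hk]
    simp
  choose T hT using fun m => jj_surj (F m) (F_inv m)
  let τ0 : X →ₗ[A] (X →ₗ[S] S) :=
    { toFun := T
      map_add' := fun m n => jj_inj _ _ (by
        rw [hT, F_add, ← hT, ← hT]
        ext y; simp [hjj])
      map_smul' := fun a m => jj_inj _ _ (by
        rw [hT, F_A, ← hT]
        ext y
        simp only [hjj, LinearMap.smul_apply, RingHom.id_apply, Algebra.smul_def, map_mul]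
        rfl) }
  have hinj : Function.Injective τ0 := by
    rw [← LinearMap.ker_eq_bot, LinearMap.ker_eq_bot']
    intro m hm0
    have h1 : F m = 0 := by
      rw [← hT]
      have : T m = 0 := hm0
      rw [this]
      ext y; simp [hjj]
    have h2 : mv P (ac k (ev m)) = 0 := by
      apply co_inj
      change F m = _
      rw [h1]
      simp [co]
    have h3 : ac k (ev m) = 0 := by
      rw [← mv_one (ac k (ev m)), ← hQP, ← mv_mv, h2]
      ext i; simp [mv]
    have h4 : ∀ i, ψ i m = 0 := fun i => by
      have := congrFun h3 i
      exact (map_eq_zero_iff (act k) (act k).injective).mp this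
    apply D.eq_zero_of_dual
    intro l
    apply hι0
    rw [← hjj, ← ψ.sum_repr (jj l)]
    simp only [LinearMap.sum_apply, LinearMap.smul_apply, h4, smul_zero, Finset.sum_const_zero]
  have hsurj : Function.Surjective τ0 := by
    intro l
    obtain ⟨d, hd⟩ : ∃ d, co d = jj l := ⟨fun i => ψ.repr (jj l) i, ψ.sum_repr _⟩
    have hd1 : ∀ g : G, mv (ρ g) (ac g d) = d := fun g => by
      apply co_inj
      rw [← hco, hd, jj_σ]
    let c : Fin r → B := ac k⁻¹ (mv Q d)
    have hkc : ac k c = mv Q d := by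
      simp only [c]
      rw [← ac_mul]
      ext i; simp [ac]
    have hc : ∀ g : G, ac g c = mv (ρ g).transpose c := by
      intro g
      obtain ⟨g, rfl⟩ := θ_surj g
      have inj : ∀ c c', ac k c = ac k c' → c = c' := fun c c' h => by
        ext i; exact (act k).injective (congrFun h i)
      apply inj
      rw [← hθ, hkc, ac_mv, ac_mv, hkc]
      conv_rhs => rw [← hd1 g]
      rw [mv_mv, mv_mv, hQ]
    let Φ : (X →ₗ[S] B) →ₗ[B] B := ψ.constr B c
    have hΦ : ∀ d, Φ (co d) = ∑ i, d i * c i := fun d => by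
      simp [co, Φ, Module.Basis.constr_basis]
    have hΦσ : ∀ (g : G) φ, Φ (σ g φ) = act g (Φ φ) := by
      intro g φ
      obtain ⟨d, rfl⟩ : ∃ d, co d = φ := ⟨fun i => ψ.repr φ i, ψ.sum_repr _⟩
      rw [hco, hΦ, hΦ, map_sum]
      simp only [map_mul]
      have : ∀ i, act g (c i) = mv (ρ g).transpose c i := fun i => congrFun (hc g) i
      simp only [this, mv, Matrix.transpose_apply, Finset.sum_mul, Finset.mul_sum]
      rw [Finset.sum_comm]
      refine Finset.sum_congr rfl fun i _ => Finset.sum_congr rfl fun j _ => ?_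
      simp [ac]
    have : ∀ l, ∃ s, algebraMap S B s = Φ (jj l) := fun l => hinv _ fun γ hγ => by
      have := hΦσ ⟨γ, hγ⟩ (jj l)
      rw [← this, jj_σ]
    choose Φ0 hΦ0 using this
    obtain ⟨m, hm⟩ := D.reflexive (X := X)
      { toFun := Φ0
        map_add' := fun l l' => hι (by
          rw [map_add, hΦ0, hΦ0, hΦ0, ← map_add]
          congr 1
          ext y; simp [hjj])
        map_smul' := fun s l => hι (by
          rw [smul_eq_mul, map_mul, RingHom.id_apply, hΦ0, hΦ0, ← smul_eq_mul, ← map_smul]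
          congr 1
          ext y; simp [hjj, Algebra.smul_def]) }
    have hm : ∀ l, Φ (jj l) = algebraMap S B (l m) := fun l => by
      rw [← hΦ0, ← hm]; rfl
    have h2x : algebraMap S B (2 * D.x) ≠ 0 := by
      intro h
      have h := congrArg D.c (hι0 _ h)
      rw [two_mul, map_add, D.cx, map_zero] at h
      have h2 := D.hhalf
      have : (1 : A) = 0 := by linear_combination D.half * h - h2
      exact one_ne_zero this
    have key : ∀ φ, Φ φ = φ m := by
      intro φ
      apply mul_left_cancel₀ h2x
      let b := Module.Free.chooseBasis A X
      have e1 : algebraMap S B (2 * D.x) • φ = ∑ i, φ (b i) • jj (D.ell (b.coord i)) := by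
        ext y
        have := congrArg φ (D.two_x_eq b y)
        rw [map_smul, Algebra.smul_def, map_sum] at this
        simp only [LinearMap.smul_apply, smul_eq_mul, LinearMap.sum_apply, hjj]
        rw [this]
        refine Finset.sum_congr rfl fun i _ => ?_
        rw [map_smul, Algebra.smul_def, mul_comm]
      have e2 := congrArg Φ e1
      have e3 := LinearMap.congr_fun e1 m
      rw [map_smul, map_sum] at e2
      simp only [map_smul, hm, LinearMap.smul_apply, smul_eq_mul, LinearMap.sum_apply, hjj] at e2 e3
      rw [e2, e3]
    refine ⟨m, jj_inj _ _ ?_⟩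
    change jj (T m) = _
    rw [hT, ← hd]
    simp only [F]
    have : ev m = c := by
      ext i
      simp only [ev]
      rw [← key]
      simp [Φ, Module.Basis.constr_basis]
    rw [this, hkc, mv_mv, hPQ, mv_one]
  refine ⟨LinearEquiv.ofBijective τ0 ⟨hinj, hsurj⟩, fun m => jj_inj _ _ ?_⟩
  change jj (T (D.x • m)) = jj (- (D.x • T m))
  rw [hT, F_x, ← hT]
  ext y
  simp [hjj]

end Klein

namespace Klein

lemma precomplete_pi {A : Type*} [CommRing A] (I : Ideal A) [IsPrecomplete I A] (N : ℕ) :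
    IsPrecomplete I (Fin N → A) := by
  have key : ∀ (n : ℕ) (x : Fin N → A), x ∈ (I ^ n • ⊤ : Submodule A (Fin N → A)) ↔
      ∀ i, x i ∈ I ^ n := by
    intro n x
    constructor
    · intro hx i
      have : (I ^ n • ⊤ : Submodule A (Fin N → A)) ≤
          Submodule.comap (LinearMap.proj i : (Fin N → A) →ₗ[A] A) (I ^ n) := by
        rw [Submodule.smul_le]
        intro r hr m _
        change r * m i ∈ I ^ n
        exact Ideal.mul_mem_right _ _ hr
      exact this hx
    · intro h
      rw [pi_eq_sum_univ' x]
      exact Submodule.sum_mem _ fun i _ => Submodule.smul_mem_smul (h i) trivial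
  constructor
  intro f hf
  have : ∀ i, ∃ L : A, ∀ n, f n i ≡ L [SMOD (I ^ n • ⊤ : Submodule A A)] := by
    intro i
    apply IsPrecomplete.prec' (fun n => f n i)
    intro m n hmn
    have := hf hmn
    rw [SModEq.sub_mem] at this ⊢
    rw [key] at this
    simpa using this i
  choose L hL using this
  refine ⟨L, fun n => ?_⟩
  rw [SModEq.sub_mem, key]
  intro i
  have := hL i n
  rw [SModEq.sub_mem] at this
  simpa using this

/-- complete Nakayama -/
lemma nak {A B : Type*} [CommRing A] [CommRing B] (φ : A →+* B) (I : Ideal A) [IsAdicComplete I A]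
    (hB : ∀ x, (∀ k, x ∈ (I.map φ) ^ k) → x = 0) {N : ℕ} (e : Fin N → B)
    (h : ∀ b, ∃ a : Fin N → A, b - ∑ i, φ (a i) * e i ∈ I.map φ) (b : B) :
    ∃ a : Fin N → A, b = ∑ i, φ (a i) * e i := by
  letI := φ.toAlgebra
  have key : ∀ n x, x ∈ (I ^ n • ⊤ : Submodule A B) ↔ x ∈ (I.map φ) ^ n := by
    intro n x
    rw [← Ideal.map_pow, Ideal.smul_top_eq_map]
    rfl
  have := precomplete_pi I N
  have : IsHausdorff I B := ⟨fun x hx => hB x fun k => by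
    have := hx k
    rwa [SModEq.zero, key] at this⟩
  let f : (Fin N → A) →ₗ[A] B := Fintype.linearCombination A e
  have hf : ∀ a, f a = ∑ i, φ (a i) * e i := fun a => by
    simp only [f, Fintype.linearCombination_apply, Algebra.smul_def]
    rfl
  have : Function.Surjective f := by
    apply surjective_of_mkQ_comp_surjective (I := I)
    intro y
    obtain ⟨b, rfl⟩ := Submodule.mkQ_surjective _ y
    obtain ⟨a, ha⟩ := h b
    refine ⟨a, ?_⟩
    rw [LinearMap.comp_apply, eq_comm, ← sub_eq_zero, ← map_sub, Submodule.mkQ_apply,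
      Submodule.Quotient.mk_eq_zero, hf]
    have := (key 1 _).mpr (by rwa [pow_one])
    rwa [pow_one] at this
  obtain ⟨a, ha⟩ := this b
  exact ⟨a, by rw [← hf, ha]⟩

section inv
variable {A B : Type*} [CommRing A] [IsDomain A] [CommRing B] [IsDomain B]
  {Γ : Type*} [Group Γ]

/-- finiteness of the group, Galois theory -/
lemma galois_aux (φ : A →+* B) (hφ : Function.Injective φ) {N : ℕ} (e : Fin N → B)
    (he : ∀ b, ∃ a : Fin N → A, b = ∑ i, φ (a i) * e i)
    (act : Γ →* (B ≃+* B)) (hact : Function.Injective act)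
    (hA : ∀ γ a, act γ (φ a) = φ a) :
    Finite Γ ∧ Nat.card Γ ≤ N ∧ (IsIntegrallyClosed A → N ≤ Nat.card Γ → ∀ b, (∀ γ, act γ b = b) → ∃ a, φ a = b) := by
  letI := φ.toAlgebra
  have hAB : Function.Injective (algebraMap A B) := hφ
  have : FaithfulSMul A B := (faithfulSMul_iff_algebraMap_injective A B).mpr hφ
  have hspan : (⊤ : Submodule A B) = Submodule.span A (Set.range e) := by
    symm
    rw [eq_top_iff]
    rintro b -
    obtain ⟨a, rfl⟩ := he b
    refine Submodule.sum_mem _ fun i _ => ?_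
    have : φ (a i) * e i = a i • e i := by rw [Algebra.smul_def]; rfl
    rw [this]
    exact Submodule.smul_mem _ _ (Submodule.subset_span ⟨i, rfl⟩)
  have hfin : Module.Finite A B := ⟨by
    rw [hspan]; exact Submodule.fg_span (Set.finite_range e)⟩
  have hint : Algebra.IsIntegral A B := inferInstance
  let K := FractionRing A
  let L := FractionRing B
  letI : Algebra K L := FractionRing.liftAlgebra A L
  have : IsScalarTower A K L := FractionRing.isScalarTower_liftAlgebra A L
  have hloc : IsLocalization (Algebra.algebraMapSubmonoid B (nonZeroDivisors A)) L :=
    inferInstance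
  have hs2 : Submodule.span K (algebraMap B L '' Set.range e) = ⊤ :=
    span_eq_top_localization_localization K (nonZeroDivisors A) L hspan.symm
  rw [← Set.range_comp] at hs2
  have hfd : FiniteDimensional K L := ⟨by
    rw [← hs2]; exact Submodule.fg_span (Set.finite_range _)⟩
  have hrk : Module.finrank K L ≤ N := by
    have := finrank_range_le_card (R := K) (b := algebraMap B L ∘ e)
    rw [Set.finrank, hs2, finrank_top] at this
    simpa using this
  let ψ : Γ →* (B ≃ₐ[A] B) :=
    { toFun := fun γ => AlgEquiv.ofRingEquiv (f := act γ) (fun a => hA γ a)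
      map_one' := by ext b; simp
      map_mul' := fun γ δ => by ext b; simp }
  have hψ : Function.Injective ψ := fun γ δ h => hact (by
    ext b
    exact DFunLike.congr_fun h b)
  let Ψ : Γ →* (L ≃ₐ[K] L) := (IsFractionRing.fieldEquivOfAlgEquivHom K L).comp ψ
  have hΨ : Function.Injective Ψ :=
    (IsFractionRing.fieldEquivOfAlgEquivHom_injective A B K L).comp hψ
  have hcard : Nat.card (L ≃ₐ[K] L) ≤ Module.finrank K L := by
    rw [Nat.card_eq_fintype_card]
    exact AlgEquiv.card_le
  have hfin' : Finite Γ := Finite.of_injective Ψ hΨ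
  have hc1 : Nat.card Γ ≤ Nat.card (L ≃ₐ[K] L) := Nat.card_le_card_of_injective Ψ hΨ
  refine ⟨hfin', hc1.trans (hcard.trans hrk), fun hic hN b hb => ?_⟩
  have heq : Nat.card (L ≃ₐ[K] L) = Module.finrank K L := by omega
  have hgal : IsGalois K L := IsGalois.of_card_aut_eq_finrank K L heq
  have hsurj : Function.Surjective Ψ :=
    ((Nat.bijective_iff_injective_and_card Ψ).mpr ⟨hΨ, by omega⟩).2
  have hmem : algebraMap B L b ∈ Set.range (algebraMap K L) := by
    rw [IsGalois.mem_range_algebraMap_iff_fixed]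
    intro f
    obtain ⟨γ, rfl⟩ := hsurj f
    change IsFractionRing.fieldEquivOfAlgEquiv K L L (ψ γ) (algebraMap B L b) = _
    rw [IsFractionRing.fieldEquivOfAlgEquiv_algebraMap]
    exact congrArg _ (hb γ)
  obtain ⟨x, hx⟩ := hmem
  have hxi : IsIntegral A x := by
    have h1 : IsIntegral A (algebraMap B L b) := (hint.isIntegral b).algebraMap
    rw [← hx] at h1
    exact (isIntegral_algebraMap_iff (algebraMap K L).injective).mp h1
  obtain ⟨a, rfl⟩ := IsIntegrallyClosed.isIntegral_iff.mp hxi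
  refine ⟨a, IsFractionRing.injective B L ?_⟩
  rw [← hx, ← IsScalarTower.algebraMap_apply, IsScalarTower.algebraMap_apply A B L]
  rfl

end inv

end Klein

namespace Klein

instance P2_ufd : UniqueFactorizationMonoid P2 := by
  have e1 : MvPowerSeries (Fin 1) ℂ ≃+* PowerSeries ℂ :=
    (MvPowerSeries.renameEquiv ℂ (Equiv.ofUnique (Fin 1) Unit)).toRingEquiv
  have : IsPrincipalIdealRing (MvPowerSeries (Fin 1) ℂ) :=
    IsPrincipalIdealRing.of_surjective e1.symm.toRingHom e1.symm.surjective
  have : IsDomain (MvPowerSeries (Fin 1) ℂ) := NoZeroDivisors.to_isDomain _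
  exact MulEquiv.uniqueFactorizationMonoid (MvPowerSeries.finSuccEquiv ℂ 1).symm.toMulEquiv
    inferInstance

lemma prime_X0 : Prime (MvPowerSeries.X 0 : P2) := by
  rw [← MulEquiv.prime_iff (MvPowerSeries.finSuccEquiv ℂ 1)]
  rw [MvPowerSeries.finSuccEquiv_X_zero]
  have : IsDomain (MvPowerSeries (Fin 1) ℂ) := NoZeroDivisors.to_isDomain _
  exact PowerSeries.X_prime

lemma X0_not_dvd_X1 : ¬ (MvPowerSeries.X 0 : P2) ∣ MvPowerSeries.X 1 := by
  rw [MvPowerSeries.X_dvd_iff]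
  intro h
  have := h (Finsupp.single 1 1) (by simp)
  simp [MvPowerSeries.coeff_X] at this

lemma unit_of_dvd {d : P2} {a b : ℕ} (h0 : d ∣ MvPowerSeries.X 0 ^ a)
    (h1 : d ∣ MvPowerSeries.X 1 ^ b) : IsUnit d := by
  obtain ⟨i, -, hi⟩ := (dvd_prime_pow prime_X0 a).1 h0
  rcases Nat.eq_zero_or_pos i with rfl | hpos
  · exact hi.isUnit_iff.mpr (by simp)
  · exact absurd (prime_X0.dvd_of_dvd_pow
      ((dvd_pow_self _ hpos.ne').trans (hi.symm.dvd.trans h1))) X0_not_dvd_X1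

/-- substitution -/
def sb (Y Z : P2) (hY : MvPowerSeries.constantCoeff Y = 0) (hZ : MvPowerSeries.constantCoeff Z = 0) :
    P2 →ₐ[ℂ] P2 :=
  MvPowerSeries.substAlgHom (a := ![Y, Z]) (MvPowerSeries.hasSubst_of_constantCoeff_zero
    (by intro i; fin_cases i <;> simp [hY, hZ]))

section sb
variable {Y Z : P2} (hY : MvPowerSeries.constantCoeff Y = 0) (hZ : MvPowerSeries.constantCoeff Z = 0)

lemma sb_X0 : sb Y Z hY hZ (MvPowerSeries.X 0) = Y :=
  (MvPowerSeries.substAlgHom_X _ _).trans rfl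

lemma sb_X1 : sb Y Z hY hZ (MvPowerSeries.X 1) = Z :=
  (MvPowerSeries.substAlgHom_X _ _).trans rfl

lemma algMap_P2 (c : ℂ) : MvPowerSeries.constantCoeff (algebraMap ℂ P2 c) = c := by
  rw [MvPowerSeries.algebraMap_apply]
  simp

lemma sb_const (p : P2) : MvPowerSeries.constantCoeff (sb Y Z hY hZ p) =
    MvPowerSeries.constantCoeff p := by
  obtain ⟨a, b, h⟩ := exists_decomp (p := p - algebraMap ℂ P2 (MvPowerSeries.constantCoeff p))
    (by rw [map_sub, algMap_P2, sub_self])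
  have h2 := congrArg (fun q => MvPowerSeries.constantCoeff (sb Y Z hY hZ q)) h
  simp only [map_sub, map_add, map_mul, sb_X0, sb_X1, AlgHom.commutes, algMap_P2, hY, hZ,
    mul_zero, add_zero] at h2
  linear_combination h2

lemma sb_comp {Y' Z' : P2} (hY' : MvPowerSeries.constantCoeff Y' = 0)
    (hZ' : MvPowerSeries.constantCoeff Z' = 0) (p : P2) :
    sb Y' Z' hY' hZ' (sb Y Z hY hZ p) = sb (sb Y' Z' hY' hZ' Y) (sb Y' Z' hY' hZ' Z)
      (by rw [sb_const, hY]) (by rw [sb_const, hZ]) p := by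
  unfold sb
  rw [MvPowerSeries.substAlgHom_comp_substAlgHom_apply]
  simp only [MvPowerSeries.substAlgHom_apply]
  congr 1
  ext i : 1
  fin_cases i <;> simp

lemma sb_congr {Y' Z' : P2} (h1 : Y = Y') (h2 : Z = Z') (p : P2) :
    sb Y Z hY hZ p = sb Y' Z' (h1 ▸ hY) (h2 ▸ hZ) p := by
  subst h1 h2; rfl

end sb

lemma sb_self (p : P2) : sb (MvPowerSeries.X 0) (MvPowerSeries.X 1) (by simp) (by simp) p = p := by
  unfold sb
  rw [MvPowerSeries.substAlgHom_apply]
  have : ![(MvPowerSeries.X 0 : P2), MvPowerSeries.X 1] = MvPowerSeries.X := by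
    ext i : 1
    fin_cases i <;> rfl
  rw [this, MvPowerSeries.subst_self]
  rfl

/-- `B = I + ` span of `n` elements -/
def Spans (I : Ideal P2) (n : ℕ) : Prop :=
  ∃ e : Fin n → P2, ∀ b, ∃ c : Fin n → ℂ, b - ∑ i, c i • e i ∈ I

lemma Spans.mono {I J : Ideal P2} {n : ℕ} (h : Spans I n) (hIJ : I ≤ J) : Spans J n := by
  obtain ⟨e, he⟩ := h
  exact ⟨e, fun b => (he b).imp fun c hc => hIJ hc⟩

lemma spans_max : Spans (Ideal.span {MvPowerSeries.X 0, MvPowerSeries.X 1}) 1 := by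
  refine ⟨fun _ => 1, fun b => ⟨fun _ => MvPowerSeries.constantCoeff b, ?_⟩⟩
  rw [← maxIdeal_eq, mem_maxIdeal]
  simp [Algebra.smul_def, algMap_P2]

lemma Spans.mul {a b c : P2} {n m : ℕ} (h1 : Spans (Ideal.span {a, c}) n)
    (h2 : Spans (Ideal.span {b, c}) m) : Spans (Ideal.span {a * b, c}) (n + m) := by
  obtain ⟨e, he⟩ := h1
  obtain ⟨e', he'⟩ := h2
  refine ⟨Fin.append e (fun j => a * e' j), fun x => ?_⟩
  obtain ⟨s, hs⟩ := he x
  obtain ⟨p, q, hpq⟩ := Ideal.mem_span_pair.mp hs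
  obtain ⟨t, ht⟩ := he' p
  obtain ⟨p', q', hpq'⟩ := Ideal.mem_span_pair.mp ht
  refine ⟨Fin.append s t, Ideal.mem_span_pair.mpr ⟨p', q + a * q', ?_⟩⟩
  simp only [Fin.sum_univ_add, Fin.append_left, Fin.append_right]
  have : ∑ i, t i • (a * e' i) = a * ∑ i, t i • e' i := by
    rw [Finset.mul_sum]
    exact Finset.sum_congr rfl fun i _ => (mul_smul_comm _ _ _).symm
  rw [this]
  linear_combination hpq + a * hpq'

lemma Spans.pow {a c : P2} {n : ℕ} (h : Spans (Ideal.span {a, c}) n) :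
    ∀ k : ℕ, Spans (Ideal.span {a ^ k, c}) (k * n)
  | 0 => by
    rw [zero_mul]
    refine ⟨fun i => i.elim0, fun b => ⟨fun i => i.elim0, ?_⟩⟩
    rw [pow_zero, Ideal.eq_top_of_isUnit_mem _ (Ideal.subset_span (Set.mem_insert _ _)) isUnit_one]
    trivial
  | k + 1 => by
    rw [pow_succ, add_mul, one_mul]
    exact (Spans.pow h k).mul h

lemma Spans.swap {a c : P2} {n : ℕ} (h : Spans (Ideal.span {a, c}) n) :
    Spans (Ideal.span {c, a}) n := by rwa [Set.pair_comm]

/-- replace generators -/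
lemma Spans.of {a c a' c' : P2} {n : ℕ} (h : Spans (Ideal.span {a, c}) n)
    (h1 : ∃ p q, p * a' + q * c' = a) (h2 : ∃ p q, p * a' + q * c' = c) :
    Spans (Ideal.span {a', c'}) n := by
  refine h.mono (Ideal.span_le.mpr ?_)
  rintro x (rfl | rfl)
  · exact Ideal.mem_span_pair.mpr h1
  · exact Ideal.mem_span_pair.mpr h2

lemma spans_uv (m n : ℕ) :
    Spans (Ideal.span {(MvPowerSeries.X 0 : P2) ^ m, (MvPowerSeries.X 1 : P2) ^ n}) (m * n) := by
  have h1 := (spans_max.swap.pow n).swap.pow m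
  simpa using h1

lemma Spans.nilp {I : Ideal P2} {n : ℕ} (h : Spans I n) (x : P2)
    (hx : MvPowerSeries.constantCoeff x = 0) : ∃ k, x ^ k ∈ I := by
  obtain ⟨e, he⟩ := h
  by_cases hI : I = ⊤
  · exact ⟨0, hI ▸ trivial⟩
  classical
  have : Module.Finite ℂ (P2 ⧸ I) := by
    refine ⟨⟨Finset.univ.image fun i => Ideal.Quotient.mk I (e i), ?_⟩⟩
    rw [eq_top_iff]
    rintro y -
    obtain ⟨b, rfl⟩ := Ideal.Quotient.mk_surjective y
    obtain ⟨c, hc⟩ := he b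
    have : Ideal.Quotient.mk I b = ∑ i, c i • Ideal.Quotient.mk I (e i) := by
      rw [← sub_eq_zero, ← Ideal.Quotient.eq_zero_iff_mem.mpr hc, map_sub, map_sum]
      rfl
    rw [this]
    exact Submodule.sum_mem _ fun i _ => Submodule.smul_mem _ _
      (Submodule.subset_span (by simp))
  have hart : IsArtinianRing (P2 ⧸ I) := IsArtinianRing.of_finite ℂ _
  have : Nontrivial (P2 ⧸ I) := Ideal.Quotient.nontrivial_iff.mpr hI
  have hloc : IsLocalRing (P2 ⧸ I) := .of_surjective' (Ideal.Quotient.mk I) Ideal.Quotient.mk_surjective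
  obtain ⟨k, hk⟩ := IsArtinianRing.isNilpotent_jacobson_bot (R := P2 ⧸ I)
  rw [IsLocalRing.jacobson_eq_maximalIdeal ⊥ bot_ne_top] at hk
  refine ⟨k, ?_⟩
  rw [← Ideal.Quotient.eq_zero_iff_mem, map_pow]
  have : Ideal.Quotient.mk I x ∈ IsLocalRing.maximalIdeal (P2 ⧸ I) := by
    have h0 : x ∈ IsLocalRing.maximalIdeal P2 := mem_maxIdeal.mpr hx
    rw [IsLocalRing.mem_maximalIdeal, mem_nonunits_iff]
    intro hu
    have hIm : I ≤ IsLocalRing.maximalIdeal P2 := IsLocalRing.le_maximalIdeal hI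
    obtain ⟨y, hy⟩ := hu.exists_right_inv
    obtain ⟨y, rfl⟩ := Ideal.Quotient.mk_surjective y
    have : x * y - 1 ∈ I := by
      rw [← Ideal.Quotient.eq_zero_iff_mem, map_sub, map_mul, hy, map_one, sub_self]
    have h1 : (1 : P2) ∈ IsLocalRing.maximalIdeal P2 := by
      have := Ideal.sub_mem _ (Ideal.mul_mem_right y _ h0) (hIm this)
      simpa using this
    exact (Ideal.ne_top_iff_one _).mp (IsLocalRing.maximalIdeal.isMaximal P2).ne_top h1
  have h2 := Ideal.pow_mem_pow this k
  rw [hk] at h2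
  exact h2

end Klein

namespace Klein

instance P2_dom : IsDomain P2 := NoZeroDivisors.to_isDomain _

section inj
variable {Y Z : P2} (hY : MvPowerSeries.constantCoeff Y = 0) (hZ : MvPowerSeries.constantCoeff Z = 0)

lemma exists_pow_mem {a : P2} (ha : ¬ (MvPowerSeries.X 0 : P2) ∣ a) :
    ∃ (k : ℕ) (p q : P2), (MvPowerSeries.X 1 : P2) ^ k = p * MvPowerSeries.X 0 + q * a := by
  have h : ∃ k : ℕ, ¬ ∃ p q : P2, a = p * MvPowerSeries.X 0 + q * MvPowerSeries.X 1 ^ k := by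
    by_contra! hcon
    apply ha
    rw [MvPowerSeries.X_dvd_iff]
    intro m hm
    obtain ⟨p, q, h⟩ := hcon (m 1 + 1)
    rw [h, map_add, MvPowerSeries.X_dvd_iff.mp (Dvd.intro_left p rfl) m hm,
      MvPowerSeries.X_pow_dvd_iff.mp (Dvd.intro_left q rfl) m (Nat.lt_succ_self _), add_zero]
  classical
  have hk := Nat.find_spec h
  have hmin := fun m => Nat.find_min h (m := m)
  set k := Nat.find h
  rcases Nat.eq_zero_or_pos k with h0 | hpos
  · exact absurd ⟨0, a, by rw [h0]; ring⟩ hk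
  · obtain ⟨k', hk'⟩ := Nat.exists_eq_succ_of_ne_zero hpos.ne'
    have := hmin k' (by omega)
    push Not at this
    obtain ⟨p, q, hpq⟩ := this
    by_cases hq : MvPowerSeries.constantCoeff q = 0
    · obtain ⟨s, t, hst⟩ := exists_decomp hq
      exact absurd ⟨p + s * MvPowerSeries.X 1 ^ k', t, by rw [hk', hpq, hst, Nat.succ_eq_add_one]; ring⟩ hk
    · have hu : IsUnit q := by
        rw [MvPowerSeries.isUnit_iff_constantCoeff]
        exact isUnit_iff_ne_zero.mpr hq
      obtain ⟨r, hr⟩ := hu.exists_left_inv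
      refine ⟨k', - r * p, r, ?_⟩
      rw [hpq]
      linear_combination (- MvPowerSeries.X 1 ^ k') * hr

lemma sb_injective (hY0 : Y ≠ 0) {N : ℕ} (hN : Spans (Ideal.span {Y, Z}) N) :
    Function.Injective (sb Y Z hY hZ) := by
  rw [injective_iff_map_eq_zero]
  intro a ha
  by_contra hne
  obtain ⟨j, a', hdvd, rfl⟩ := WfDvdMonoid.max_power_factor (a₀ := a) (x := (MvPowerSeries.X 0 : P2)) hne prime_X0.irreducible
  rw [map_mul, map_pow, sb_X0] at ha
  have ha' : sb Y Z hY hZ a' = 0 := (mul_eq_zero.mp ha).resolve_left (pow_ne_zero _ hY0)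
  obtain ⟨k, p, q, hk⟩ := exists_pow_mem hdvd
  have h1 := congrArg (sb Y Z hY hZ) hk
  rw [map_add, map_mul, map_mul, ha', map_pow, sb_X0, sb_X1, mul_zero, add_zero] at h1
  have key : ∀ x : P2, MvPowerSeries.constantCoeff x = 0 → ∃ n : ℕ, Y ∣ x ^ n := by
    intro x hx
    obtain ⟨n, hn⟩ := hN.nilp x hx
    obtain ⟨s, t, hst⟩ := Ideal.mem_span_pair.mp hn
    refine ⟨n * k, ?_⟩
    rw [pow_mul, ← hst]
    have : Y ∣ (s * Y + t * Z) ^ k - (t * Z) ^ k := by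
      refine dvd_trans ?_ (sub_dvd_pow_sub_pow _ _ k)
      rw [add_sub_cancel_right]
      exact dvd_mul_left _ _
    have h2 : Y ∣ (t * Z) ^ k := by
      rw [mul_pow, h1]
      exact Dvd.intro_left (t ^ k * sb Y Z hY hZ p) (by ring)
    simpa using dvd_add this h2
  obtain ⟨n, hn⟩ := key (MvPowerSeries.X 0) (by simp)
  obtain ⟨m, hm⟩ := key (MvPowerSeries.X 1) (by simp)
  have := unit_of_dvd hn hm
  rw [MvPowerSeries.isUnit_iff_constantCoeff, hY] at this
  simp at this

/-- generators from `Spans` -/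
lemma sb_gen {N : ℕ} (hN : Spans (Ideal.span {Y, Z}) N) :
    ∃ e : Fin N → P2, ∀ b, ∃ a : Fin N → P2, b = ∑ i, sb Y Z hY hZ (a i) * e i := by
  obtain ⟨e, he⟩ := hN
  refine ⟨e, nak (sb Y Z hY hZ).toRingHom (IsLocalRing.maximalIdeal P2) ?_ e ?_⟩
  · intro x hx
    have : (IsLocalRing.maximalIdeal P2).map (sb Y Z hY hZ).toRingHom ≠ ⊤ := by
      intro h
      have h1 : (IsLocalRing.maximalIdeal P2).map (sb Y Z hY hZ).toRingHom ≤ IsLocalRing.maximalIdeal P2 := by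
        rw [Ideal.map_le_iff_le_comap]
        intro y hy
        rw [Ideal.mem_comap, mem_maxIdeal]
        exact (sb_const hY hZ y).trans (mem_maxIdeal.mp hy)
      rw [h, top_le_iff] at h1
      exact (IsLocalRing.maximalIdeal.isMaximal P2).ne_top h1
    have h2 := Ideal.iInf_pow_eq_bot_of_isLocalRing _ this
    have : x ∈ ⨅ i : ℕ, (IsLocalRing.maximalIdeal P2).map (sb Y Z hY hZ).toRingHom ^ i := by
      rw [Ideal.mem_iInf]; exact hx
    rw [h2] at this
    exact this
  · intro b
    obtain ⟨c, hc⟩ := he b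
    refine ⟨fun i => algebraMap ℂ P2 (c i), ?_⟩
    have hI : (IsLocalRing.maximalIdeal P2).map (sb Y Z hY hZ).toRingHom = Ideal.span {Y, Z} := by
      rw [maxIdeal_eq, Ideal.map_span, Set.image_pair]
      congr 2
      · exact sb_X0 hY hZ
      · rw [show (sb Y Z hY hZ).toRingHom (MvPowerSeries.X 1) = Z from sb_X1 hY hZ]
    rw [hI]
    convert hc using 4 with i
    rw [Algebra.smul_def]
    congr 1
    exact (sb Y Z hY hZ).commutes _

end inj

section lin

/-- linear substitution -/
def lm (γ : Matrix (Fin 2) (Fin 2) ℂ) : P2 →ₐ[ℂ] P2 :=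
  sb (γ 0 0 • MvPowerSeries.X 0 + γ 1 0 • MvPowerSeries.X 1)
    (γ 0 1 • MvPowerSeries.X 0 + γ 1 1 • MvPowerSeries.X 1)
    (by simp [Algebra.smul_def]) (by simp [Algebra.smul_def])

lemma lm_u (γ : Matrix (Fin 2) (Fin 2) ℂ) : lm γ (MvPowerSeries.X 0) =
    γ 0 0 • MvPowerSeries.X 0 + γ 1 0 • MvPowerSeries.X 1 := sb_X0 _ _

lemma lm_v (γ : Matrix (Fin 2) (Fin 2) ℂ) : lm γ (MvPowerSeries.X 1) =
    γ 0 1 • MvPowerSeries.X 0 + γ 1 1 • MvPowerSeries.X 1 := sb_X1 _ _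

lemma lm_one (p : P2) : lm 1 p = p := by
  unfold lm
  rw [sb_congr _ _ (Y' := MvPowerSeries.X 0) (Z' := MvPowerSeries.X 1) (by simp) (by simp)]
  exact sb_self p

lemma lm_mul (γ δ : Matrix (Fin 2) (Fin 2) ℂ) (p : P2) : lm (γ * δ) p = lm γ (lm δ p) := by
  conv_rhs => rw [lm, lm, sb_comp]
  unfold lm
  apply sb_congr
  · rw [map_add, map_smul, map_smul, sb_X0, sb_X1]
    simp only [Matrix.mul_apply, Fin.sum_univ_two]
    module
  · rw [map_add, map_smul, map_smul, sb_X0, sb_X1]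
    simp only [Matrix.mul_apply, Fin.sum_univ_two]
    module

/-- the action of `GL₂` -/
def lin : GL (Fin 2) ℂ →* (P2 ≃ₐ[ℂ] P2) where
  toFun γ := AlgEquiv.ofAlgHom (lm γ.1) (lm γ⁻¹.1)
    (by ext1 p; rw [AlgHom.comp_apply, ← lm_mul, ← Units.val_mul, mul_inv_cancel]; exact lm_one p)
    (by ext1 p; rw [AlgHom.comp_apply, ← lm_mul, ← Units.val_mul, inv_mul_cancel]; exact lm_one p)
  map_one' := by ext1 p; exact lm_one p
  map_mul' γ δ := by ext1 p; exact lm_mul _ _ p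

lemma lin_apply (γ : GL (Fin 2) ℂ) (p : P2) : lin γ p = lm γ.1 p := rfl

lemma coeff0 (a b : ℂ) : MvPowerSeries.coeff (Finsupp.single 0 1)
    (a • MvPowerSeries.X 0 + b • MvPowerSeries.X 1 : P2) = a := by
  simp [MvPowerSeries.coeff_X, Finsupp.single_left_inj]

lemma coeff1 (a b : ℂ) : MvPowerSeries.coeff (Finsupp.single 1 1)
    (a • MvPowerSeries.X 0 + b • MvPowerSeries.X 1 : P2) = b := by
  simp [MvPowerSeries.coeff_X, Finsupp.single_left_inj]

lemma lin_injective : Function.Injective lin := by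
  intro γ δ h
  have hu := DFunLike.congr_fun h (MvPowerSeries.X 0)
  have hv := DFunLike.congr_fun h (MvPowerSeries.X 1)
  rw [lin_apply, lin_apply, lm_u, lm_u] at hu
  rw [lin_apply, lin_apply, lm_v, lm_v] at hv
  have h1 := congrArg (MvPowerSeries.coeff (Finsupp.single 0 1)) hu
  have h2 := congrArg (MvPowerSeries.coeff (Finsupp.single 1 1)) hu
  have h3 := congrArg (MvPowerSeries.coeff (Finsupp.single 0 1)) hv
  have h4 := congrArg (MvPowerSeries.coeff (Finsupp.single 1 1)) hv
  rw [coeff0, coeff0] at h1 h3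
  rw [coeff1, coeff1] at h2 h4
  ext i j
  fin_cases i <;> fin_cases j <;> assumption

lemma lin_const (γ : GL (Fin 2) ℂ) (p : P2) :
    MvPowerSeries.constantCoeff (lin γ p) = MvPowerSeries.constantCoeff p := by
  rw [lin_apply, lm, sb_const]

lemma lin_sb {Y Z : P2} (hY : MvPowerSeries.constantCoeff Y = 0)
    (hZ : MvPowerSeries.constantCoeff Z = 0) (γ : GL (Fin 2) ℂ) (h1 : lin γ Y = Y)
    (h2 : lin γ Z = Z) (p : P2) : lin γ (sb Y Z hY hZ p) = sb Y Z hY hZ p := by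
  rw [lin_apply] at *
  unfold lm at *
  rw [sb_comp]
  exact sb_congr _ _ h1 h2 p

/-- the group attached to the invariants -/
def KGrp (X Y Z : P2) : Subgroup (GL (Fin 2) ℂ) where
  carrier := {γ | lin γ Y = Y ∧ lin γ Z = Z ∧ lin γ X = (γ.1.det) • X}
  one_mem' := by simp
  mul_mem' := by
    rintro γ δ ⟨h1, h2, h3⟩ ⟨h1', h2', h3'⟩
    refine ⟨?_, ?_, ?_⟩
    · rw [map_mul, AlgEquiv.mul_apply, h1', h1]
    · rw [map_mul, AlgEquiv.mul_apply, h2', h2]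
    · rw [map_mul, AlgEquiv.mul_apply, h3', map_smul, h3, Units.val_mul, Matrix.det_mul, smul_smul,
        mul_comm]
  inv_mem' := by
    rintro γ ⟨h1, h2, h3⟩
    have key : ∀ p, lin γ⁻¹ (lin γ p) = p := fun p => by
      rw [← AlgEquiv.mul_apply, ← map_mul, inv_mul_cancel, map_one]; rfl
    have hd : (γ⁻¹ : GL (Fin 2) ℂ).1.det * γ.1.det = 1 := by
      rw [← Matrix.det_mul, ← Units.val_mul, inv_mul_cancel]; simp
    refine ⟨?_, ?_, ?_⟩
    · conv_lhs => rw [← h1]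
      exact key _
    · conv_lhs => rw [← h2]
      exact key _
    · have := key X
      rw [h3, map_smul] at this
      conv_rhs => rw [← this]
      rw [smul_smul, hd, one_smul]

lemma mem_KGrp {X Y Z : P2} {γ : GL (Fin 2) ℂ} : γ ∈ KGrp X Y Z ↔
    lin γ Y = Y ∧ lin γ Z = Z ∧ lin γ X = (γ.1.det) • X := Iff.rfl

end lin

section psi
variable {f : MvPowerSeries (Fin 3) ℂ} {g : P2} (H : KHyp f g) {X Y Z : P2}
  (hY : MvPowerSeries.constantCoeff Y = 0) (hZ : MvPowerSeries.constantCoeff Z = 0)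
  (rel : X * X = - sb Y Z hY hZ g)

lemma ka_eq {a b : P2} {r : KleinianRing f}
    (hr : r = algebraMap P2 _ a + algebraMap P2 _ b * kx f) :
    ka H r = a := (k_unique' H ((kab H r).symm.trans hr)).1

def kpsi : KleinianRing f →+* P2 where
  toFun r := sb Y Z hY hZ (ka H r) + sb Y Z hY hZ (kb H r) * X
  map_one' := by
    have h : (1 : KleinianRing f) = algebraMap P2 _ 1 + algebraMap P2 _ 0 * kx f := by simp
    rw [ka_eq H h, kb_eq H h]; simp
  map_zero' := by
    have h : (0 : KleinianRing f) = algebraMap P2 _ 0 + algebraMap P2 _ 0 * kx f := by simp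
    rw [ka_eq H h, kb_eq H h]; simp
  map_add' r s := by
    have h : r + s = algebraMap P2 _ (ka H r + ka H s) + algebraMap P2 _ (kb H r + kb H s) * kx f := by
      conv_lhs => rw [kab H r, kab H s]
      rw [map_add, map_add]; ring
    rw [ka_eq H h, kb_eq H h, map_add, map_add]; ring
  map_mul' r s := by
    have h : r * s = algebraMap P2 _ (ka H r * ka H s - g * kb H r * kb H s) +
        algebraMap P2 _ (ka H r * kb H s + kb H r * ka H s) * kx f := by
      conv_lhs => rw [kab H r, kab H s]
      simp only [map_sub, map_add, map_mul]
      linear_combination (algebraMap P2 _ (kb H r) * algebraMap P2 _ (kb H s)) * kx_sq H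
    rw [ka_eq H h, kb_eq H h]
    simp only [map_sub, map_add, map_mul]
    linear_combination (- sb Y Z hY hZ (kb H r) * sb Y Z hY hZ (kb H s)) * rel

lemma kpsi_apply (a b : P2) : kpsi H hY hZ rel (algebraMap P2 _ a + algebraMap P2 _ b * kx f) =
    sb Y Z hY hZ a + sb Y Z hY hZ b * X := by
  change sb Y Z hY hZ (ka H _) + sb Y Z hY hZ (kb H _) * X = _
  rw [ka_eq H rfl, kb_eq H rfl]

end psi

theorem allTau_P2 {f : MvPowerSeries (Fin 3) ℂ} {g : P2} (H : KHyp f g) {X Y Z : P2}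
    (hY : MvPowerSeries.constantCoeff Y = 0) (hZ : MvPowerSeries.constantCoeff Z = 0)
    (hg0 : Squarefree g)
    (rel : X * X = - sb Y Z hY hZ g) {N : ℕ} (hN : Spans (Ideal.span {Y, Z}) N)
    (hgrp : Finite (KGrp X Y Z) → Nat.card (KGrp X Y Z) ≤ N →
      (∀ γ ∈ KGrp X Y Z, γ.1.det = 1 ∨ γ.1.det = -1) → N ≤ Nat.card (KGrp X Y Z) ∧
      (∃ k ∈ KGrp X Y Z, k.1.det = -1) ∧
      ∀ γ ∈ KGrp X Y Z, γ.1.det = 1 → ∃ k ∈ KGrp X Y Z, k.1.det = -1 ∧ k * γ * k⁻¹ = γ⁻¹) :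
    AllTau (kQuad H) := by
  have hY0 : Y ≠ 0 := by
    rintro rfl
    have key : ∀ x : P2, MvPowerSeries.constantCoeff x = 0 → ∃ n : ℕ, Z ∣ x ^ n := by
      intro x hx
      obtain ⟨n, hn⟩ := hN.nilp x hx
      obtain ⟨s, t, hst⟩ := Ideal.mem_span_pair.mp hn
      exact ⟨n, t, by rw [← hst]; ring⟩
    obtain ⟨n, hn⟩ := key (MvPowerSeries.X 0) (by simp)
    obtain ⟨m, hm⟩ := key (MvPowerSeries.X 1) (by simp)
    have := unit_of_dvd hn hm
    rw [MvPowerSeries.isUnit_iff_constantCoeff, hZ] at this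
    simp at this
  have hinj := sb_injective hY hZ hY0 hN
  have hX0 : X ≠ 0 := by
    rintro rfl
    rw [mul_zero, eq_comm, neg_eq_zero, map_eq_zero_iff _ hinj] at rel
    exact hg0.ne_zero rel
  obtain ⟨e, he⟩ := sb_gen hY hZ hN
  have hrad := hg0.isRadical
  -- determinants
  have hdet : ∀ γ ∈ KGrp X Y Z, γ.1.det = 1 ∨ γ.1.det = -1 := by
    intro γ hγ
    have h1 : lin γ (X * X) = X * X := by
      rw [rel, map_neg, lin_sb hY hZ γ hγ.1 hγ.2.1]
    rw [map_mul, hγ.2.2, smul_mul_smul_comm] at h1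
    have h2 : (γ.1.det * γ.1.det - 1) • (X * X) = 0 := by rw [sub_smul, h1, one_smul, sub_self]
    have h3 := (smul_eq_zero.mp h2).resolve_right (mul_ne_zero hX0 hX0)
    exact mul_self_eq_one_iff.mp (by linear_combination h3)
  let act : KGrp X Y Z →* (P2 ≃ₐ[ℂ] P2) := lin.comp (KGrp X Y Z).subtype
  let toR : (P2 ≃ₐ[ℂ] P2) →* (P2 ≃+* P2) :=
    { toFun := fun e => e.toRingEquiv, map_one' := rfl, map_mul' := fun _ _ => rfl }
  have htoR : Function.Injective toR := fun a b h => by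
    ext1 x
    exact DFunLike.congr_fun h x
  obtain ⟨hfin, hcard, hinvt⟩ := galois_aux (sb Y Z hY hZ).toRingHom hinj e he (toR.comp act)
    (htoR.comp (lin_injective.comp Subtype.val_injective))
    (fun γ a => lin_sb hY hZ γ.1 γ.2.1 γ.2.2.1 a)
  obtain ⟨hge, ⟨k, hkm, hk⟩, hconj⟩ := hgrp hfin hcard hdet
  have hinv0 : ∀ b, (∀ γ ∈ KGrp X Y Z, lin γ b = b) → ∃ a, sb Y Z hY hZ a = b :=
    fun b hb => hinvt inferInstance hge b (fun γ => hb γ.1 γ.2)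
  letI : Algebra (KleinianRing f) P2 := (kpsi H hY hZ rel).toAlgebra
  have hpsi : ∀ a b, algebraMap (KleinianRing f) P2
      (algebraMap P2 _ a + algebraMap P2 _ b * kx f) = sb Y Z hY hZ a + sb Y Z hY hZ b * X :=
    kpsi_apply H hY hZ rel
  have hpsiA : ∀ a, algebraMap (KleinianRing f) P2 (algebraMap P2 _ a) = sb Y Z hY hZ a := by
    intro a
    simpa using hpsi a 0
  have hpsiX : algebraMap (KleinianRing f) P2 (kx f) = X := by
    simpa using hpsi 0 1
  let sg : KGrp X Y Z →* ℂ :=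
    { toFun := fun γ => γ.1.1.det
      map_one' := by simp
      map_mul' := fun γ δ => by simp [Matrix.det_mul] }
  let κ : P2 →ₐ[ℂ] ℂ :=
    { MvPowerSeries.constantCoeff with commutes' := fun c => algMap_P2 c }
  refine allTau_of_group (kQuad H) (maxIdeal_eq) twoReg_P2 κ ?_ act
    (fun γ b => lin_const γ.1 b) sg ?_ ?_ ?_ ?_ ⟨k, hkm⟩ hk ?_
  · intro b hb
    rw [MvPowerSeries.isUnit_iff_constantCoeff]
    exact isUnit_iff_ne_zero.mpr hb
  · rw [injective_iff_map_eq_zero]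
    intro r hr
    rw [kab H r, hpsi] at hr
    have h2 := congrArg (lin k) hr
    rw [map_add, map_mul, lin_sb hY hZ k hkm.1 hkm.2.1, lin_sb hY hZ k hkm.1 hkm.2.1, hkm.2.2, hk,
      map_zero, neg_one_smul] at h2
    have h3 : sb Y Z hY hZ (ka H r) = 0 := by
      have : (2 : ℂ) • sb Y Z hY hZ (ka H r) = 0 := by
        rw [two_smul]; linear_combination hr + h2
      exact (smul_eq_zero.mp this).resolve_left two_ne_zero
    have h4 : sb Y Z hY hZ (kb H r) = 0 := by
      rw [h3, zero_add] at hr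
      exact (mul_eq_zero.mp hr).resolve_right hX0
    rw [kab H r, (map_eq_zero_iff _ hinj).mp h3, (map_eq_zero_iff _ hinj).mp h4]
    simp
  · intro γ a
    change lin γ.1 _ = _
    rw [hpsiA]
    exact lin_sb hY hZ γ.1 γ.2.1 γ.2.2.1 a
  · intro γ
    change lin γ.1 (algebraMap (KleinianRing f) P2 (kx f)) = γ.1.1.det • algebraMap (KleinianRing f) P2 (kx f)
    rw [hpsiX]
    exact γ.2.2.2
  · intro b hb
    have hb' : ∀ γ ∈ KGrp X Y Z, γ.1.det = 1 → lin γ b = b := fun γ hγ h => hb ⟨γ, hγ⟩ h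
    have comp : ∀ γ δ p, lin (γ * δ) p = lin γ (lin δ p) := fun γ δ p => by
      rw [map_mul]; rfl
    have d1 : ∀ γ ∈ KGrp X Y Z, γ.1.det = 1 → lin γ (lin k b) = lin k b := by
      intro γ hγ h
      rw [← comp, show γ * k = k * (k⁻¹ * γ * k) by group, comp]
      rw [hb' _ (Subgroup.mul_mem _ (Subgroup.mul_mem _ (Subgroup.inv_mem _ hkm) hγ) hkm)]
      rw [Units.val_mul, Units.val_mul, Matrix.det_mul, Matrix.det_mul, h, mul_one,
        ← Matrix.det_mul, ← Units.val_mul, inv_mul_cancel]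
      simp
    have d2 : ∀ γ ∈ KGrp X Y Z, γ.1.det = -1 → lin γ b = lin k b := by
      intro γ hγ h
      rw [show γ = k * (k⁻¹ * γ) by group, comp]
      rw [hb' _ (Subgroup.mul_mem _ (Subgroup.inv_mem _ hkm) hγ)]
      have hi : (k⁻¹ : GL (Fin 2) ℂ).1.det * k.1.det = 1 := by
        rw [← Matrix.det_mul, ← Units.val_mul, inv_mul_cancel]; simp
      rw [Units.val_mul, Matrix.det_mul, h, ← hk, hi]
    have d3 : ∀ γ ∈ KGrp X Y Z, γ.1.det = -1 → lin γ (lin k b) = b := by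
      intro γ hγ h
      rw [← comp, hb' _ (Subgroup.mul_mem _ hγ hkm)]
      rw [Units.val_mul, Matrix.det_mul, h, hk]; norm_num
    obtain ⟨s, hs⟩ := hinv0 (b + lin k b) (by
      intro γ hγ
      rw [map_add]
      rcases hdet γ hγ with h | h
      · rw [hb' γ hγ h, d1 γ hγ h]
      · rw [d2 γ hγ h, d3 γ hγ h, add_comm])
    have hd : ∀ γ ∈ KGrp X Y Z, lin γ (b - lin k b) = γ.1.det • (b - lin k b) := by
      intro γ hγ
      rw [map_sub]
      rcases hdet γ hγ with h | h
      · rw [hb' γ hγ h, d1 γ hγ h, h, one_smul]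
      · rw [d2 γ hγ h, d3 γ hγ h, h, neg_one_smul]; ring
    set d := b - lin k b with hddef
    obtain ⟨a, ha⟩ := hinv0 (X * d) (by
      intro γ hγ
      rw [map_mul, hγ.2.2, hd γ hγ, smul_mul_smul_comm]
      rcases hdet γ hγ with h | h <;> rw [h] <;> norm_num)
    obtain ⟨c, hc⟩ := hinv0 (d * d) (by
      intro γ hγ
      rw [map_mul, hd γ hγ, smul_mul_smul_comm]
      rcases hdet γ hγ with h | h <;> rw [h] <;> norm_num)
    have hac : a * a = - (g * c) := by
      apply hinj
      rw [map_mul, map_neg, map_mul, ha, hc]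
      linear_combination d * d * rel
    obtain ⟨a', rfl⟩ := hrad 2 a ⟨-c, by rw [sq, hac]; ring⟩
    have hd' : d = - (X * sb Y Z hY hZ a') := by
      apply mul_left_cancel₀ hX0
      rw [← ha, map_mul]
      linear_combination sb Y Z hY hZ a' * rel
    refine ⟨algebraMap P2 _ ((1/2 : ℂ) • s) + algebraMap P2 _ (-((1/2 : ℂ) • a')) * kx f, ?_⟩
    rw [hpsi, map_neg, map_smul, map_smul, hs]
    have : b = (1/2 : ℂ) • ((b + lin k b) + d) := by
      rw [hddef, show b + lin k b + (b - lin k b) = (2 : ℂ) • b by rw [two_smul]; ring, smul_smul]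
      norm_num
    conv_rhs => rw [this]
    rw [smul_add, hd']
    simp only [Algebra.smul_def]
    ring
  · intro γ hγ
    obtain ⟨k', hk'm, hk', hc⟩ := hconj γ.1 γ.2 hγ
    exact ⟨⟨k', hk'm⟩, hk', Subtype.ext hc⟩

end Klein

namespace Klein

lemma sqf_of {g : P2} {n m : ℕ}
    (h0 : ∀ p, p ∣ g → p ∣ MvPowerSeries.pderiv (R := ℂ) 0 g → p ∣ MvPowerSeries.pderiv (R := ℂ) 1 g →
      p ∣ MvPowerSeries.X 0 ^ n)
    (h1 : ∀ p, p ∣ g → p ∣ MvPowerSeries.pderiv (R := ℂ) 0 g → p ∣ MvPowerSeries.pderiv (R := ℂ) 1 g →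
      p ∣ MvPowerSeries.X 1 ^ m) : Squarefree g := by
  intro p hp
  have hd : ∀ i, p ∣ MvPowerSeries.pderiv (R := ℂ) i g := by
    intro i
    obtain ⟨q, rfl⟩ := hp
    rw [Derivation.leibniz, Derivation.leibniz]
    simp only [smul_eq_mul]
    exact ⟨p * MvPowerSeries.pderiv (R := ℂ) i q + q * (MvPowerSeries.pderiv (R := ℂ) i p + MvPowerSeries.pderiv (R := ℂ) i p), by ring⟩
  have hpg : p ∣ g := (Dvd.intro _ rfl).trans hp
  exact unit_of_dvd (h0 p hpg (hd 0) (hd 1)) (h1 p hpg (hd 0) (hd 1))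

lemma dvd_nat {p q : P2} (n : ℕ) (hn : n ≠ 0) (h : p ∣ (n : P2) * q) : p ∣ q := by
  have : IsUnit (n : P2) := by
    rw [MvPowerSeries.isUnit_iff_constantCoeff]
    simp [hn]
  exact (this.dvd_mul_left).mp h

lemma sqf_A (n : ℕ) (hn : 1 ≤ n) : Squarefree (MvPowerSeries.X 0 ^ 2 + MvPowerSeries.X 1 ^ (n + 1) : P2) := by
  apply sqf_of (n := 1) (m := n)
  · intro p h h0 h1
    simp [Derivation.leibniz_pow] at h0 h1
    rw [pow_one]
    exact dvd_nat 2 two_ne_zero (by simpa using h0)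
  · intro p h h0 h1
    simp [Derivation.leibniz_pow] at h0 h1
    exact dvd_nat (n+1) (by omega) (by simpa using h1)

lemma sqf_D (n : ℕ) (hn : 1 ≤ n) : Squarefree (MvPowerSeries.X 0 ^ 2 * MvPowerSeries.X 1 + MvPowerSeries.X 1 ^ (n + 1) : P2) := by
  apply sqf_of (n := 3) (m := n + 1)
  · intro p h h0 h1
    simp [Derivation.leibniz_pow] at h0 h1
    have h2 : p ∣ MvPowerSeries.X 0 * MvPowerSeries.X 1 :=
      dvd_nat 2 two_ne_zero (by convert h0 using 1; push_cast; ring)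
    obtain ⟨m, rfl⟩ := Nat.exists_eq_add_of_le' hn
    have h3 := dvd_sub (h1.mul_left (MvPowerSeries.X 0)) (h2.mul_left (((m : P2) + 2) * MvPowerSeries.X 1 ^ m))
    convert h3 using 1
    push_cast [Nat.add_sub_cancel]
    ring
  · intro p h h0 h1
    simp [Derivation.leibniz_pow] at h0 h1
    have h2 : p ∣ MvPowerSeries.X 0 * MvPowerSeries.X 1 :=
      dvd_nat 2 two_ne_zero (by convert h0 using 1; push_cast; ring)
    have h3 := dvd_sub (h1.mul_left (MvPowerSeries.X 1)) (h2.mul_left (MvPowerSeries.X 0))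
    refine dvd_nat (n + 1) (by omega) ?_
    convert h3 using 1
    push_cast
    ring

lemma sqf_E6 : Squarefree (MvPowerSeries.X 0 ^ 3 + MvPowerSeries.X 1 ^ 4 : P2) := by
  apply sqf_of (n := 2) (m := 3)
  · intro p h h0 h1
    simp [Derivation.leibniz_pow] at h0 h1
    exact dvd_nat 3 (by norm_num) (by simpa using h0)
  · intro p h h0 h1
    simp [Derivation.leibniz_pow] at h0 h1
    exact dvd_nat 4 (by norm_num) (by simpa using h1)

lemma sqf_E8 : Squarefree (MvPowerSeries.X 0 ^ 3 + MvPowerSeries.X 1 ^ 5 : P2) := by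
  apply sqf_of (n := 2) (m := 4)
  · intro p h h0 h1
    simp [Derivation.leibniz_pow] at h0 h1
    exact dvd_nat 3 (by norm_num) (by simpa using h0)
  · intro p h h0 h1
    simp [Derivation.leibniz_pow] at h0 h1
    exact dvd_nat 5 (by norm_num) (by simpa using h1)

lemma sqf_E7 : Squarefree (MvPowerSeries.X 0 ^ 3 + MvPowerSeries.X 0 * MvPowerSeries.X 1 ^ 3 : P2) := by
  apply sqf_of (n := 3) (m := 5)
  · intro p h h0 h1
    simp [Derivation.leibniz_pow] at h0 h1
    have h2 : p ∣ MvPowerSeries.X 0 * MvPowerSeries.X 1 ^ 2 :=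
      dvd_nat 3 (by norm_num) (by convert h1 using 1; push_cast; ring)
    have h3 := dvd_sub (h0.mul_left (MvPowerSeries.X 0)) (h2.mul_left (MvPowerSeries.X 1))
    refine dvd_nat 3 (by norm_num) ?_
    convert h3 using 1
    push_cast
    ring
  · intro p h h0 h1
    simp [Derivation.leibniz_pow] at h0 h1
    have h2 : p ∣ MvPowerSeries.X 0 * MvPowerSeries.X 1 ^ 2 :=
      dvd_nat 3 (by norm_num) (by convert h1 using 1; push_cast; ring)
    have h3 := dvd_sub (h0.mul_left (MvPowerSeries.X 1 ^ 2)) (h2.mul_left (3 * MvPowerSeries.X 0))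
    convert h3 using 1
    ring

lemma fse0 : MvPowerSeries.finSuccEquiv ℂ 2 (MvPowerSeries.X 0) = PowerSeries.X :=
  MvPowerSeries.finSuccEquiv_X_zero ..
lemma fse1 : MvPowerSeries.finSuccEquiv ℂ 2 (MvPowerSeries.X 1) = PowerSeries.C (MvPowerSeries.X 0) :=
  MvPowerSeries.finSuccEquiv_X_succ 0
lemma fse2 : MvPowerSeries.finSuccEquiv ℂ 2 (MvPowerSeries.X 2) = PowerSeries.C (MvPowerSeries.X 1) :=
  MvPowerSeries.finSuccEquiv_X_succ 1

lemma khA (n : ℕ) : KHyp (MvPowerSeries.X 0 ^ 2 + MvPowerSeries.X 1 ^ 2 + MvPowerSeries.X 2 ^ (n + 1))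
    (MvPowerSeries.X 0 ^ 2 + MvPowerSeries.X 1 ^ (n + 1)) :=
  ⟨by simp, by simp only [map_add, map_mul, map_pow, fse0, fse1, fse2]; ring⟩

lemma khD (n : ℕ) : KHyp (MvPowerSeries.X 0 ^ 2 + MvPowerSeries.X 1 ^ 2 * MvPowerSeries.X 2 + MvPowerSeries.X 2 ^ (n + 1))
    (MvPowerSeries.X 0 ^ 2 * MvPowerSeries.X 1 + MvPowerSeries.X 1 ^ (n + 1)) :=
  ⟨by simp, by simp only [map_add, map_mul, map_pow, fse0, fse1, fse2]; ring⟩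

lemma khE6 : KHyp (MvPowerSeries.X 0 ^ 2 + MvPowerSeries.X 1 ^ 3 + MvPowerSeries.X 2 ^ 4)
    (MvPowerSeries.X 0 ^ 3 + MvPowerSeries.X 1 ^ 4) :=
  ⟨by simp, by simp only [map_add, map_mul, map_pow, fse0, fse1, fse2]; ring⟩

lemma khE7 : KHyp (MvPowerSeries.X 0 ^ 2 + MvPowerSeries.X 1 ^ 3 + MvPowerSeries.X 1 * MvPowerSeries.X 2 ^ 3)
    (MvPowerSeries.X 0 ^ 3 + MvPowerSeries.X 0 * MvPowerSeries.X 1 ^ 3) :=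
  ⟨by simp, by simp only [map_add, map_mul, map_pow, fse0, fse1, fse2]; ring⟩

lemma khE8 : KHyp (MvPowerSeries.X 0 ^ 2 + MvPowerSeries.X 1 ^ 3 + MvPowerSeries.X 2 ^ 5)
    (MvPowerSeries.X 0 ^ 3 + MvPowerSeries.X 1 ^ 5) :=
  ⟨by simp, by simp only [map_add, map_mul, map_pow, fse0, fse1, fse2]; ring⟩

end Klein

namespace Klein

/-- the special part of a subgroup -/
def SG (Γ : Subgroup (GL (Fin 2) ℂ)) : Subgroup (GL (Fin 2) ℂ) where
  carrier := {γ | γ ∈ Γ ∧ γ.1.det = 1}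
  one_mem' := ⟨Γ.one_mem, by simp⟩
  mul_mem' := by
    rintro a b ⟨h1, h2⟩ ⟨h3, h4⟩
    exact ⟨Γ.mul_mem h1 h3, by rw [Units.val_mul, Matrix.det_mul, h2, h4, one_mul]⟩
  inv_mem' := by
    rintro a ⟨h1, h2⟩
    refine ⟨Γ.inv_mem h1, ?_⟩
    have : (a⁻¹ : GL (Fin 2) ℂ).1.det * a.1.det = 1 := by
      rw [← Matrix.det_mul, ← Units.val_mul, inv_mul_cancel]; simp
    rwa [h2, mul_one] at this

lemma mem_SG {Γ : Subgroup (GL (Fin 2) ℂ)} {γ : GL (Fin 2) ℂ} :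
    γ ∈ SG Γ ↔ γ ∈ Γ ∧ γ.1.det = 1 := Iff.rfl

lemma SG_le (Γ : Subgroup (GL (Fin 2) ℂ)) : SG Γ ≤ Γ := fun _ h => h.1

lemma card_SG {Γ : Subgroup (GL (Fin 2) ℂ)} [Finite Γ]
    (hdet : ∀ γ ∈ Γ, γ.1.det = 1 ∨ γ.1.det = -1) {k : GL (Fin 2) ℂ} (hk : k ∈ Γ)
    (hkd : k.1.det = -1) : Nat.card Γ = 2 * Nat.card (SG Γ) := by
  have h1 : ((SG Γ).subgroupOf Γ).index = 2 := by
    rw [Subgroup.index_eq_two_iff]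
    refine ⟨⟨k, hk⟩, fun b => ?_⟩
    rw [Subgroup.mem_subgroupOf, Subgroup.mem_subgroupOf, mem_SG, mem_SG]
    have e : ((b * ⟨k, hk⟩ : Γ) : GL (Fin 2) ℂ).1.det = - b.1.1.det := by
      rw [Subgroup.coe_mul, Units.val_mul, Matrix.det_mul, hkd, mul_neg_one]
    rw [e]
    have hne : (-1 : ℂ) ≠ 1 := by norm_num
    have hm := (b * ⟨k, hk⟩ : Γ).2
    have hb := b.2
    rcases hdet b.1 b.2 with h | h
    · rw [h]; right; exact ⟨⟨hb, rfl⟩, fun hh => hne hh.2⟩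
    · rw [h]; left; exact ⟨⟨hm, by norm_num⟩, fun hh => hne hh.2⟩
  have h2 := Subgroup.index_mul_card ((SG Γ).subgroupOf Γ)
  rw [h1, Nat.card_congr (Subgroup.subgroupOfEquivOfLe (SG_le Γ)).toEquiv] at h2
  exact h2.symm

lemma finite_SG {Γ : Subgroup (GL (Fin 2) ℂ)} [Finite Γ] : Finite (SG Γ) :=
  Finite.of_injective (Subgroup.inclusion (SG_le Γ)) (Subgroup.inclusion_injective _)

/-- constants -/
abbrev cc (c : ℂ) : P2 := algebraMap ℂ P2 c
abbrev uu : P2 := MvPowerSeries.X 0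
abbrev vv : P2 := MvPowerSeries.X 1

lemma cc_const (c : ℂ) : MvPowerSeries.constantCoeff (cc c) = c := algMap_P2 c

/-- a matrix as an element of `GL₂` -/
def mkGL (a b c d : ℂ) (h : a * d - b * c ≠ 0) : GL (Fin 2) ℂ :=
  Matrix.GeneralLinearGroup.mkOfDetNeZero !![a, b; c, d] (by rwa [Matrix.det_fin_two_of])

section
variable {a b c d : ℂ} (h : a * d - b * c ≠ 0)

lemma mkGL_val : (mkGL a b c d h).1 = !![a, b; c, d] := rfl

lemma mkGL_det : (mkGL a b c d h).1.det = a * d - b * c := by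
  rw [mkGL_val, Matrix.det_fin_two_of]

lemma lin_u : lin (mkGL a b c d h) uu = cc a * uu + cc c * vv := by
  rw [lin_apply, lm_u, Algebra.smul_def, Algebra.smul_def]; rfl

lemma lin_v : lin (mkGL a b c d h) vv = cc b * uu + cc d * vv := by
  rw [lin_apply, lm_v, Algebra.smul_def, Algebra.smul_def]; rfl

end

lemma lin_cc (γ : GL (Fin 2) ℂ) (c : ℂ) : lin γ (cc c) = cc c := (lin γ).commutes c

/-- diagonal matrices -/
def dg : ℂˣ →* GL (Fin 2) ℂ where
  toFun t := mkGL t 0 0 (t⁻¹ : ℂˣ) (by simp)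
  map_one' := by
    ext i j
    fin_cases i <;> fin_cases j <;> simp [mkGL_val]
  map_mul' s t := by
    ext i j
    fin_cases i <;> fin_cases j <;> simp [mkGL_val, mul_comm]

lemma dg_injective : Function.Injective dg := by
  intro s t h
  have := congrArg (fun γ : GL (Fin 2) ℂ => γ.1 0 0) h
  exact Units.ext this

lemma dg_eq (t : ℂˣ) : dg t = mkGL t 0 0 (t⁻¹ : ℂˣ) (by simp) := rfl

lemma dg_det (t : ℂˣ) : (dg t).1.det = 1 := by
  change (mkGL t 0 0 (t⁻¹ : ℂˣ) (by simp)).1.det = 1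
  rw [mkGL_det]; simp

lemma lin_dg_u (t : ℂˣ) : lin (dg t) uu = cc t * uu := by
  change lin (mkGL t 0 0 (t⁻¹ : ℂˣ) (by simp)) uu = _
  rw [lin_u]; simp

lemma lin_dg_v (t : ℂˣ) : lin (dg t) vv = cc (t⁻¹ : ℂˣ) * vv := by
  change lin (mkGL t 0 0 (t⁻¹ : ℂˣ) (by simp)) vv = _
  rw [lin_v]; simp

lemma conj_zpow {G : Type*} [Group G] {k a : G} (h : k * a * k⁻¹ = a⁻¹) (i : ℤ) :
    k * a ^ i * k⁻¹ = (a ^ i)⁻¹ := by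
  have := (MulAut.conj k).toMonoidHom.map_zpow a i
  simp only [MulEquiv.coe_toMonoidHom, MulAut.conj_apply] at this
  rw [this, h, inv_zpow]

lemma cc_mul_inv (t : ℂˣ) : cc t * cc (t⁻¹ : ℂˣ) = 1 := by
  rw [← map_mul]; simp

theorem tau_A (n : ℕ) (hn : 1 ≤ n) : AllTau (kQuad (khA n)) := by
  obtain ⟨ζ, hζ⟩ : ∃ ζ : ℂ, IsPrimitiveRoot ζ (n + 1) :=
    ⟨_, Complex.isPrimitiveRoot_exp (n + 1) (by omega)⟩
  obtain ⟨t, rfl⟩ := hζ.isUnit (by omega)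
  have ht : IsPrimitiveRoot t (n + 1) := (IsPrimitiveRoot.coe_units_iff).mp hζ
  have htp : cc t ^ (n + 1) = 1 := by rw [← map_pow, hζ.pow_eq_one, map_one]
  have htp' : cc (t⁻¹ : ℂˣ) ^ (n + 1) = 1 := by
    have := congrArg (· ^ (n + 1)) (cc_mul_inv t)
    simpa [mul_pow, htp] using this
  have hI : cc Complex.I * cc Complex.I = -1 := by
    rw [← map_mul, Complex.I_mul_I, map_neg, map_one]
  have hH : 2 * cc (1/2) = 1 := by
    rw [show (2 : P2) = cc 2 from (map_ofNat _ 2).symm, ← map_mul]; norm_num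
  have ht1 := cc_mul_inv t
  obtain ⟨X, hX⟩ : ∃ X : P2, X = cc (1/2) * (uu ^ (n + 1) - vv ^ (n + 1)) := ⟨_, rfl⟩
  obtain ⟨Y, hY⟩ : ∃ Y : P2, Y = - cc Complex.I * cc (1/2) * (uu ^ (n + 1) + vv ^ (n + 1)) := ⟨_, rfl⟩
  obtain ⟨Z, hZ⟩ : ∃ Z : P2, Z = uu * vv := ⟨_, rfl⟩
  have hs : (mkGL 0 1 1 0 (by norm_num)) ∈ KGrp X Y Z ∧ (mkGL 0 1 1 0 (by norm_num)).1.det = -1 := by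
    refine ⟨?_, by rw [mkGL_det]; norm_num⟩
    rw [mem_KGrp, mkGL_det, hX, hY, hZ]
    simp only [map_mul, map_add, map_sub, map_neg, map_pow, lin_u, lin_v, lin_cc, map_zero, map_one]
    refine ⟨?_, ?_, ?_⟩
    · ring
    · ring
    · rw [Algebra.smul_def, map_sub, map_mul, map_mul, map_zero, map_one]; ring
  have hd : dg t ∈ SG (KGrp X Y Z) := by
    refine ⟨?_, dg_det t⟩
    rw [mem_KGrp, dg_det, hX, hY, hZ]
    simp only [map_mul, map_add, map_sub, map_neg, map_pow, lin_dg_u, lin_dg_v, lin_cc, mul_pow, htp, htp',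
      one_mul, one_smul, true_and, and_true]
    linear_combination uu * vv * ht1
  refine allTau_P2 (khA n) (X := X) (Y := Y) (Z := Z) (by simp [hY]) (by simp [hZ]) (sqf_A n hn) ?_
    (N := (n + 1) + (n + 1)) ?_ ?_
  · simp only [map_add, map_pow, sb_X0, sb_X1]
    rw [hX, hY, hZ, mul_pow uu vv]
    linear_combination (cc (1/2) ^ 2 * (uu ^ (n + 1) + vv ^ (n + 1)) ^ 2) * hI
      - uu ^ (n + 1) * vv ^ (n + 1) * (2 * cc (1/2) + 1) * hH
  · have hYp : 2 * cc Complex.I * Y = uu ^ (n + 1) + vv ^ (n + 1) := by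
      rw [hY]
      linear_combination (-2 * cc (1/2) * (uu ^ (n + 1) + vv ^ (n + 1))) * hI
        + (uu ^ (n + 1) + vv ^ (n + 1)) * hH
    rw [hZ]
    refine (Spans.mul (a := uu) (b := vv) (c := Y) ?_ ?_).swap
    · have := spans_uv 1 (n + 1)
      rw [one_mul] at this
      refine this.of ⟨1, 0, by ring⟩ ⟨- uu ^ n, 2 * cc Complex.I, ?_⟩
      linear_combination hYp
    · have := spans_uv (n + 1) 1
      rw [mul_one] at this
      refine this.swap.of ⟨1, 0, by ring⟩ ⟨- vv ^ n, 2 * cc Complex.I, ?_⟩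
      linear_combination hYp
  · intro hfin hcard hdet
    have hc := card_SG hdet hs.1 hs.2
    have := finite_SG (Γ := KGrp X Y Z)
    have ho : orderOf (dg t) = n + 1 := by
      rw [orderOf_injective dg dg_injective, ← ht.eq_orderOf]
    have hle : Subgroup.zpowers (dg t) ≤ SG (KGrp X Y Z) := by
      rw [Subgroup.zpowers_le]; exact hd
    have hz : Nat.card (Subgroup.zpowers (dg t)) = n + 1 := by rw [Nat.card_zpowers, ho]
    have hge : n + 1 ≤ Nat.card (SG (KGrp X Y Z)) := by
      rw [← hz]; exact Subgroup.card_le_of_le hle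
    have heq : Subgroup.zpowers (dg t) = SG (KGrp X Y Z) :=
      Subgroup.eq_of_le_of_card_ge hle (by omega)
    refine ⟨by omega, ⟨_, hs.1, hs.2⟩, fun γ hγ hγd => ⟨_, hs.1, hs.2, ?_⟩⟩
    have hm : γ ∈ SG (KGrp X Y Z) := ⟨hγ, hγd⟩
    rw [← heq, Subgroup.mem_zpowers_iff] at hm
    obtain ⟨i, rfl⟩ := hm
    apply conj_zpow
    rw [mul_inv_eq_iff_eq_mul, ← map_inv]
    ext i j
    rw [dg_eq, dg_eq, Units.val_mul, Units.val_mul, mkGL_val, mkGL_val, mkGL_val]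
    fin_cases i <;> fin_cases j <;> simp

end Klein

namespace Klein

lemma idx_two {A : Type*} [Group A] {G : Subgroup A} [Finite G] {a b : A} (ha : a ∈ G) (hb : b ∈ G)
    (hba : b ∉ Subgroup.zpowers a) (hc : Nat.card G ≤ 2 * orderOf a) :
    Nat.card G = 2 * orderOf a ∧
      ∀ g ∈ G, g ∈ Subgroup.zpowers a ∨ g * b⁻¹ ∈ Subgroup.zpowers a := by
  have hle : Subgroup.zpowers a ≤ G := by rwa [Subgroup.zpowers_le]
  have h2 := Subgroup.index_mul_card ((Subgroup.zpowers a).subgroupOf G)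
  rw [Nat.card_congr (Subgroup.subgroupOfEquivOfLe hle).toEquiv, Nat.card_zpowers] at h2
  have hpos : 0 < Nat.card G := Nat.card_pos
  have hop : 0 < orderOf a := by
    rcases Nat.eq_zero_or_pos (orderOf a) with h | h
    · rw [h] at h2; omega
    · exact h
  have hi1 : ((Subgroup.zpowers a).subgroupOf G).index ≠ 1 := by
    intro h
    rw [Subgroup.index_eq_one, Subgroup.subgroupOf_eq_top] at h
    exact hba (h hb)
  have hi0 : ((Subgroup.zpowers a).subgroupOf G).index ≠ 0 := by
    intro h
    rw [h] at h2; omega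
  have hi2 : ((Subgroup.zpowers a).subgroupOf G).index ≤ 2 := by
    rw [← h2] at hc
    exact Nat.le_of_mul_le_mul_right hc hop
  have hi : ((Subgroup.zpowers a).subgroupOf G).index = 2 := by omega
  refine ⟨by rw [← h2, hi], fun g hg => ?_⟩
  have h3 := Subgroup.mul_mem_iff_of_index_two hi (a := (⟨g, hg⟩ : G)) (b := (⟨b, hb⟩ : G)⁻¹)
  simp only [Subgroup.mem_subgroupOf, inv_mem_iff, Subgroup.coe_mul, Subgroup.coe_inv] at h3
  tauto

lemma dic_inv {A : Type*} [Group A] {a b c g : A} (hb : b * a * b⁻¹ = a⁻¹) (hca : c * a * c⁻¹ = a)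
    (hcb : c * b * c⁻¹ = b⁻¹) (hg : g ∈ Subgroup.zpowers a ∨ g * b⁻¹ ∈ Subgroup.zpowers a) :
    c * b * g * (c * b)⁻¹ = g⁻¹ ∨ c * g * c⁻¹ = g⁻¹ := by
  have hc : ∀ i : ℤ, c * a ^ i * c⁻¹ = a ^ i := fun i => by
    have := (MulAut.conj c).toMonoidHom.map_zpow a i
    simp only [MulEquiv.coe_toMonoidHom, MulAut.conj_apply] at this
    rw [this, hca]
  rcases hg with h | h
  · left
    obtain ⟨i, rfl⟩ := Subgroup.mem_zpowers_iff.mp h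
    apply conj_zpow
    calc c * b * a * (c * b)⁻¹ = c * (b * a * b⁻¹) * c⁻¹ := by group
      _ = (c * a * c⁻¹)⁻¹ := by rw [hb]; group
      _ = a⁻¹ := by rw [hca]
  · right
    obtain ⟨i, hi⟩ := Subgroup.mem_zpowers_iff.mp h
    obtain rfl : g = a ^ i * b := by rw [hi]; group
    calc c * (a ^ i * b) * c⁻¹ = (c * a ^ i * c⁻¹) * (c * b * c⁻¹) := by group
      _ = b⁻¹ * (b * a ^ i * b⁻¹) := by rw [hc, hcb]; group
      _ = _ := by rw [conj_zpow hb]; group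

lemma mkGL_mul {a b c d a' b' c' d' a'' b'' c'' d'' : ℂ} {h h' h''}
    (h1 : a * a' + b * c' = a'') (h2 : a * b' + b * d' = b'') (h3 : c * a' + d * c' = c'')
    (h4 : c * b' + d * d' = d'') :
    mkGL a b c d h * mkGL a' b' c' d' h' = mkGL a'' b'' c'' d'' h'' := by
  subst h1 h2 h3 h4
  apply Units.ext
  rw [Units.val_mul, mkGL_val, mkGL_val, mkGL_val, Matrix.mul_fin_two]

lemma mkGL_congr {a b c d a'' b'' c'' d'' : ℂ} {h h''}
    (h1 : a = a'') (h2 : b = b'') (h3 : c = c'') (h4 : d = d'') :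
    mkGL a b c d h = mkGL a'' b'' c'' d'' h'' := by
  subst h1 h2 h3 h4; rfl

lemma conj_eq_inv_iff {A : Type*} [Group A] {a b : A} : b * a * b⁻¹ = a⁻¹ ↔ a * (b * a) = b := by
  rw [mul_inv_eq_iff_eq_mul]
  constructor
  · intro h; rw [h]; group
  · intro h; nth_rewrite 2 [← h]; group

lemma conj_eq_self_iff {A : Type*} [Group A] {a b : A} : b * a * b⁻¹ = a ↔ b * a = a * b := by
  rw [mul_inv_eq_iff_eq_mul]

theorem tau_D (m : ℕ) (hm : 1 ≤ m) : AllTau (kQuad (khD m)) := by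
  obtain ⟨ζ, hζ⟩ : ∃ ζ : ℂ, IsPrimitiveRoot ζ (2 * m) :=
    ⟨_, Complex.isPrimitiveRoot_exp (2 * m) (by omega)⟩
  obtain ⟨t, rfl⟩ := hζ.isUnit (by omega)
  have ht : IsPrimitiveRoot t (2 * m) := (IsPrimitiveRoot.coe_units_iff).mp hζ
  have htp : cc t ^ (2 * m) = 1 := by rw [← map_pow, hζ.pow_eq_one, map_one]
  have htp' : cc (t⁻¹ : ℂˣ) ^ (2 * m) = 1 := by
    have := congrArg (· ^ (2 * m)) (cc_mul_inv t)
    simpa [mul_pow, htp] using this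
  have hI : cc Complex.I * cc Complex.I = -1 := by
    rw [← map_mul, Complex.I_mul_I, map_neg, map_one]
  have hH : 2 * cc (1/2) = 1 := by
    rw [show (2 : P2) = cc 2 from (map_ofNat _ 2).symm, ← map_mul]; norm_num
  have ht1 := cc_mul_inv t
  obtain ⟨s, hs⟩ : ∃ s : P2, s = cc Complex.I ^ m := ⟨_, rfl⟩
  obtain ⟨e, he⟩ : ∃ e : P2, e = cc Complex.I ^ (2 * m) := ⟨_, rfl⟩
  have hss : s * s = e := by rw [hs, he]; ring
  have hee : e * e = 1 := by
    rw [he, ← mul_pow, hI, pow_mul]; simp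
  have hls : ∀ γ, lin γ s = s := fun γ => by rw [hs, map_pow, lin_cc]
  have hle : ∀ γ, lin γ e = e := fun γ => by rw [he, map_pow, lin_cc]
  have hneg : (-1 : P2) ^ (2 * m) = 1 := by rw [pow_mul]; simp
  obtain ⟨X, hX⟩ : ∃ X : P2, X = s * cc (1/2) * (uu * vv) * (uu ^ (2 * m) - e * vv ^ (2 * m)) :=
    ⟨_, rfl⟩
  obtain ⟨Y, hY⟩ : ∃ Y : P2, Y = cc Complex.I * s * cc (1/2) * (uu ^ (2 * m) + e * vv ^ (2 * m)) :=
    ⟨_, rfl⟩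
  obtain ⟨Z, hZ⟩ : ∃ Z : P2, Z = uu ^ 2 * vv ^ 2 := ⟨_, rfl⟩
  obtain ⟨k, hk⟩ : ∃ k, k = mkGL 1 0 0 (-1) (by norm_num) := ⟨_, rfl⟩
  obtain ⟨b, hb⟩ : ∃ b, b = mkGL 0 Complex.I Complex.I 0 (by simp) := ⟨_, rfl⟩
  have hkm : k ∈ KGrp X Y Z ∧ k.1.det = -1 := by
    have hkd : k.1.det = -1 := by rw [hk, mkGL_det]; norm_num
    refine ⟨?_, hkd⟩
    rw [mem_KGrp, hkd, hX, hY, hZ, hk]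
    simp only [map_mul, map_add, map_sub, map_neg, map_pow, lin_u, lin_v, lin_cc, map_zero, map_one,
      hls, hle, zero_mul, one_mul, neg_mul, zero_add, add_zero, mul_pow, neg_pow vv, hneg, neg_smul,
      one_smul]
    refine ⟨?_, ?_, ?_⟩
    · trivial
    · ring
    · ring
  have hbm : b ∈ SG (KGrp X Y Z) := by
    have hbd : b.1.det = 1 := by rw [hb, mkGL_det]; simp
    refine ⟨?_, hbd⟩
    rw [mem_KGrp, hbd, hX, hY, hZ, hb]
    simp only [map_mul, map_add, map_sub, map_neg, map_pow, lin_u, lin_v, lin_cc, map_zero, map_one,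
      hls, hle, zero_mul, one_mul, neg_mul, zero_add, add_zero, mul_pow, ← he,
      one_smul]
    refine ⟨?_, ?_, ?_⟩
    · linear_combination cc Complex.I * s * cc (1/2) * uu ^ (2 * m) * hee
    · linear_combination (cc Complex.I * cc Complex.I - 1) * uu ^ 2 * vv ^ 2 * hI
    · linear_combination s * cc (1/2) * (uu * vv) * e * vv ^ (2 * m) * hI
        - s * cc (1/2) * (uu * vv) * cc Complex.I ^ 2 * uu ^ (2 * m) * hee
        - s * cc (1/2) * (uu * vv) * uu ^ (2 * m) * hI
  have hd : dg t ∈ SG (KGrp X Y Z) := by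
    refine ⟨?_, dg_det t⟩
    rw [mem_KGrp, dg_det, hX, hY, hZ]
    simp only [map_mul, map_add, map_sub, map_neg, map_pow, lin_dg_u, lin_dg_v, lin_cc, mul_pow, htp, htp',
      one_mul, one_smul, true_and, and_true, hls, hle]
    constructor
    · linear_combination uu ^ 2 * vv ^ 2 * (cc t * cc (t⁻¹ : ℂˣ) + 1) * ht1
    · linear_combination s * cc (1/2) * (uu * vv) * (uu ^ (2 * m) - e * vv ^ (2 * m)) * ht1
  refine allTau_P2 (khD m) (X := X) (Y := Y) (Z := Z) (by simp [hY, show m ≠ 0 by omega]) (by simp [hZ]) (sqf_D m hm) ?_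
    (N := 2 * (2 * m) + (2 * m) * 2) ?_ ?_
  · simp only [map_add, map_pow, map_mul, sb_X0, sb_X1]
    rw [hX, hY, hZ, ← mul_pow uu vv]
    have : ((uu * vv) ^ 2) ^ (m + 1) = uu ^ 2 * vv ^ 2 * uu ^ (2 * m) * vv ^ (2 * m) := by ring
    rw [this]
    generalize uu ^ (2 * m) = U
    generalize vv ^ (2 * m) = V
    linear_combination (s ^ 2 * cc (1/2) ^ 2 * uu ^ 2 * vv ^ 2 * (U + e * V) ^ 2) * hI
      - 4 * cc (1/2) ^ 2 * uu ^ 2 * vv ^ 2 * e * U * V * hss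
      - 4 * cc (1/2) ^ 2 * uu ^ 2 * vv ^ 2 * U * V * hee
      - (2 * cc (1/2) + 1) * uu ^ 2 * vv ^ 2 * U * V * hH
  · have hYp : -2 * e * s * cc Complex.I * Y = uu ^ (2 * m) + e * vv ^ (2 * m) := by
      rw [hY]
      generalize uu ^ (2 * m) + e * vv ^ (2 * m) = S
      linear_combination (-2 * e * s ^ 2 * cc (1/2) * S) * hI + 2 * e * cc (1/2) * S * hss
        + 2 * cc (1/2) * S * hee + S * hH
    rw [hZ]
    refine (Spans.mul (a := uu ^ 2) (b := vv ^ 2) (c := Y) ?_ ?_).swap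
    · have := spans_uv 2 (2 * m)
      refine this.of ⟨1, 0, by ring⟩ ⟨- e * uu ^ (2 * (m - 1)), e * (-2 * e * s * cc Complex.I), ?_⟩
      have : uu ^ (2 * m) = uu ^ (2 * (m - 1)) * uu ^ 2 := by
        rw [← pow_add]; congr 1; omega
      rw [this] at hYp
      linear_combination e * hYp + vv ^ (2 * m) * hee
    · have := spans_uv (2 * m) 2
      refine this.swap.of ⟨1, 0, by ring⟩ ⟨- e * vv ^ (2 * (m - 1)), -2 * e * s * cc Complex.I, ?_⟩
      have : vv ^ (2 * m) = vv ^ (2 * (m - 1)) * vv ^ 2 := by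
        rw [← pow_add]; congr 1; omega
      rw [this] at hYp
      linear_combination hYp
  · intro hfin hcard hdet
    have hc := card_SG hdet hkm.1 hkm.2
    have := finite_SG (Γ := KGrp X Y Z)
    have ho : orderOf (dg t) = 2 * m := by
      rw [orderOf_injective dg dg_injective, ← ht.eq_orderOf]
    have hbz : b ∉ Subgroup.zpowers (dg t) := by
      intro h
      obtain ⟨i, hi⟩ := Subgroup.mem_zpowers_iff.mp h
      rw [← map_zpow] at hi
      have := congrArg (fun γ : GL (Fin 2) ℂ => γ.1 0 1) hi
      rw [hb] at this
      simp only [dg_eq, mkGL_val] at this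
      exact Complex.I_ne_zero (by simpa using this.symm)
    obtain ⟨h1, h2⟩ := idx_two hd hbm hbz (by omega)
    refine ⟨by omega, ⟨_, hkm.1, hkm.2⟩, fun γ hγ hγd => ?_⟩
    have hba : b * dg t * b⁻¹ = (dg t)⁻¹ := by
      rw [mul_inv_eq_iff_eq_mul, ← map_inv, dg_eq, dg_eq, hb]
      apply Units.ext
      rw [Units.val_mul, Units.val_mul, mkGL_val, mkGL_val, mkGL_val, Matrix.mul_fin_two,
        Matrix.mul_fin_two]
      simp [mul_comm]
    have hka : k * dg t * k⁻¹ = dg t := by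
      rw [mul_inv_eq_iff_eq_mul, dg_eq, hk]
      apply Units.ext
      rw [Units.val_mul, Units.val_mul, mkGL_val, mkGL_val, Matrix.mul_fin_two,
        Matrix.mul_fin_two]
      simp
    have hkb : k * b * k⁻¹ = b⁻¹ := by
      rw [conj_eq_inv_iff, hk, hb]
      apply Units.ext
      rw [Units.val_mul, Units.val_mul, mkGL_val, mkGL_val, Matrix.mul_fin_two,
        Matrix.mul_fin_two]
      simp
    rcases dic_inv hba hka hkb (h2 γ ⟨hγ, hγd⟩) with h | h
    · exact ⟨k * b, Subgroup.mul_mem _ hkm.1 hbm.1, by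
        rw [Units.val_mul, Matrix.det_mul, hkm.2, hbm.2, mul_one], h⟩
    · exact ⟨k, hkm.1, hkm.2, h⟩

end Klein

namespace Klein

lemma conj_into {A : Type*} [Group A] {G H : Subgroup A} [Finite G] (hHG : H ≤ G) {p e m : ℕ}
    (hp : p.Prime) (hH : Nat.card H = p ^ e) (hn : ¬ p ^ (e + 1) ∣ Nat.card G) {g : A} (hg : g ∈ G)
    (ho : orderOf g = p ^ m) : ∃ x ∈ G, x * g * x⁻¹ ∈ H := by
  haveI : Fact p.Prime := ⟨hp⟩
  have hH' : Nat.card (H.subgroupOf G) = p ^ e := by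
    rw [Nat.card_congr (Subgroup.subgroupOfEquivOfLe hHG).toEquiv, hH]
  have hdvd : p ^ e ∣ Nat.card G := hH' ▸ Subgroup.card_subgroup_dvd_card _
  have hpos : Nat.card G ≠ 0 := Nat.card_pos.ne'
  have hfac : (Nat.card G).factorization p = e := by
    apply le_antisymm
    · by_contra h
      exact hn ((hp.pow_dvd_iff_le_factorization hpos).mpr (by omega))
    · exact (hp.pow_dvd_iff_le_factorization hpos).mp hdvd
  let S : Sylow p G := Sylow.ofCard (H.subgroupOf G) (by rw [hH', hfac])
  have hS : (S : Subgroup G) = H.subgroupOf G := Sylow.coe_ofCard _ _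
  have hpg : IsPGroup p (Subgroup.zpowers (⟨g, hg⟩ : G)) := by
    apply IsPGroup.of_card (n := m)
    rw [Nat.card_zpowers, ← ho]
    exact (Subgroup.orderOf_coe (⟨g, hg⟩ : G)).symm
  obtain ⟨Q, hQ⟩ := hpg.exists_le_sylow
  obtain ⟨x, hx⟩ := MulAction.exists_smul_eq G Q S
  refine ⟨x, x.2, ?_⟩
  have h1 : (⟨g, hg⟩ : G) ∈ Q := hQ (Subgroup.mem_zpowers _)
  have h2 : x * ⟨g, hg⟩ * x⁻¹ ∈ (S : Subgroup G) := by
    rw [← hx, Sylow.coe_subgroup_smul]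
    exact Subgroup.smul_mem_pointwise_smul _ (MulAut.conj x) _ h1
  rw [hS, Subgroup.mem_subgroupOf] at h2
  exact h2

lemma commutant {A B : Matrix (Fin 2) (Fin 2) ℂ} (hA : ¬ ∃ c : ℂ, A = c • 1) (hc : B * A = A * B) :
    ∃ α β : ℂ, B = α • 1 + β • A := by
  obtain ⟨a, b, c, d, rfl⟩ : ∃ a b c d, A = !![a, b; c, d] := ⟨_, _, _, _, Matrix.eta_fin_two A⟩
  obtain ⟨a', b', c', d', rfl⟩ : ∃ a b c d, B = !![a, b; c, d] := ⟨_, _, _, _, Matrix.eta_fin_two B⟩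
  rw [Matrix.mul_fin_two, Matrix.mul_fin_two] at hc
  have h00 := congrFun (congrFun hc 0) 0
  have h01 := congrFun (congrFun hc 0) 1
  have h10 := congrFun (congrFun hc 1) 0
  simp at h00 h01 h10
  have key : ∀ α β : ℂ, a' = α + β * a → b' = β * b → c' = β * c → d' = α + β * d →
      ∃ α β : ℂ, !![a', b'; c', d'] = α • (1 : Matrix (Fin 2) (Fin 2) ℂ) + β • !![a, b; c, d] := by
    intro α β h1 h2 h3 h4
    refine ⟨α, β, ?_⟩
    ext i j
    fin_cases i <;> fin_cases j <;> simp [h1, h2, h3, h4]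
  by_cases hb : b = 0
  · by_cases hcc : c = 0
    · subst hb hcc
      have had : a - d ≠ 0 := by
        intro h
        refine hA ⟨a, ?_⟩
        have : d = a := by linear_combination -h
        subst this
        ext i j
        fin_cases i <;> fin_cases j <;> simp
      have hb' : b' = 0 := by
        have : (a - d) * b' = 0 := by linear_combination -h01
        simpa [had] using this
      have hc' : c' = 0 := by
        have : (a - d) * c' = 0 := by linear_combination h10
        simpa [had] using this
      refine key (a' - (a' - d') / (a - d) * a) ((a' - d') / (a - d)) (by ring) (by simp [hb']) (by simp [hc']) ?_
      field_simp
      ring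
    · refine key (a' - c' / c * a) (c' / c) (by ring) ?_ (by field_simp) ?_
      · subst hb
        have : c * b' = 0 := by linear_combination h00
        simpa [hcc] using this
      · field_simp
        linear_combination h10
  · refine key (a' - b' / b * a) (b' / b) (by ring) (by field_simp) ?_ ?_
    · field_simp
      linear_combination -h00
    · field_simp
      linear_combination -h01

lemma inv_val {g : GL (Fin 2) ℂ} (hd : g.1.det = 1) : (g⁻¹).1 = g.1.trace • 1 - g.1 := by
  have h : g.1 * (g.1.trace • 1 - g.1) = 1 := by
    obtain ⟨a, b, c, d, h⟩ : ∃ a b c d, g.1 = !![a, b; c, d] := ⟨_, _, _, _, Matrix.eta_fin_two g.1⟩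
    rw [h, Matrix.det_fin_two_of] at hd
    rw [h, Matrix.trace_fin_two_of]
    ext i j
    fin_cases i <;> fin_cases j <;> simp [Matrix.mul_apply, Fin.sum_univ_two] <;>
      first | linear_combination hd | ring1
  have h2 : (g⁻¹).1 * g.1 = 1 := by rw [← Units.val_mul, inv_mul_cancel]; rfl
  calc (g⁻¹).1 = (g⁻¹).1 * (g.1 * (g.1.trace • 1 - g.1)) := by rw [h, mul_one]
    _ = _ := by rw [← mul_assoc, h2, one_mul]

lemma inv_of_comm {g g0 k : GL (Fin 2) ℂ} (hd0 : g0.1.det = 1) (hd : g.1.det = 1)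
    (hns : ¬ ∃ c : ℂ, g0.1 = c • 1) (hc : g * g0 = g0 * g) (hk : k * g0 * k⁻¹ = g0⁻¹) :
    k * g * k⁻¹ = g⁻¹ := by
  rw [mul_inv_eq_iff_eq_mul] at hk ⊢
  have hc' := congrArg Units.val hc
  have hk' := congrArg Units.val hk
  rw [Units.val_mul, Units.val_mul] at hc' hk'
  obtain ⟨α, β, h⟩ := commutant hns hc'
  apply Units.ext
  rw [Units.val_mul, Units.val_mul, inv_val hd]
  rw [inv_val hd0] at hk'
  have ht : g.1.trace = 2 * α + β * g0.1.trace := by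
    rw [h, Matrix.trace_add, Matrix.trace_smul, Matrix.trace_smul, Matrix.trace_one]
    simp [mul_comm]
  rw [ht, h, mul_add, mul_smul_comm, mul_smul_comm, hk', sub_mul, sub_mul, add_mul]
  simp only [smul_mul_assoc, mul_one, one_mul, smul_sub, smul_smul, add_smul, two_mul, add_mul]
  abel

/-- being inverted by an element of determinant `-1` -/
def IInv (Γ : Subgroup (GL (Fin 2) ℂ)) (g : GL (Fin 2) ℂ) : Prop :=
  ∃ k ∈ Γ, k.1.det = -1 ∧ k * g * k⁻¹ = g⁻¹

lemma IInv.conj {Γ : Subgroup (GL (Fin 2) ℂ)} {g x : GL (Fin 2) ℂ} (hx : x ∈ SG Γ)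
    (h : IInv Γ (x * g * x⁻¹)) : IInv Γ g := by
  obtain ⟨k, hk, hd, h⟩ := h
  refine ⟨x⁻¹ * k * x, Γ.mul_mem (Γ.mul_mem (Γ.inv_mem hx.1) hk) hx.1, ?_, ?_⟩
  · rw [Units.val_mul, Units.val_mul, Matrix.det_mul, Matrix.det_mul, hd,
      ((SG Γ).inv_mem hx).2, hx.2]; norm_num
  · calc x⁻¹ * k * x * g * (x⁻¹ * k * x)⁻¹ = x⁻¹ * (k * (x * g * x⁻¹) * k⁻¹) * x := by group
      _ = g⁻¹ := by rw [h]; group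

lemma IInv.zpow {Γ : Subgroup (GL (Fin 2) ℂ)} {c g : GL (Fin 2) ℂ}
    (h : IInv Γ c) (hg : g ∈ Subgroup.zpowers c) : IInv Γ g := by
  obtain ⟨k, hk, hd, h⟩ := h
  obtain ⟨i, rfl⟩ := Subgroup.mem_zpowers_iff.mp hg
  exact ⟨k, hk, hd, conj_zpow h i⟩

theorem E_main {Γ : Subgroup (GL (Fin 2) ℂ)} [Finite Γ]
    (hodd : ∀ p : ℕ, p.Prime → p ≠ 2 → p ∣ Nat.card (SG Γ) → ¬ p ^ 2 ∣ Nat.card (SG Γ) ∧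
      ∃ c ∈ SG Γ, orderOf c = p ∧ IInv Γ c)
    {H : Subgroup (GL (Fin 2) ℂ)} (hH : H ≤ SG Γ) {e : ℕ} (hHc : Nat.card H = 2 ^ e)
    (hn : ¬ 2 ^ (e + 1) ∣ Nat.card (SG Γ)) (hHi : ∀ h ∈ H, IInv Γ h) :
    ∀ γ ∈ SG Γ, IInv Γ γ := by
  intro γ hγ
  have := finite_SG (Γ := Γ)
  have hdc : orderOf γ ∣ Nat.card (SG Γ) := by
    have := orderOf_dvd_natCard (⟨γ, hγ⟩ : SG Γ)
    rwa [← Subgroup.orderOf_coe] at this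
  have hpos : 0 < orderOf γ := Nat.pos_of_dvd_of_pos hdc Nat.card_pos
  by_cases h2 : ∃ p, p.Prime ∧ p ≠ 2 ∧ p ∣ orderOf γ
  · obtain ⟨p, hp, hp2, hpd⟩ := h2
    obtain ⟨hpn, c, hc, hco, hci⟩ := hodd p hp hp2 (hpd.trans hdc)
    obtain ⟨q, hq⟩ := hpd
    have hq0 : q ≠ 0 := by rintro rfl; omega
    have ho : orderOf (γ ^ q) = p := by
      rw [orderOf_pow' _ hq0, hq, Nat.gcd_mul_left_left, Nat.mul_div_cancel _ (Nat.pos_of_ne_zero hq0)]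
    have hg0 : γ ^ q ∈ SG Γ := Subgroup.pow_mem _ hγ q
    obtain ⟨x, hx, hxm⟩ := conj_into (G := SG Γ) (H := Subgroup.zpowers c)
      (by rwa [Subgroup.zpowers_le]) hp (e := 1) (m := 1) (by rw [Nat.card_zpowers, hco, pow_one])
      hpn hg0 (by rw [ho, pow_one])
    obtain ⟨k, hk, hkd, hki⟩ := IInv.conj hx (hci.zpow hxm)
    refine ⟨k, hk, hkd, inv_of_comm hg0.2 hγ.2 ?_ ?_ hki⟩
    · rintro ⟨s, hs⟩
      have hd := hg0.2
      rw [hs, Matrix.det_smul, Matrix.det_one, mul_one] at hd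
      simp only [Fintype.card_fin] at hd
      have : (γ ^ q) ^ 2 = 1 := by
        apply Units.ext
        rw [Units.val_pow_eq_pow_val, hs, smul_pow, hd, one_smul, one_pow]; rfl
      have := orderOf_dvd_of_pow_eq_one this
      rw [ho] at this
      exact hp2 ((Nat.prime_dvd_prime_iff_eq hp Nat.prime_two).mp this)
    · rw [← pow_succ, ← pow_succ']
  · push Not at h2
    have h3 : orderOf γ = 2 ^ (orderOf γ).primeFactorsList.length := by
      apply Nat.eq_prime_pow_of_unique_prime_dvd hpos.ne'
      intro d hd hdd
      by_contra h
      exact h2 d hd h hdd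
    obtain ⟨x, hx, hxm⟩ := conj_into hH Nat.prime_two hHc hn hγ h3
    exact IInv.conj hx (hHi _ hxm)

/-- the subgroup generated by `a` and `b` -/
def dic {A : Type*} [Group A] (a b : A) (hb : b * a * b⁻¹ = a⁻¹) (hbb : b * b ∈ Subgroup.zpowers a) :
    Subgroup A where
  carrier := {g | g ∈ Subgroup.zpowers a ∨ g * b⁻¹ ∈ Subgroup.zpowers a}
  one_mem' := Or.inl (Subgroup.one_mem _)
  mul_mem' := by
    have hn : ∀ x ∈ Subgroup.zpowers a, b * x * b⁻¹ ∈ Subgroup.zpowers a := by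
      intro x hx
      obtain ⟨i, rfl⟩ := Subgroup.mem_zpowers_iff.mp hx
      rw [conj_zpow hb]; exact Subgroup.inv_mem _ hx
    rintro x y (hx | hx) (hy | hy)
    · exact Or.inl (Subgroup.mul_mem _ hx hy)
    · right; rw [mul_assoc]; exact Subgroup.mul_mem _ hx hy
    · right
      have := Subgroup.mul_mem _ hx (hn _ hy)
      convert this using 1; group
    · left
      have := Subgroup.mul_mem _ (Subgroup.mul_mem _ hx (hn _ hy)) hbb
      convert this using 1; group
  inv_mem' := by
    have hn : ∀ x ∈ Subgroup.zpowers a, b⁻¹ * x * b ∈ Subgroup.zpowers a := by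
      intro x hx
      obtain ⟨i, rfl⟩ := Subgroup.mem_zpowers_iff.mp hx
      have h := conj_zpow hb (-i)
      have : b⁻¹ * a ^ i * b = a ^ (-i) := by
        have h' : a ^ i = b * a ^ (-i) * b⁻¹ := by rw [h]; group
        nth_rewrite 1 [h']; group
      rw [this]; exact Subgroup.zpow_mem _ (Subgroup.mem_zpowers a) _
    rintro x (hx | hx)
    · exact Or.inl (Subgroup.inv_mem _ hx)
    · right
      have := Subgroup.mul_mem _ (hn _ (Subgroup.inv_mem _ hx)) (Subgroup.inv_mem _ hbb)
      convert this using 1; group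

section
variable {A : Type*} [Group A] {a b : A} {hb : b * a * b⁻¹ = a⁻¹} {hbb : b * b ∈ Subgroup.zpowers a}

lemma mem_dic {g : A} : g ∈ dic a b hb hbb ↔ g ∈ Subgroup.zpowers a ∨ g * b⁻¹ ∈ Subgroup.zpowers a :=
  Iff.rfl

lemma dic_le {G : Subgroup A} (ha : a ∈ G) (hbG : b ∈ G) : dic a b hb hbb ≤ G := by
  have hz : Subgroup.zpowers a ≤ G := by rwa [Subgroup.zpowers_le]
  rintro g (h | h)
  · exact hz h
  · have := G.mul_mem (hz h) hbG
    rwa [inv_mul_cancel_right] at this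

lemma card_dic (hba : b ∉ Subgroup.zpowers a) : Nat.card (dic a b hb hbb) = 2 * orderOf a := by
  have hle : Subgroup.zpowers a ≤ dic a b hb hbb := fun x hx => Or.inl hx
  have hbm : b ∈ dic a b hb hbb := by
    right; rw [mul_inv_cancel]; exact Subgroup.one_mem _
  have h1 : ((Subgroup.zpowers a).subgroupOf (dic a b hb hbb)).index = 2 := by
    rw [Subgroup.index_eq_two_iff]
    refine ⟨(⟨b, hbm⟩ : dic a b hb hbb)⁻¹, ?_⟩
    rintro ⟨x, hx⟩
    simp only [Subgroup.mem_subgroupOf, Subgroup.coe_mul, Subgroup.coe_inv]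
    rcases hx with hx | hx
    · right
      refine ⟨hx, fun h => hba ?_⟩
      have := Subgroup.mul_mem _ (Subgroup.inv_mem _ hx) h
      rw [inv_mul_cancel_left] at this
      exact (Subgroup.inv_mem_iff _).mp this
    · left
      refine ⟨hx, fun h => hba ?_⟩
      have := Subgroup.mul_mem _ (Subgroup.inv_mem _ h) hx
      rw [inv_mul_cancel_left] at this
      exact (Subgroup.inv_mem_iff _).mp this
  have h2 := Subgroup.index_mul_card ((Subgroup.zpowers a).subgroupOf (dic a b hb hbb))
  rw [h1, Nat.card_congr (Subgroup.subgroupOfEquivOfLe hle).toEquiv, Nat.card_zpowers] at h2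
  exact h2.symm

end

end Klein

namespace Klein

lemma not_mem_zp {A : Type*} [Group A] {a b : A} (hb : b * a * b⁻¹ = a⁻¹) (ha : a ^ 2 ≠ 1) :
    b ∉ Subgroup.zpowers a := by
  intro h
  obtain ⟨i, rfl⟩ := Subgroup.mem_zpowers_iff.mp h
  have : a ^ i * a * (a ^ i)⁻¹ = a := by group
  rw [this] at hb
  apply ha
  rw [sq]
  nth_rewrite 1 [hb]; group

lemma E_fin {Γ : Subgroup (GL (Fin 2) ℂ)} [Finite Γ] {N n : ℕ} (hcard : Nat.card Γ ≤ N)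
    (hdet : ∀ γ ∈ Γ, γ.1.det = 1 ∨ γ.1.det = -1) (hk : ∃ k ∈ Γ, k.1.det = -1)
    (hN : N = 2 * n) (hn : n ∣ Nat.card (SG Γ))
    (h : Nat.card (SG Γ) = n → ∀ γ ∈ SG Γ, IInv Γ γ) :
    N ≤ Nat.card Γ ∧ (∃ k ∈ Γ, k.1.det = -1) ∧
      ∀ γ ∈ Γ, γ.1.det = 1 → ∃ k ∈ Γ, k.1.det = -1 ∧ k * γ * k⁻¹ = γ⁻¹ := by
  obtain ⟨k, hk1, hk2⟩ := hk
  have hc := card_SG hdet hk1 hk2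
  have := finite_SG (Γ := Γ)
  have hpos : 0 < Nat.card (SG Γ) := Nat.card_pos
  have hle := Nat.le_of_dvd hpos hn
  refine ⟨by omega, ⟨k, hk1, hk2⟩, fun γ hγ hd => h (by omega) γ ⟨hγ, hd⟩⟩

lemma mat_ext {a b c d a' b' c' d' : ℂ} (h1 : a = a') (h2 : b = b') (h3 : c = c') (h4 : d = d') :
    !![a, b; c, d] = !![a', b'; c', d'] := by subst h1 h2 h3 h4; rfl

/-- octahedral forms -/
def fT {A : Type*} [CommRing A] (u v : A) : A := u * v * (u ^ 4 - v ^ 4)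
def fW {A : Type*} [CommRing A] (u v : A) : A := (u ^ 4) ^ 2 + 14 * u ^ 4 * v ^ 4 + (v ^ 4) ^ 2
def fC {A : Type*} [CommRing A] (u v : A) : A :=
  (u ^ 4) ^ 3 - 33 * (u ^ 4) ^ 2 * v ^ 4 - 33 * u ^ 4 * (v ^ 4) ^ 2 + (v ^ 4) ^ 3

lemma syz_O {A : Type*} [CommRing A] (u v : A) : fC u v ^ 2 = fW u v ^ 3 - 108 * fT u v ^ 4 := by
  unfold fC fW fT; ring

lemma lin_fT (γ) : lin γ (fT uu vv) = fT (lin γ uu) (lin γ vv) := by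
  simp only [fT, map_mul, map_sub, map_pow]
lemma lin_fW (γ) : lin γ (fW uu vv) = fW (lin γ uu) (lin γ vv) := by
  simp only [fW, map_mul, map_add, map_pow, map_ofNat]
lemma lin_fC (γ) : lin γ (fC uu vv) = fC (lin γ uu) (lin γ vv) := by
  simp only [fC, map_mul, map_add, map_sub, map_pow, map_ofNat]

lemma f_D {A : Type*} [CommRing A] (z u v : A) (hz : z ^ 4 = -1) :
    fT (z * u + 0 * v) (0 * u + - z ^ 3 * v) = - fT u v ∧ fW (z * u + 0 * v) (0 * u + - z ^ 3 * v) = fW u v ∧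
      fC (z * u + 0 * v) (0 * u + - z ^ 3 * v) = - fC u v := by
  have h1 : (z * u + 0 * v) * (0 * u + - z ^ 3 * v) = u * v := by linear_combination - u * v * hz
  have h2 : (z * u + 0 * v) ^ 4 = - u ^ 4 := by linear_combination u ^ 4 * hz
  have h3 : (0 * u + - z ^ 3 * v) ^ 4 = - v ^ 4 := by
    linear_combination (z ^ 8 - z ^ 4 + 1) * v ^ 4 * hz
  unfold fT fW fC
  rw [h1, h2, h3]
  refine ⟨?_, ?_, ?_⟩ <;> ring

lemma f_sc {A : Type*} [CommRing A] (z u v : A) (hz : z ^ 4 = -1) :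
    fT (z ^ 2 * u + 0 * v) (0 * u + z ^ 2 * v) = - fT u v ∧ fW (z ^ 2 * u + 0 * v) (0 * u + z ^ 2 * v) = fW u v ∧
      fC (z ^ 2 * u + 0 * v) (0 * u + z ^ 2 * v) = fC u v := by
  have h1 : (z ^ 2 * u + 0 * v) * (0 * u + z ^ 2 * v) = - (u * v) := by linear_combination u * v * hz
  have h2 : (z ^ 2 * u + 0 * v) ^ 4 = u ^ 4 := by linear_combination (z ^ 4 - 1) * u ^ 4 * hz
  have h3 : (0 * u + z ^ 2 * v) ^ 4 = v ^ 4 := by linear_combination (z ^ 4 - 1) * v ^ 4 * hz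
  unfold fT fW fC
  rw [h1, h2, h3]
  refine ⟨?_, ?_, ?_⟩ <;> ring

lemma f_j {A : Type*} [CommRing A] (u v : A) :
    fT (0 * u + 1 * v) (- 1 * u + 0 * v) = fT u v ∧ fW (0 * u + 1 * v) (- 1 * u + 0 * v) = fW u v ∧
      fC (0 * u + 1 * v) (- 1 * u + 0 * v) = fC u v := by
  unfold fT fW fC
  refine ⟨?_, ?_, ?_⟩ <;> ring

lemma f_T {A : Type*} [CommRing A] (s u v : A) (hs : 2 * s ^ 2 = -1) :
    fT (s * u + s * v) (s * u + - s * v) = - fT u v ∧ fW (s * u + s * v) (s * u + - s * v) = fW u v ∧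
      fC (s * u + s * v) (s * u + - s * v) = - fC u v := by
  have h6 : 8 * s ^ 6 = -1 := by linear_combination (4 * s ^ 4 - 2 * s ^ 2 + 1) * hs
  have h8 : 16 * s ^ 8 = 1 := by linear_combination 2 * s ^ 2 * h6 - hs
  have h12 : 64 * s ^ 12 = 1 := by linear_combination (8 * s ^ 6 - 1) * h6
  unfold fT fW fC
  refine ⟨?_, ?_, ?_⟩
  · linear_combination (u * v * (u ^ 4 - v ^ 4)) * h6
  · linear_combination ((u ^ 4) ^ 2 + 14 * u ^ 4 * v ^ 4 + (v ^ 4) ^ 2) * h8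
  · linear_combination
      -((u ^ 4) ^ 3 - 33 * (u ^ 4) ^ 2 * v ^ 4 - 33 * u ^ 4 * (v ^ 4) ^ 2 + (v ^ 4) ^ 3) * h12

lemma exists_z8 : ∃ z : ℂ, z ^ 4 = -1 := IsAlgClosed.exists_pow_nat_eq (-1) (by norm_num)

/-- a primitive eighth root of unity -/
def z8 : ℂ := exists_z8.choose
lemma z8_4 : z8 ^ 4 = -1 := exists_z8.choose_spec

def s8 : ℂ := (z8 + z8 ^ 3) / 2
lemma s8_2 : 2 * s8 ^ 2 = -1 := by
  unfold s8
  linear_combination (1 + z8 ^ 2 / 2) * z8_4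

def oD : GL (Fin 2) ℂ := mkGL z8 0 0 (- z8 ^ 3) (by
  have : z8 * (- z8 ^ 3) - 0 * 0 = 1 := by linear_combination -z8_4
  rw [this]; exact one_ne_zero)

def osc : GL (Fin 2) ℂ := mkGL (z8 ^ 2) 0 0 (z8 ^ 2) (by
  have : z8 ^ 2 * z8 ^ 2 - 0 * 0 = -1 := by linear_combination z8_4
  rw [this]; norm_num)

def oj : GL (Fin 2) ℂ := mkGL 0 (-1) 1 0 (by norm_num)

def oT : GL (Fin 2) ℂ := mkGL s8 s8 s8 (-s8) (by
  have : s8 * (- s8) - s8 * s8 = 1 := by linear_combination -s8_2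
  rw [this]; norm_num)

lemma oD_val : oD.1 = !![z8, 0; 0, - z8 ^ 3] := rfl
lemma osc_val : osc.1 = !![z8 ^ 2, 0; 0, z8 ^ 2] := rfl
lemma oj_val : oj.1 = !![0, -1; 1, 0] := rfl
lemma oT_val : oT.1 = !![s8, s8; s8, -s8] := rfl

lemma oD_det : oD.1.det = 1 := by rw [oD_val, Matrix.det_fin_two_of]; linear_combination -z8_4
lemma osc_det : osc.1.det = -1 := by rw [osc_val, Matrix.det_fin_two_of]; linear_combination z8_4
lemma oj_det : oj.1.det = 1 := by rw [oj_val, Matrix.det_fin_two_of]; norm_num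
lemma oT_det : oT.1.det = 1 := by rw [oT_val, Matrix.det_fin_two_of]; linear_combination -s8_2

lemma cc_zero : cc 0 = 0 := map_zero _
lemma cc_one : cc 1 = 1 := map_one _
lemma cc_neg (a : ℂ) : cc (-a) = - cc a := map_neg _ _
lemma cc_pow (a : ℂ) (n : ℕ) : cc (a ^ n) = cc a ^ n := map_pow _ _ _

abbrev pT : P2 := fT uu vv
abbrev pW : P2 := fW uu vv
abbrev pC : P2 := fC uu vv

lemma lin_oD : lin oD pT = - pT ∧ lin oD pW = pW ∧ lin oD pC = - pC := by
  rw [lin_fT, lin_fW, lin_fC, oD, lin_u, lin_v, cc_zero, cc_neg, cc_pow]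
  exact f_D _ _ _ (by rw [← map_pow, z8_4, map_neg, map_one])

lemma lin_osc : lin osc pT = - pT ∧ lin osc pW = pW ∧ lin osc pC = pC := by
  rw [lin_fT, lin_fW, lin_fC, osc, lin_u, lin_v, cc_zero, cc_pow]
  exact f_sc _ _ _ (by rw [← map_pow, z8_4, map_neg, map_one])

lemma lin_oj : lin oj pT = pT ∧ lin oj pW = pW ∧ lin oj pC = pC := by
  rw [lin_fT, lin_fW, lin_fC, oj, lin_u, lin_v, cc_zero, cc_neg, cc_one]
  exact f_j _ _

lemma lin_oT : lin oT pT = - pT ∧ lin oT pW = pW ∧ lin oT pC = - pC := by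
  rw [lin_fT, lin_fW, lin_fC, oT, lin_u, lin_v, cc_neg]
  exact f_T _ _ _ (by
    rw [← map_pow, show (2 : P2) = cc 2 from (map_ofNat _ 2).symm, ← map_mul, s8_2, map_neg, map_one])

/-- dimension count -/
lemma spans_TW : Spans (Ideal.span {pT, pW}) 48 := by
  have h16 : cc (1/16) * 16 = 1 := by
    rw [show (16 : P2) = cc 16 from (map_ofNat _ 16).symm, ← map_mul]; norm_num
  have h1 : Spans (Ideal.span {uu, pW}) 8 := (spans_uv 1 8).of ⟨1, 0, by ring⟩
    ⟨- uu ^ 7 - 14 * uu ^ 3 * vv ^ 4, 1, by unfold pW fW; ring⟩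
  have h2 : Spans (Ideal.span {vv, pW}) 8 := (spans_uv 8 1).swap.of ⟨1, 0, by ring⟩
    ⟨- vv ^ 7 - 14 * vv ^ 3 * uu ^ 4, 1, by unfold pW fW; ring⟩
  have h3 : Spans (Ideal.span {uu ^ 4 - vv ^ 4, pW}) 32 := by
    have h4 : Spans (Ideal.span {vv, uu ^ 4 - vv ^ 4}) 4 := (spans_uv 4 1).swap.of ⟨1, 0, by ring⟩
      ⟨vv ^ 3, 1, by ring⟩
    refine (h4.pow 8).swap.of ⟨1, 0, by ring⟩
      ⟨- cc (1/16) * (uu ^ 4 + 15 * vv ^ 4), cc (1/16), ?_⟩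
    unfold pW fW
    linear_combination vv ^ 8 * h16
  exact (h1.mul h2).mul h3

end Klein

namespace Klein

lemma o1 : oj * oD * oj⁻¹ = oD⁻¹ := by
  rw [conj_eq_inv_iff]
  apply Units.ext
  simp only [Units.val_mul, oD_val, oj_val, Matrix.mul_fin_two]
  have := z8_4
  apply mat_ext <;> grind

lemma o2 : oj * oj = oD ^ 4 := by
  apply Units.ext
  simp only [Units.val_mul, oD_val, oj_val, pow_succ, pow_zero, one_mul, Matrix.mul_fin_two]
  have := z8_4
  apply mat_ext <;> grind

lemma o3 : (oD * oT) ^ 3 = 1 := by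
  apply Units.ext
  simp only [Units.val_mul, oD_val, oT_val, pow_succ, pow_zero, one_mul, Matrix.mul_fin_two,
    Units.val_one, Matrix.one_fin_two, s8]
  have := z8_4
  apply mat_ext <;> grind

lemma o3' : oD * oT ≠ 1 := by
  intro h
  have h2 := congrArg (fun g : GL (Fin 2) ℂ => g.1 0 1) h
  simp only [Units.val_mul, oD_val, oT_val, Matrix.mul_fin_two,
    Units.val_one, Matrix.one_fin_two, s8] at h2
  simp at h2
  have := z8_4
  grind

lemma o4 : (osc * oT * oj) * (oD * oT) * (osc * oT * oj)⁻¹ = (oD * oT)⁻¹ := by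
  rw [conj_eq_inv_iff]
  apply Units.ext
  simp only [Units.val_mul, oD_val, oT_val, osc_val, oj_val, Matrix.mul_fin_two, s8]
  have := z8_4
  apply mat_ext <;> grind

lemma o5 : oD ^ 4 ≠ 1 := by
  intro h
  have h2 := congrArg (fun g : GL (Fin 2) ℂ => g.1 0 0) h
  simp only [pow_succ, pow_zero, one_mul, Units.val_mul, oD_val, Matrix.mul_fin_two,
    Units.val_one, Matrix.one_fin_two] at h2
  simp at h2
  have := z8_4
  grind

lemma o6 : oD ^ 8 = 1 := by
  have : (oD ^ 4) ^ 2 = 1 := by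
    apply Units.ext
    simp only [pow_succ, pow_zero, one_mul, Units.val_mul, oD_val, Matrix.mul_fin_two,
      Units.val_one, Matrix.one_fin_two]
    have := z8_4
    apply mat_ext <;> grind
  rw [← pow_mul] at this
  exact this

lemma o7 : (osc * oD * oD) * oD * (osc * oD * oD)⁻¹ = oD := by
  rw [conj_eq_self_iff]
  apply Units.ext
  simp only [Units.val_mul, oD_val, osc_val, Matrix.mul_fin_two]
  apply mat_ext <;> ring

lemma o8 : (osc * oD * oD) * oj * (osc * oD * oD)⁻¹ = oj⁻¹ := by
  rw [conj_eq_inv_iff]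
  apply Units.ext
  simp only [Units.val_mul, oD_val, oj_val, osc_val, Matrix.mul_fin_two]
  have := z8_4
  apply mat_ext <;> grind

/-- for the tetrahedral group -/
lemma o9 : (osc * oD * oj) * (oD * oD) * (osc * oD * oj)⁻¹ = (oD * oD)⁻¹ := by
  rw [conj_eq_inv_iff]
  apply Units.ext
  simp only [Units.val_mul, oD_val, oj_val, osc_val, Matrix.mul_fin_two]
  have := z8_4
  apply mat_ext <;> grind

lemma o10 : (osc * oT) * oj * (osc * oT)⁻¹ = oj⁻¹ := by
  rw [conj_eq_inv_iff]
  apply Units.ext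
  simp only [Units.val_mul, oT_val, oj_val, osc_val, Matrix.mul_fin_two, s8]
  have := z8_4
  apply mat_ext <;> grind

lemma o11 : (osc * oD * oT * oD * oD * oD) * (oD * oD * oj) * (osc * oD * oT * oD * oD * oD)⁻¹ = (oD * oD * oj)⁻¹ := by
  rw [conj_eq_inv_iff]
  apply Units.ext
  simp only [Units.val_mul, oT_val, oD_val, oj_val, osc_val, Matrix.mul_fin_two, s8]
  have := z8_4
  apply mat_ext <;> grind

lemma o12 : oj * (oD * oD) * oj⁻¹ = (oD * oD)⁻¹ := by
  rw [conj_eq_inv_iff]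
  apply Units.ext
  simp only [Units.val_mul, oD_val, oj_val, Matrix.mul_fin_two]
  have := z8_4
  apply mat_ext <;> grind

lemma o13 : (oD * oD * oj) ^ 2 = (oD * oD) ^ 2 := by
  apply Units.ext
  simp only [pow_succ, pow_zero, one_mul, Units.val_mul, oD_val, oj_val, Matrix.mul_fin_two]
  have := z8_4
  apply mat_ext <;> grind

end Klein

namespace Klein

lemma pT_const : MvPowerSeries.constantCoeff pT = 0 := by simp [fT]
lemma pW_const : MvPowerSeries.constantCoeff pW = 0 := by simp [fW]

lemma cc_unit {c : ℂ} (hc : c ≠ 0) : cc c⁻¹ * cc c = 1 := by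
  rw [← map_mul, inv_mul_cancel₀ hc, map_one]

lemma det_mul_GL (a b : GL (Fin 2) ℂ) : (a * b).1.det = a.1.det * b.1.det := by
  rw [Units.val_mul, Matrix.det_mul]

lemma lin_mul (a b : GL (Fin 2) ℂ) (x : P2) : lin (a * b) x = lin a (lin b x) := by
  rw [map_mul]; rfl

lemma prime_odd_dvd_48 {p : ℕ} (hp : p.Prime) (h2 : p ≠ 2) (h : p ∣ 48) : p = 3 := by
  have : p ∣ 2 ^ 4 * 3 := h
  rcases (hp.dvd_mul).mp this with h | h
  · exact absurd ((Nat.prime_dvd_prime_iff_eq hp Nat.prime_two).mp (hp.dvd_of_dvd_pow h)) h2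
  · exact (Nat.prime_dvd_prime_iff_eq hp Nat.prime_three).mp h

set_option maxHeartbeats 400000 in
theorem tau_E7 : AllTau (kQuad khE7) := by
  obtain ⟨X, hX⟩ : ∃ X : P2, X = cc 864 * (pT * pC) := ⟨_, rfl⟩
  obtain ⟨Y, hY⟩ : ∃ Y : P2, Y = cc 432 * pT ^ 2 := ⟨_, rfl⟩
  obtain ⟨Z, hZ⟩ : ∃ Z : P2, Z = cc (-12) * pW := ⟨_, rfl⟩
  have mem : ∀ γ : GL (Fin 2) ℂ, ∀ e : P2, lin γ pT = e * pT → e ^ 2 = 1 → lin γ pW = pW →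
      lin γ pC = e * cc (γ.1.det) * pC → γ ∈ KGrp X Y Z := by
    intro γ e h1 h2 h3 h4
    rw [mem_KGrp, hX, hY, hZ]
    simp only [map_mul, map_pow, lin_cc, h1, h3, h4, Algebra.smul_def]
    refine ⟨?_, ?_, ?_⟩
    · linear_combination cc 432 * pT ^ 2 * h2
    · trivial
    · linear_combination cc 864 * pT * pC * cc (γ.1.det) * h2
  have mD : oD ∈ SG (KGrp X Y Z) := ⟨mem _ (-1) (by rw [lin_oD.1]; ring) (by ring) lin_oD.2.1
    (by rw [lin_oD.2.2, oD_det, cc_one]; ring), oD_det⟩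
  have mT : oT ∈ SG (KGrp X Y Z) := ⟨mem _ (-1) (by rw [lin_oT.1]; ring) (by ring) lin_oT.2.1
    (by rw [lin_oT.2.2, oT_det, cc_one]; ring), oT_det⟩
  have mj : oj ∈ SG (KGrp X Y Z) := ⟨mem _ 1 (by rw [lin_oj.1]; ring) (by ring) lin_oj.2.1
    (by rw [lin_oj.2.2, oj_det, cc_one]; ring), oj_det⟩
  have msc : osc ∈ KGrp X Y Z := mem _ (-1) (by rw [lin_osc.1]; ring) (by ring) lin_osc.2.1
    (by rw [lin_osc.2.2, osc_det, cc_neg, cc_one]; ring)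
  have msc' : ∀ g ∈ SG (KGrp X Y Z), osc * g ∈ KGrp X Y Z ∧ (osc * g).1.det = -1 := fun g hg =>
    ⟨Subgroup.mul_mem _ msc hg.1, by rw [det_mul_GL, osc_det, hg.2, mul_one]⟩
  have h864 : cc 864 = 864 := map_ofNat _ 864
  have h432 : cc 432 = 432 := map_ofNat _ 432
  have h12 : cc (-12) = -12 := by rw [cc_neg]; exact congrArg Neg.neg (map_ofNat _ 12)
  refine allTau_P2 khE7 (X := X) (Y := Y) (Z := Z) (by simp [hY, fT]) (by simp [hZ, fW]) sqf_E7 ?_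
    (N := 96) ?_ ?_
  · simp only [map_add, map_pow, map_mul, sb_X0, sb_X1]
    rw [hX, hY, hZ, h864, h432, h12]
    have := syz_O (uu : P2) vv
    linear_combination 864 ^ 2 * pT ^ 2 * this
  · refine (spans_TW.pow 2).of ⟨cc 432⁻¹, 0, ?_⟩ ⟨0, cc (-12)⁻¹, ?_⟩
    · rw [hY]
      linear_combination pT ^ 2 * cc_unit (show (432 : ℂ) ≠ 0 by norm_num)
    · rw [hZ]
      linear_combination pW * cc_unit (show (-12 : ℂ) ≠ 0 by norm_num)
  · intro hfin hcard hdet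
    have oD8 : orderOf oD = 8 := orderOf_eq_prime_pow (p := 2) (n := 2) o5 o6
    have o3o : orderOf (oD * oT) = 3 := by
      haveI : Fact (Nat.Prime 3) := ⟨Nat.prime_three⟩
      exact orderOf_eq_prime o3 o3'
    have hz : oj * oj ∈ Subgroup.zpowers oD := by rw [o2]; exact Subgroup.npow_mem_zpowers _ _
    have hne : oD ^ 2 ≠ 1 := by
      intro h; apply o5
      rw [show (4 : ℕ) = 2 * 2 from rfl, pow_mul, h, one_pow]
    have hHc : Nat.card (dic oD oj o1 hz) = 2 ^ 4 := by
      rw [card_dic (not_mem_zp o1 hne), oD8]; norm_num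
    have hHle : dic oD oj o1 hz ≤ SG (KGrp X Y Z) := dic_le mD mj
    have hDT := Subgroup.mul_mem _ mD mT
    have d1 : 16 ∣ Nat.card (SG (KGrp X Y Z)) := by
      have := Subgroup.card_dvd_of_le hHle
      rwa [hHc] at this
    have d2 : 3 ∣ Nat.card (SG (KGrp X Y Z)) := by
      rw [← o3o, ← Nat.card_zpowers]
      exact Subgroup.card_dvd_of_le ((Subgroup.zpowers_le).mpr hDT)
    refine E_fin hcard hdet ⟨osc, msc, osc_det⟩ (n := 48) rfl (by omega) (fun hc => ?_)
    refine E_main ?_ hHle hHc (by rw [hc]; decide) ?_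
    · intro p hp h2 hpd
      rw [hc] at hpd ⊢
      obtain rfl := prime_odd_dvd_48 hp h2 hpd
      refine ⟨by decide, _, hDT, o3o, osc * oT * oj, ?_, ?_, o4⟩
      · rw [mul_assoc]; exact (msc' _ (Subgroup.mul_mem _ mT mj)).1
      · rw [mul_assoc]; exact (msc' _ (Subgroup.mul_mem _ mT mj)).2
    · intro g hg
      have mc := msc' _ (Subgroup.mul_mem _ mD mD)
      rw [← mul_assoc] at mc
      rcases dic_inv o1 o7 o8 hg with h | h
      · exact ⟨_, Subgroup.mul_mem _ mc.1 mj.1, by rw [det_mul_GL, mc.2, oj_det, mul_one], h⟩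
      · exact ⟨_, mc.1, mc.2, h⟩

set_option maxHeartbeats 400000 in
theorem tau_E6 : AllTau (kQuad khE6) := by
  obtain ⟨a, ha⟩ : ∃ a : ℂ, a ^ 2 = 108 ^ 3 := IsAlgClosed.exists_pow_nat_eq _ (by norm_num)
  obtain ⟨X, hX⟩ : ∃ X : P2, X = cc a * pC := ⟨_, rfl⟩
  obtain ⟨Y, hY⟩ : ∃ Y : P2, Y = cc (-108) * pW := ⟨_, rfl⟩
  obtain ⟨Z, hZ⟩ : ∃ Z : P2, Z = cc 108 * pT := ⟨_, rfl⟩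
  have mem : ∀ γ : GL (Fin 2) ℂ, lin γ pT = pT → lin γ pW = pW →
      lin γ pC = cc (γ.1.det) * pC → γ ∈ KGrp X Y Z := by
    intro γ h1 h3 h4
    rw [mem_KGrp, hX, hY, hZ]
    simp only [map_mul, map_pow, lin_cc, h1, h3, h4, Algebra.smul_def, true_and]
    ring
  have D1 := lin_oD.1
  have D2 := lin_oD.2.1
  have D3 := lin_oD.2.2
  have T1 := lin_oT.1
  have T2 := lin_oT.2.1
  have T3 := lin_oT.2.2
  have S1 := lin_osc.1
  have S2 := lin_osc.2.1
  have S3 := lin_osc.2.2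
  have mDD : oD * oD ∈ SG (KGrp X Y Z) := by
    have hd : (oD * oD).1.det = 1 := by rw [det_mul_GL, oD_det, one_mul]
    refine ⟨mem _ ?_ ?_ ?_, hd⟩
    · simp only [lin_mul, D1, map_neg, neg_neg]
    · simp only [lin_mul, D2]
    · rw [hd, cc_one, one_mul]; simp only [lin_mul, D3, map_neg, neg_neg]
  have mDT : oD * oT ∈ SG (KGrp X Y Z) := by
    have hd : (oD * oT).1.det = 1 := by rw [det_mul_GL, oD_det, oT_det, one_mul]
    refine ⟨mem _ ?_ ?_ ?_, hd⟩
    · simp only [lin_mul, D1, T1, map_neg, neg_neg]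
    · simp only [lin_mul, D2, T2]
    · rw [hd, cc_one, one_mul]; simp only [lin_mul, D3, T3, map_neg, neg_neg]
  have mj : oj ∈ SG (KGrp X Y Z) := ⟨mem _ lin_oj.1 lin_oj.2.1
    (by rw [lin_oj.2.2, oj_det, cc_one, one_mul]), oj_det⟩
  have mS : ∀ g, lin g pT = - pT → lin g pW = pW → lin g pC = - pC → g.1.det = 1 →
      osc * g ∈ KGrp X Y Z ∧ (osc * g).1.det = -1 := by
    intro g h1 h2 h3 h4
    have hd : (osc * g).1.det = -1 := by rw [det_mul_GL, osc_det, h4, mul_one]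
    refine ⟨mem _ ?_ ?_ ?_, hd⟩
    · rw [lin_mul, h1, map_neg, S1, neg_neg]
    · rw [lin_mul, h2, S2]
    · rw [hd, lin_mul, h3, map_neg, S3, cc_neg, cc_one]; ring
  have mSD := mS _ D1 D2 D3 oD_det
  have mST := mS _ T1 T2 T3 oT_det
  have mSx := mS (oD * oT * oD * oD * oD) (by simp only [lin_mul, D1, T1, map_neg, neg_neg])
    (by simp only [lin_mul, D2, T2]) (by simp only [lin_mul, D3, T3, map_neg, neg_neg])
    (by simp only [det_mul_GL, oD_det, oT_det, mul_one])
  have ha' : cc a ^ 2 = 108 ^ 3 := by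
    rw [← cc_pow, ha, cc_pow]; exact congrArg (· ^ 3) (map_ofNat _ 108)
  have h108 : cc 108 = 108 := map_ofNat _ 108
  have h108' : cc (-108) = -108 := by rw [cc_neg, h108]
  refine allTau_P2 khE6 (X := X) (Y := Y) (Z := Z) (by simp [hY, fW]) (by simp [hZ, fT]) sqf_E6 ?_
    (N := 48) ?_ ?_
  · simp only [map_add, map_pow, map_mul, sb_X0, sb_X1]
    rw [hX, hY, hZ, h108, h108']
    have := syz_O (uu : P2) vv
    linear_combination pC ^ 2 * ha' + 108 ^ 3 * this
  · refine spans_TW.swap.of ⟨cc (-108)⁻¹, 0, ?_⟩ ⟨0, cc 108⁻¹, ?_⟩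
    · rw [hY]
      linear_combination pW * cc_unit (show (-108 : ℂ) ≠ 0 by norm_num)
    · rw [hZ]
      linear_combination pT * cc_unit (show (108 : ℂ) ≠ 0 by norm_num)
  · intro hfin hcard hdet
    have hne : (oD * oD) ^ 2 ≠ 1 := by
      intro h; apply o5
      rw [← h, ← sq, ← pow_mul]
    have h4 : (oD * oD) ^ 4 = 1 := by rw [← o6, ← sq, ← pow_mul]
    have oD4 : orderOf (oD * oD) = 4 := orderOf_eq_prime_pow (p := 2) (n := 1) hne h4
    have o3o : orderOf (oD * oT) = 3 := by
      haveI : Fact (Nat.Prime 3) := ⟨Nat.prime_three⟩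
      exact orderOf_eq_prime o3 o3'
    have hjj : (oD * oD) ^ 2 = oj ^ 2 := by rw [sq oj, o2, ← sq, ← pow_mul]
    have hz : oj * oj ∈ Subgroup.zpowers (oD * oD) := by
      rw [← sq oj, ← hjj]; exact Subgroup.npow_mem_zpowers _ _
    have hHc : Nat.card (dic (oD * oD) oj o12 hz) = 2 ^ 3 := by
      rw [card_dic (not_mem_zp o12 hne), oD4]; norm_num
    have hHle : dic (oD * oD) oj o12 hz ≤ SG (KGrp X Y Z) := dic_le mDD mj
    have d1 : 8 ∣ Nat.card (SG (KGrp X Y Z)) := by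
      have := Subgroup.card_dvd_of_le hHle
      rwa [hHc] at this
    have d2 : 3 ∣ Nat.card (SG (KGrp X Y Z)) := by
      rw [← o3o, ← Nat.card_zpowers]
      exact Subgroup.card_dvd_of_le ((Subgroup.zpowers_le).mpr mDT)
    refine E_fin hcard hdet ⟨_, mSD.1, mSD.2⟩ (n := 24) rfl (by omega) (fun hc => ?_)
    refine E_main ?_ hHle hHc (by rw [hc]; decide) ?_
    · intro p hp h2 hpd
      rw [hc] at hpd ⊢
      obtain rfl := prime_odd_dvd_48 hp h2 (hpd.trans (by decide))
      refine ⟨by decide, _, mDT, o3o, osc * oT * oj, Subgroup.mul_mem _ mST.1 mj.1, ?_, o4⟩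
      rw [det_mul_GL, mST.2, oj_det, mul_one]
    · have iD : IInv (KGrp X Y Z) (oD * oD) := ⟨_, Subgroup.mul_mem _ mSD.1 mj.1, by
        rw [det_mul_GL, mSD.2, oj_det, mul_one], o9⟩
      have ij : IInv (KGrp X Y Z) oj := ⟨_, mST.1, mST.2, o10⟩
      have iDj : IInv (KGrp X Y Z) (oD * oD * oj) :=
        ⟨osc * (oD * oT * oD * oD * oD), mSx.1, mSx.2, by simpa only [mul_assoc] using o11⟩
      rintro g (hg | hg)
      · exact iD.zpow hg
      · obtain ⟨i, hi⟩ := Subgroup.mem_zpowers_iff.mp hg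
        have hgi : g = (oD * oD) ^ i * oj := by rw [hi]; group
        rcases Int.even_or_odd' i with ⟨l, hl | hl⟩
        · apply ij.zpow
          refine Subgroup.mem_zpowers_iff.mpr ⟨2 * l + 1, ?_⟩
          rw [hgi, hl, zpow_add, zpow_one, zpow_mul, zpow_mul]
          congr 2
          exact_mod_cast hjj.symm
        · apply iDj.zpow
          refine Subgroup.mem_zpowers_iff.mpr ⟨2 * l + 1, ?_⟩
          rw [hgi, hl, zpow_add, zpow_add, zpow_one, zpow_one, zpow_mul, zpow_mul]
          have : (oD * oD * oj) ^ (2 : ℤ) = (oD * oD) ^ (2 : ℤ) := by exact_mod_cast o13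
          rw [this]; group

end Klein

namespace Klein

/-- icosahedral forms -/
def fF {A : Type*} [CommRing A] (u v : A) : A := u * v * ((u ^ 5) ^ 2 + 11 * (u ^ 5 * v ^ 5) - (v ^ 5) ^ 2)
def fH {A : Type*} [CommRing A] (u v : A) : A :=
  -((u ^ 5) ^ 4 + (v ^ 5) ^ 4) + 228 * ((u ^ 5) ^ 3 * v ^ 5 - u ^ 5 * (v ^ 5) ^ 3)
    - 494 * ((u ^ 5) ^ 2 * (v ^ 5) ^ 2)
def fI {A : Type*} [CommRing A] (u v : A) : A :=
  (u ^ 5) ^ 6 + (v ^ 5) ^ 6 + 522 * ((u ^ 5) ^ 5 * v ^ 5 - u ^ 5 * (v ^ 5) ^ 5)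
    - 10005 * ((u ^ 5) ^ 4 * (v ^ 5) ^ 2 + (u ^ 5) ^ 2 * (v ^ 5) ^ 4)

lemma syz_I {A : Type*} [CommRing A] (u v : A) : fI u v ^ 2 + fH u v ^ 3 = 1728 * fF u v ^ 5 := by
  have h : (u * v) ^ 5 = u ^ 5 * v ^ 5 := by ring
  unfold fI fH fF
  rw [mul_pow (u * v), h]
  generalize u ^ 5 = a
  generalize v ^ 5 = b
  ring

lemma lin_fF (γ) : lin γ (fF uu vv) = fF (lin γ uu) (lin γ vv) := by
  simp only [fF, map_mul, map_add, map_sub, map_pow, map_ofNat]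
lemma lin_fH (γ) : lin γ (fH uu vv) = fH (lin γ uu) (lin γ vv) := by
  simp only [fH, map_mul, map_add, map_sub, map_neg, map_pow, map_ofNat]
lemma lin_fI (γ) : lin γ (fI uu vv) = fI (lin γ uu) (lin γ vv) := by
  simp only [fI, map_mul, map_add, map_sub, map_pow, map_ofNat]

section
variable {A : Type*} [CommRing A]

lemma i_D (w u v : A) (hw : w ^ 5 = 1) :
    fF (w * u + 0 * v) (0 * u + w ^ 4 * v) = fF u v ∧ fH (w * u + 0 * v) (0 * u + w ^ 4 * v) = fH u v ∧
      fI (w * u + 0 * v) (0 * u + w ^ 4 * v) = fI u v := by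
  have h1 : (w * u + 0 * v) * (0 * u + w ^ 4 * v) = u * v := by linear_combination u * v * hw
  have h2 : (w * u + 0 * v) ^ 5 = u ^ 5 := by linear_combination u ^ 5 * hw
  have h3 : (0 * u + w ^ 4 * v) ^ 5 = v ^ 5 := by
    linear_combination (w ^ 15 + w ^ 10 + w ^ 5 + 1) * v ^ 5 * hw
  unfold fF fH fI
  rw [h1, h2, h3]
  exact ⟨rfl, rfl, rfl⟩

lemma i_sc (i u v : A) (hi : i ^ 2 = -1) :
    fF (i * u + 0 * v) (0 * u + i * v) = fF u v ∧ fH (i * u + 0 * v) (0 * u + i * v) = fH u v ∧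
      fI (i * u + 0 * v) (0 * u + i * v) = - fI u v := by
  have h1 : (i * u + 0 * v) * (0 * u + i * v) = - (u * v) := by linear_combination u * v * hi
  have h2 : (i * u + 0 * v) ^ 5 = i * u ^ 5 := by linear_combination u ^ 5 * i * (i ^ 2 - 1) * hi
  have h3 : (0 * u + i * v) ^ 5 = i * v ^ 5 := by linear_combination v ^ 5 * i * (i ^ 2 - 1) * hi
  have i4 : i ^ 4 = 1 := by linear_combination (i ^ 2 - 1) * hi
  have i6 : i ^ 6 = -1 := by linear_combination (i ^ 4 - i ^ 2 + 1) * hi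
  unfold fF fH fI
  rw [h1, h2, h3]
  generalize u ^ 5 = a
  generalize v ^ 5 = b
  refine ⟨?_, ?_, ?_⟩
  · linear_combination - (u * v) * (a ^ 2 + 11 * (a * b) - b ^ 2) * hi
  · linear_combination (-(a ^ 4 + b ^ 4) + 228 * (a ^ 3 * b - a * b ^ 3) - 494 * (a ^ 2 * b ^ 2)) * i4
  · linear_combination (a ^ 6 + b ^ 6 + 522 * (a ^ 5 * b - a * b ^ 5)
      - 10005 * (a ^ 4 * b ^ 2 + a ^ 2 * b ^ 4)) * i6

lemma i_j (u v : A) :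
    fF (0 * u + 1 * v) (- 1 * u + 0 * v) = fF u v ∧ fH (0 * u + 1 * v) (- 1 * u + 0 * v) = fH u v ∧
      fI (0 * u + 1 * v) (- 1 * u + 0 * v) = fI u v := by
  unfold fF fH fI
  refine ⟨?_, ?_, ?_⟩ <;> ring

lemma mulr {r x y x0 x1 y0 y1 : A} (hr : r ^ 2 = r + 1) (hx : x = x0 + x1 * r) (hy : y = y0 + y1 * r) :
    x * y = (x0 * y0 + x1 * y1) + (x0 * y1 + x1 * y0 + x1 * y1) * r := by
  rw [hx, hy]; linear_combination x1 * y1 * hr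

lemma p_red {r : A} (hr : r ^ 2 = r + 1) (u v : A) : (u + r * v) ^ 5 =
    (u ^ 5 + 10 * u ^ 3 * v ^ 2 + 10 * u ^ 2 * v ^ 3 + 10 * u * v ^ 4 + 3 * v ^ 5) +
    (5 * u ^ 4 * v + 10 * u ^ 3 * v ^ 2 + 20 * u ^ 2 * v ^ 3 + 15 * u * v ^ 4 + 5 * v ^ 5) * r := by
  have h3 : r ^ 3 = 2 * r + 1 := by linear_combination (r + 1) * hr
  have h4 : r ^ 4 = 3 * r + 2 := by linear_combination (r ^ 2 + r + 2) * hr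
  have h5 : r ^ 5 = 5 * r + 3 := by linear_combination (r ^ 3 + r ^ 2 + 2 * r + 3) * hr
  linear_combination 10 * u ^ 3 * v ^ 2 * hr + 10 * u ^ 2 * v ^ 3 * h3 + 5 * u * v ^ 4 * h4 + v ^ 5 * h5

lemma q_red {r : A} (hr : r ^ 2 = r + 1) (u v : A) : (r * u - v) ^ 5 =
    (3 * u ^ 5 - 10 * u ^ 4 * v + 10 * u ^ 3 * v ^ 2 - 10 * u ^ 2 * v ^ 3 - v ^ 5) +
    (5 * u ^ 5 - 15 * u ^ 4 * v + 20 * u ^ 3 * v ^ 2 - 10 * u ^ 2 * v ^ 3 + 5 * u * v ^ 4) * r := by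
  have h3 : r ^ 3 = 2 * r + 1 := by linear_combination (r + 1) * hr
  have h4 : r ^ 4 = 3 * r + 2 := by linear_combination (r ^ 2 + r + 2) * hr
  have h5 : r ^ 5 = 5 * r + 3 := by linear_combination (r ^ 3 + r ^ 2 + 2 * r + 3) * hr
  linear_combination - 10 * u ^ 2 * v ^ 3 * hr + 10 * u ^ 3 * v ^ 2 * h3 - 5 * u ^ 4 * v * h4 + u ^ 5 * h5

set_option maxHeartbeats 1000000 in
lemma fF_T {r : A} (hr : r ^ 2 = r + 1) (u v : A) :
    fF (u + r * v) (r * u - v) = 125 * (8 * r + 5) * fF u v := by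
  have hl : (u + r * v) * (r * u - v) = (u ^ 2 + u * v - v ^ 2) * r := by
    linear_combination u * v * hr
  have hp := p_red hr u v
  have hq := q_red hr u v
  obtain ⟨p, hp'⟩ : ∃ x, x = (u + r * v) ^ 5 := ⟨_, rfl⟩
  obtain ⟨q, hq'⟩ : ∃ x, x = (r * u - v) ^ 5 := ⟨_, rfl⟩
  obtain ⟨p0, hp0⟩ : ∃ x, x = u ^ 5 + 10 * u ^ 3 * v ^ 2 + 10 * u ^ 2 * v ^ 3 + 10 * u * v ^ 4 + 3 * v ^ 5 :=
    ⟨_, rfl⟩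
  obtain ⟨p1, hp1⟩ : ∃ x, x = 5 * u ^ 4 * v + 10 * u ^ 3 * v ^ 2 + 20 * u ^ 2 * v ^ 3 + 15 * u * v ^ 4
    + 5 * v ^ 5 := ⟨_, rfl⟩
  obtain ⟨q0, hq0⟩ : ∃ x, x = 3 * u ^ 5 - 10 * u ^ 4 * v + 10 * u ^ 3 * v ^ 2 - 10 * u ^ 2 * v ^ 3 - v ^ 5 :=
    ⟨_, rfl⟩
  obtain ⟨q1, hq1⟩ : ∃ x, x = 5 * u ^ 5 - 15 * u ^ 4 * v + 20 * u ^ 3 * v ^ 2 - 10 * u ^ 2 * v ^ 3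
    + 5 * u * v ^ 4 := ⟨_, rfl⟩
  rw [← hp0, ← hp1, ← hp'] at hp
  rw [← hq0, ← hq1, ← hq'] at hq
  have e1 : (u ^ 2 + u * v - v ^ 2) * ((2 * p0 * p1 + 11 * (p0 * q1 + p1 * q0) - 2 * q0 * q1)
      + (p1 ^ 2 + 11 * p1 * q1 - q1 ^ 2)) = 625 * fF u v := by
    rw [hp0, hp1, hq0, hq1]; unfold fF; ring
  have e2 : (u ^ 2 + u * v - v ^ 2) * ((p0 ^ 2 + 11 * p0 * q0 - q0 ^ 2)
      + (2 * p0 * p1 + 11 * (p0 * q1 + p1 * q0) - 2 * q0 * q1)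
      + 2 * (p1 ^ 2 + 11 * p1 * q1 - q1 ^ 2)) = 1000 * fF u v := by
    rw [hp0, hp1, hq0, hq1]; unfold fF; ring
  have e : fF (u + r * v) (r * u - v) = (u ^ 2 + u * v - v ^ 2) * r * (p ^ 2 + 11 * (p * q) - q ^ 2) := by
    rw [fF, hl, ← hp', ← hq']
  rw [e, hp, hq]
  generalize u ^ 2 + u * v - v ^ 2 = l at *
  linear_combination e1 + r * e2 + (l * (2 * p0 * p1 + 11 * (p0 * q1 + p1 * q0) - 2 * q0 * q1)
    + l * (r + 1) * (p1 ^ 2 + 11 * p1 * q1 - q1 ^ 2)) * hr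

set_option maxHeartbeats 1000000 in
lemma fH_T {r : A} (hr : r ^ 2 = r + 1) (u v : A) :
    fH (u + r * v) (r * u - v) = 3125 * (55 * r + 34) * fH u v := by
  have hp := p_red hr u v
  have hq := q_red hr u v
  obtain ⟨p, hp'⟩ : ∃ x, x = (u + r * v) ^ 5 := ⟨_, rfl⟩
  obtain ⟨q, hq'⟩ : ∃ x, x = (r * u - v) ^ 5 := ⟨_, rfl⟩
  obtain ⟨p0, hp0⟩ : ∃ x, x = u ^ 5 + 10 * u ^ 3 * v ^ 2 + 10 * u ^ 2 * v ^ 3 + 10 * u * v ^ 4 + 3 * v ^ 5 :=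
    ⟨_, rfl⟩
  obtain ⟨p1, hp1⟩ : ∃ x, x = 5 * u ^ 4 * v + 10 * u ^ 3 * v ^ 2 + 20 * u ^ 2 * v ^ 3 + 15 * u * v ^ 4
    + 5 * v ^ 5 := ⟨_, rfl⟩
  obtain ⟨q0, hq0⟩ : ∃ x, x = 3 * u ^ 5 - 10 * u ^ 4 * v + 10 * u ^ 3 * v ^ 2 - 10 * u ^ 2 * v ^ 3 - v ^ 5 :=
    ⟨_, rfl⟩
  obtain ⟨q1, hq1⟩ : ∃ x, x = 5 * u ^ 5 - 15 * u ^ 4 * v + 20 * u ^ 3 * v ^ 2 - 10 * u ^ 2 * v ^ 3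
    + 5 * u * v ^ 4 := ⟨_, rfl⟩
  rw [← hp0, ← hp1, ← hp'] at hp
  rw [← hq0, ← hq1, ← hq'] at hq
  have hpp := mulr hr hp hp
  have hqq := mulr hr hq hq
  have hpq := mulr hr hp hq
  obtain ⟨a0, ha0⟩ : ∃ x, x = p0 * p0 + p1 * p1 := ⟨_, rfl⟩
  obtain ⟨a1, ha1⟩ : ∃ x, x = p0 * p1 + p1 * p0 + p1 * p1 := ⟨_, rfl⟩
  obtain ⟨b0, hb0⟩ : ∃ x, x = q0 * q0 + q1 * q1 := ⟨_, rfl⟩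
  obtain ⟨b1, hb1⟩ : ∃ x, x = q0 * q1 + q1 * q0 + q1 * q1 := ⟨_, rfl⟩
  obtain ⟨m0, hm0⟩ : ∃ x, x = p0 * q0 + p1 * q1 := ⟨_, rfl⟩
  obtain ⟨m1, hm1⟩ : ∃ x, x = p0 * q1 + p1 * q0 + p1 * q1 := ⟨_, rfl⟩
  rw [← ha0, ← ha1] at hpp
  rw [← hb0, ← hb1] at hqq
  rw [← hm0, ← hm1] at hpq
  obtain ⟨B, hB⟩ : ∃ x, x = -a1 ^ 2 - b1 ^ 2 + 228 * m1 * (a1 - b1) - 494 * m1 ^ 2 := ⟨_, rfl⟩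
  have e0 : (-a0 ^ 2 - b0 ^ 2 + 228 * m0 * (a0 - b0) - 494 * m0 ^ 2) + B = 106250 * fH u v := by
    rw [hB, ha0, ha1, hb0, hb1, hm0, hm1, hp0, hp1, hq0, hq1]; unfold fH; ring
  have e1 : (-2 * a0 * a1 - 2 * b0 * b1 + 228 * (m0 * (a1 - b1) + m1 * (a0 - b0)) - 988 * m0 * m1) + B
      = 171875 * fH u v := by
    rw [hB, ha0, ha1, hb0, hb1, hm0, hm1, hp0, hp1, hq0, hq1]; unfold fH; ring
  have e : fH (u + r * v) (r * u - v) = -(p * p) ^ 2 - (q * q) ^ 2 + 228 * (p * q) * (p * p - q * q)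
      - 494 * (p * q) ^ 2 := by
    rw [fH, ← hp', ← hq']; ring
  rw [e, hpp, hqq, hpq]
  rw [hB] at e0 e1
  linear_combination e0 + r * e1 + (-a1 ^ 2 - b1 ^ 2 + 228 * m1 * (a1 - b1) - 494 * m1 ^ 2) * hr

set_option maxHeartbeats 4000000 in
lemma fI_T {r : A} (hr : r ^ 2 = r + 1) (u v : A) :
    fI (u + r * v) (r * u - v) = -78125 * (1364 * r + 843) * fI u v := by
  have hp := p_red hr u v
  have hq := q_red hr u v
  obtain ⟨p, hp'⟩ : ∃ x, x = (u + r * v) ^ 5 := ⟨_, rfl⟩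
  obtain ⟨q, hq'⟩ : ∃ x, x = (r * u - v) ^ 5 := ⟨_, rfl⟩
  obtain ⟨p0, hp0⟩ : ∃ x, x = u ^ 5 + 10 * u ^ 3 * v ^ 2 + 10 * u ^ 2 * v ^ 3 + 10 * u * v ^ 4 + 3 * v ^ 5 :=
    ⟨_, rfl⟩
  obtain ⟨p1, hp1⟩ : ∃ x, x = 5 * u ^ 4 * v + 10 * u ^ 3 * v ^ 2 + 20 * u ^ 2 * v ^ 3 + 15 * u * v ^ 4
    + 5 * v ^ 5 := ⟨_, rfl⟩
  obtain ⟨q0, hq0⟩ : ∃ x, x = 3 * u ^ 5 - 10 * u ^ 4 * v + 10 * u ^ 3 * v ^ 2 - 10 * u ^ 2 * v ^ 3 - v ^ 5 :=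
    ⟨_, rfl⟩
  obtain ⟨q1, hq1⟩ : ∃ x, x = 5 * u ^ 5 - 15 * u ^ 4 * v + 20 * u ^ 3 * v ^ 2 - 10 * u ^ 2 * v ^ 3
    + 5 * u * v ^ 4 := ⟨_, rfl⟩
  rw [← hp0, ← hp1, ← hp'] at hp
  rw [← hq0, ← hq1, ← hq'] at hq
  have hpp := mulr hr hp hp
  have hqq := mulr hr hq hq
  have hpq := mulr hr hp hq
  obtain ⟨a0, ha0⟩ : ∃ x, x = p0 * p0 + p1 * p1 := ⟨_, rfl⟩
  obtain ⟨a1, ha1⟩ : ∃ x, x = p0 * p1 + p1 * p0 + p1 * p1 := ⟨_, rfl⟩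
  obtain ⟨b0, hb0⟩ : ∃ x, x = q0 * q0 + q1 * q1 := ⟨_, rfl⟩
  obtain ⟨b1, hb1⟩ : ∃ x, x = q0 * q1 + q1 * q0 + q1 * q1 := ⟨_, rfl⟩
  obtain ⟨m0, hm0⟩ : ∃ x, x = p0 * q0 + p1 * q1 := ⟨_, rfl⟩
  obtain ⟨m1, hm1⟩ : ∃ x, x = p0 * q1 + p1 * q0 + p1 * q1 := ⟨_, rfl⟩
  rw [← ha0, ← ha1] at hpp
  rw [← hb0, ← hb1] at hqq
  rw [← hm0, ← hm1] at hpq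
  obtain ⟨B, hB⟩ : ∃ x, x = a1 ^ 2 + b1 ^ 2 + 522 * m1 * (a1 - b1) - 10006 * m1 ^ 2 := ⟨_, rfl⟩
  obtain ⟨d0, hd0⟩ : ∃ x, x = (a0 ^ 2 + b0 ^ 2 + 522 * m0 * (a0 - b0) - 10006 * m0 ^ 2) + B := ⟨_, rfl⟩
  obtain ⟨d1, hd1⟩ : ∃ x, x = (2 * a0 * a1 + 2 * b0 * b1 + 522 * (m0 * (a1 - b1) + m1 * (a0 - b0))
    - 20012 * m0 * m1) + B := ⟨_, rfl⟩
  have e0 : (a0 + b0) * d0 + (a1 + b1) * d1 = -65859375 * fI u v := by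
    rw [hd0, hd1, hB, ha0, ha1, hb0, hb1, hm0, hm1, hp0, hp1, hq0, hq1]; unfold fI; ring
  have e1 : (a0 + b0) * d1 + (a1 + b1) * d0 + (a1 + b1) * d1 = -106562500 * fI u v := by
    rw [hd0, hd1, hB, ha0, ha1, hb0, hb1, hm0, hm1, hp0, hp1, hq0, hq1]; unfold fI; ring
  have e : fI (u + r * v) (r * u - v) = (p * p + q * q) *
      ((p * p) ^ 2 + (q * q) ^ 2 + 522 * (p * q) * (p * p - q * q) - 10006 * (p * q) ^ 2) := by
    rw [fI, ← hp', ← hq']; ring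
  have h1 : p * p + q * q = (a0 + b0) + (a1 + b1) * r := by rw [hpp, hqq]; ring
  have h2 : (p * p) ^ 2 + (q * q) ^ 2 + 522 * (p * q) * (p * p - q * q) - 10006 * (p * q) ^ 2
      = d0 + d1 * r := by
    rw [hpp, hqq, hpq, hd0, hd1, hB]
    linear_combination (a1 ^ 2 + b1 ^ 2 + 522 * m1 * (a1 - b1) - 10006 * m1 ^ 2) * hr
  rw [e, mulr hr h1 h2, e0, e1]
  ring

lemma i_T (c r u v : A) (hr : r ^ 2 = r + 1) (hc : c ^ 2 * (r + 2) = -1) :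
    fF (c * u + c * r * v) (c * r * u + - c * v) = fF u v ∧
    fH (c * u + c * r * v) (c * r * u + - c * v) = fH u v ∧
    fI (c * u + c * r * v) (c * r * u + - c * v) = fI u v := by
  have h1 : c * u + c * r * v = c * (u + r * v) := by ring
  have h2 : c * r * u + - c * v = c * (r * u - v) := by ring
  have k4 : c ^ 4 * (5 * r + 5) = 1 := by
    linear_combination (c ^ 2 * (r + 2) - 1) * hc - c ^ 4 * hr
  have k12 : c ^ 12 * (125 * (8 * r + 5)) = 1 := by
    have : (c ^ 4 * (5 * r + 5)) ^ 3 = 1 := by rw [k4, one_pow]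
    linear_combination this - c ^ 12 * 125 * (r + 4) * hr
  have k20 : c ^ 20 * (3125 * (55 * r + 34)) = 1 := by
    have : (c ^ 4 * (5 * r + 5)) ^ 2 = 1 := by rw [k4, one_pow]
    have : c ^ 8 * (25 * (3 * r + 2)) = 1 := by
      linear_combination this - c ^ 8 * 25 * hr
    have hm : (c ^ 8 * (25 * (3 * r + 2))) * (c ^ 12 * (125 * (8 * r + 5))) = 1 := by
      rw [this, k12, one_mul]
    linear_combination hm - c ^ 20 * 3125 * 24 * hr
  have k10 : c ^ 10 * (25 * (3 * r + 2)) * (r + 2) = -1 := by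
    have : (c ^ 4 * (5 * r + 5)) ^ 2 = 1 := by rw [k4, one_pow]
    have : c ^ 8 * (25 * (3 * r + 2)) = 1 := by
      linear_combination this - c ^ 8 * 25 * hr
    have hm : (c ^ 8 * (25 * (3 * r + 2))) * (c ^ 2 * (r + 2)) = -1 := by
      rw [this, hc, one_mul]
    linear_combination hm
  have k10' : c ^ 10 * (25 * (11 * r + 7)) = -1 := by
    linear_combination k10 - c ^ 10 * 25 * 3 * hr
  have k30 : c ^ 30 * (-78125 * (1364 * r + 843)) = 1 := by
    have hm : (c ^ 10 * (25 * (11 * r + 7))) * (c ^ 20 * (3125 * (55 * r + 34))) = -1 := by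
      rw [k10', k20, mul_one]
    linear_combination - hm + c ^ 30 * 78125 * 605 * hr
  rw [h1, h2]
  refine ⟨?_, ?_, ?_⟩
  · have : fF (c * (u + r * v)) (c * (r * u - v)) = c ^ 12 * fF (u + r * v) (r * u - v) := by
      unfold fF; ring
    rw [this, fF_T hr]
    linear_combination fF u v * k12
  · have : fH (c * (u + r * v)) (c * (r * u - v)) = c ^ 20 * fH (u + r * v) (r * u - v) := by
      unfold fH; rw [mul_pow c (u + r * v), mul_pow c (r * u - v)]; ring
    rw [this, fH_T hr]
    linear_combination fH u v * k20
  · have : fI (c * (u + r * v)) (c * (r * u - v)) = c ^ 30 * fI (u + r * v) (r * u - v) := by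
      unfold fI; rw [mul_pow c (u + r * v), mul_pow c (r * u - v)]
      generalize (u + r * v) ^ 5 = p
      generalize (r * u - v) ^ 5 = q
      ring
    rw [this, fI_T hr]
    linear_combination fI u v * k30

end

end Klein

namespace Klein

lemma exists_w5 : ∃ w : ℂ, w ^ 4 + w ^ 3 + w ^ 2 + w + 1 = 0 := by
  have hp : IsPrimitiveRoot (Complex.exp (2 * Real.pi * Complex.I / (5 : ℕ))) 5 :=
    Complex.isPrimitiveRoot_exp 5 (by norm_num)
  have h := hp.geom_sum_eq_zero (by norm_num)
  simp only [Finset.sum_range_succ, Finset.sum_range_zero] at h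
  refine ⟨Complex.exp (2 * Real.pi * Complex.I / (5 : ℕ)), ?_⟩
  linear_combination h

/-- a primitive fifth root of unity -/
def w5 : ℂ := exists_w5.choose
lemma w5_4 : w5 ^ 4 + w5 ^ 3 + w5 ^ 2 + w5 + 1 = 0 := exists_w5.choose_spec
lemma w5_5 : w5 ^ 5 = 1 := by linear_combination (w5 - 1) * w5_4

def r5 : ℂ := -(w5 ^ 2 + w5 ^ 3)
lemma r5_2 : r5 ^ 2 = r5 + 1 := by
  have := w5_4
  unfold r5; grind

def c5 : ℂ := (w5 - w5 ^ 4) * (3 - r5) / 5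
lemma c5_2 : c5 ^ 2 * (r5 + 2) = -1 := by
  have := w5_4
  unfold c5 r5; grind

lemma w5_ne : w5 ≠ 1 := by
  intro h
  have := w5_4
  rw [h] at this
  norm_num at this

lemma c5_w5 : c5 * w5 - c5 * w5 ^ 4 = -1 := by
  have := w5_4
  unfold c5 r5; grind

def eD : GL (Fin 2) ℂ := mkGL w5 0 0 (w5 ^ 4) (by
  have : w5 * (w5 ^ 4) - 0 * 0 = 1 := by linear_combination w5_5
  rw [this]; exact one_ne_zero)

def eT : GL (Fin 2) ℂ := mkGL c5 (c5 * r5) (c5 * r5) (-c5) (by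
  have : c5 * (- c5) - c5 * r5 * (c5 * r5) = 1 := by linear_combination -c5_2 - c5 ^ 2 * r5_2
  rw [this]; norm_num)

lemma eD_val : eD.1 = !![w5, 0; 0, w5 ^ 4] := rfl
lemma eT_val : eT.1 = !![c5, c5 * r5; c5 * r5, -c5] := rfl
lemma eD_det : eD.1.det = 1 := by rw [eD_val, Matrix.det_fin_two_of]; linear_combination w5_5
lemma eT_det : eT.1.det = 1 := by
  rw [eT_val, Matrix.det_fin_two_of]; linear_combination -c5_2 - c5 ^ 2 * r5_2

abbrev pF : P2 := fF uu vv
abbrev pH : P2 := fH uu vv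
abbrev pI : P2 := fI uu vv

lemma lin_eD : lin eD pF = pF ∧ lin eD pH = pH ∧ lin eD pI = pI := by
  rw [lin_fF, lin_fH, lin_fI, eD, lin_u, lin_v, cc_zero, cc_pow]
  exact i_D _ _ _ (by rw [← map_pow, w5_5, map_one])

lemma lin_osc' : lin osc pF = pF ∧ lin osc pH = pH ∧ lin osc pI = - pI := by
  rw [lin_fF, lin_fH, lin_fI, osc, lin_u, lin_v, cc_zero]
  exact i_sc _ _ _ (by
    rw [← map_pow, ← pow_mul, show 2 * 2 = 4 from rfl, z8_4, map_neg, map_one])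

lemma lin_oj' : lin oj pF = pF ∧ lin oj pH = pH ∧ lin oj pI = pI := by
  rw [lin_fF, lin_fH, lin_fI, oj, lin_u, lin_v, cc_zero, cc_neg, cc_one]
  exact i_j _ _

lemma lin_eT : lin eT pF = pF ∧ lin eT pH = pH ∧ lin eT pI = pI := by
  rw [lin_fF, lin_fH, lin_fI, eT, lin_u, lin_v, cc_neg, show cc (c5 * r5) = cc c5 * cc r5 from map_mul _ _ _]
  refine i_T _ _ _ _ ?_ ?_
  · rw [← map_pow, r5_2, map_add, map_one]
  · rw [← map_pow, show (2 : P2) = cc 2 from (map_ofNat _ 2).symm, ← map_add, ← map_mul, c5_2,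
      map_neg, map_one]

/-- dimension count -/
lemma spans_FH : Spans (Ideal.span {pF, pH}) 240 := by
  have hc : cc (1/3125) * 3125 = 1 := by
    rw [show (3125 : P2) = cc 3125 from (map_ofNat _ 3125).symm, ← map_mul]; norm_num
  have h1 : Spans (Ideal.span {uu, pH}) 20 := (spans_uv 1 20).of ⟨1, 0, by ring⟩
    ⟨- uu ^ 19 + 228 * (uu ^ 14 * vv ^ 5 - uu ^ 4 * vv ^ 15) - 494 * uu ^ 9 * vv ^ 10, -1, by
      unfold pH fH; ring⟩
  have h2 : Spans (Ideal.span {vv, pH}) 20 := (spans_uv 20 1).swap.of ⟨1, 0, by ring⟩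
    ⟨- vv ^ 19 + 228 * (uu ^ 15 * vv ^ 4 - uu ^ 5 * vv ^ 14) - 494 * uu ^ 10 * vv ^ 9, -1, by
      unfold pH fH; ring⟩
  obtain ⟨P, hP⟩ : ∃ P : P2, P = (uu ^ 5) ^ 2 + 11 * (uu ^ 5 * vv ^ 5) - (vv ^ 5) ^ 2 := ⟨_, rfl⟩
  have h3 : Spans (Ideal.span {P, pH}) 200 := by
    have h4 : Spans (Ideal.span {uu, P}) 10 := (spans_uv 1 10).of ⟨1, 0, by ring⟩
      ⟨uu ^ 9 + 11 * (uu ^ 4 * vv ^ 5), -1, by rw [hP]; ring⟩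
    have h5 : Spans (Ideal.span {vv, uu ^ 5 + 11 * vv ^ 5}) 5 := (spans_uv 5 1).swap.of ⟨1, 0, by ring⟩
      ⟨- 11 * vv ^ 4, 1, by ring⟩
    have h6 : Spans (Ideal.span {uu ^ 5 + 11 * vv ^ 5, P}) 50 := (h5.pow 10).swap.of ⟨1, 0, by ring⟩
      ⟨uu ^ 5, -1, by rw [hP]; ring⟩
    refine ((h4.pow 15).mul h6).swap.of ⟨1, 0, by ring⟩
      ⟨cc (1/3125) * ((vv ^ 5) ^ 2 + 239 * uu ^ 5 * vv ^ 5 + 3124 * (uu ^ 5) ^ 2), - cc (1/3125), ?_⟩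
    rw [hP]
    unfold pH fH
    linear_combination uu ^ 15 * (uu ^ 5 + 11 * vv ^ 5) * hc
  have h7 := (h1.mul h2).mul h3
  rw [hP] at h7
  exact h7

lemma e1 : oj * eD * oj⁻¹ = eD⁻¹ := by
  rw [conj_eq_inv_iff]
  apply Units.ext
  simp only [Units.val_mul, eD_val, oj_val, Matrix.mul_fin_two]
  have := w5_5
  apply mat_ext <;> grind

lemma e2 : oj * eT * oj⁻¹ = eT⁻¹ := by
  rw [conj_eq_inv_iff]
  apply Units.ext
  simp only [Units.val_mul, eT_val, oj_val, Matrix.mul_fin_two]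
  have := c5_2
  have := r5_2
  apply mat_ext <;> grind

lemma oj_sq : oj * oj = eT ^ 2 := by
  apply Units.ext
  simp only [Units.val_mul, eT_val, oj_val, pow_succ, pow_zero, one_mul, Matrix.mul_fin_two]
  have := c5_2
  have := r5_2
  apply mat_ext <;> grind

lemma eT_sq : eT ^ 2 ≠ 1 := by
  intro h
  have h2 := congrArg (fun g : GL (Fin 2) ℂ => g.1 0 0) h
  simp only [pow_succ, pow_zero, one_mul, Units.val_mul, eT_val, Matrix.mul_fin_two,
    Units.val_one, Matrix.one_fin_two] at h2
  simp at h2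
  have := c5_2
  have := r5_2
  grind

lemma eT_four : eT ^ 4 = 1 := by
  have h : (eT ^ 2) * (eT ^ 2) = 1 := by
    rw [← oj_sq]
    apply Units.ext
    simp only [Units.val_mul, oj_val, Matrix.mul_fin_two, Units.val_one, Matrix.one_fin_two]
    apply mat_ext <;> norm_num
  rw [← pow_add] at h
  exact h

lemma eD_five : eD ^ 5 = 1 := by
  apply Units.ext
  simp only [pow_succ, pow_zero, one_mul, Units.val_mul, eD_val, Matrix.mul_fin_two,
      Units.val_one, Matrix.one_fin_two]
  have := w5_5
  apply mat_ext <;> grind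

lemma eD_ne : eD ≠ 1 := by
  intro h
  have h2 := congrArg (fun g : GL (Fin 2) ℂ => g.1 0 0) h
  simp only [eD_val, Units.val_one, Matrix.one_fin_two] at h2
  exact w5_ne h2

lemma e3 : (eD * eT) ^ 3 = 1 := by
  apply Units.ext
  simp only [Units.val_mul, eD_val, eT_val, pow_succ, pow_zero, one_mul, Matrix.mul_fin_two,
    Units.val_one, Matrix.one_fin_two]
  have := w5_5
  have := c5_2
  have := r5_2
  have := c5_w5
  apply mat_ext <;> grind

lemma e3' : eD * eT ≠ 1 := by
  intro h
  have h2 := congrArg (fun g : GL (Fin 2) ℂ => g.1.trace) h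
  simp only [Units.val_mul, eD_val, eT_val, Matrix.mul_fin_two,
    Units.val_one, Matrix.one_fin_two, Matrix.trace_fin_two_of] at h2
  have h3 : (-1 : ℂ) = 2 := by linear_combination h2 - c5_w5
  norm_num at h3

lemma e4 : (osc * eT * oj) * (eD * eT) * (osc * eT * oj)⁻¹ = (eD * eT)⁻¹ := by
  rw [conj_eq_inv_iff]
  apply Units.ext
  simp only [Units.val_mul, eD_val, eT_val, osc_val, oj_val, Matrix.mul_fin_two]
  have := z8_4
  have := w5_5
  have := c5_2
  have := r5_2
  have := c5_w5
  apply mat_ext <;> grind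

lemma e5 : (osc * oj) * eD * (osc * oj)⁻¹ = eD⁻¹ := by
  rw [conj_eq_inv_iff]
  apply Units.ext
  simp only [Units.val_mul, eD_val, osc_val, oj_val, Matrix.mul_fin_two]
  have := w5_5
  apply mat_ext <;> grind

lemma e7 : (osc * eT) * eT * (osc * eT)⁻¹ = eT := by
  rw [conj_eq_self_iff]
  apply Units.ext
  simp only [Units.val_mul, eT_val, osc_val, Matrix.mul_fin_two]
  apply mat_ext <;> ring

lemma e8 : (osc * eT) * oj * (osc * eT)⁻¹ = oj⁻¹ := by
  rw [conj_eq_inv_iff]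
  apply Units.ext
  simp only [Units.val_mul, eT_val, oj_val, osc_val, Matrix.mul_fin_two]
  apply mat_ext <;> ring

lemma prime_odd_dvd_120 {p : ℕ} (hp : p.Prime) (h2 : p ≠ 2) (h : p ∣ 120) : p = 3 ∨ p = 5 := by
  have : p ∣ 2 ^ 3 * (3 * 5) := h
  rcases (hp.dvd_mul).mp this with h | h
  · exact absurd ((Nat.prime_dvd_prime_iff_eq hp Nat.prime_two).mp (hp.dvd_of_dvd_pow h)) h2
  rcases (hp.dvd_mul).mp h with h | h
  · exact Or.inl ((Nat.prime_dvd_prime_iff_eq hp Nat.prime_three).mp h)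
  · exact Or.inr ((Nat.prime_dvd_prime_iff_eq hp Nat.prime_five).mp h)

set_option maxHeartbeats 400000 in
theorem tau_E8 : AllTau (kQuad khE8) := by
  obtain ⟨X, hX⟩ : ∃ X : P2, X = cc 2985984 * pI := ⟨_, rfl⟩
  obtain ⟨Y, hY⟩ : ∃ Y : P2, Y = cc 20736 * pH := ⟨_, rfl⟩
  obtain ⟨Z, hZ⟩ : ∃ Z : P2, Z = cc (-1728) * pF := ⟨_, rfl⟩
  have mem : ∀ γ : GL (Fin 2) ℂ, lin γ pF = pF → lin γ pH = pH →
      lin γ pI = cc (γ.1.det) * pI → γ ∈ KGrp X Y Z := by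
    intro γ h1 h3 h4
    rw [mem_KGrp, hX, hY, hZ]
    simp only [map_mul, lin_cc, h1, h3, h4, Algebra.smul_def, true_and]
    ring
  have mD : eD ∈ SG (KGrp X Y Z) := ⟨mem _ lin_eD.1 lin_eD.2.1
    (by rw [lin_eD.2.2, eD_det, cc_one, one_mul]), eD_det⟩
  have mT : eT ∈ SG (KGrp X Y Z) := ⟨mem _ lin_eT.1 lin_eT.2.1
    (by rw [lin_eT.2.2, eT_det, cc_one, one_mul]), eT_det⟩
  have mj : oj ∈ SG (KGrp X Y Z) := ⟨mem _ lin_oj'.1 lin_oj'.2.1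
    (by rw [lin_oj'.2.2, oj_det, cc_one, one_mul]), oj_det⟩
  have msc : osc ∈ KGrp X Y Z := mem _ lin_osc'.1 lin_osc'.2.1
    (by rw [lin_osc'.2.2, osc_det, cc_neg, cc_one]; ring)
  have msc' : ∀ g ∈ SG (KGrp X Y Z), osc * g ∈ KGrp X Y Z ∧ (osc * g).1.det = -1 := fun g hg =>
    ⟨Subgroup.mul_mem _ msc hg.1, by rw [det_mul_GL, osc_det, hg.2, mul_one]⟩
  have hc1 : cc 2985984 = 2985984 := map_ofNat _ 2985984
  have hc2 : cc 20736 = 20736 := map_ofNat _ 20736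
  have hc3 : cc (-1728) = -1728 := by rw [cc_neg]; exact congrArg Neg.neg (map_ofNat _ 1728)
  refine allTau_P2 khE8 (X := X) (Y := Y) (Z := Z) (by simp [hY, fH]) (by simp [hZ, fF]) sqf_E8 ?_
    (N := 240) ?_ ?_
  · simp only [map_add, map_pow, map_mul, sb_X0, sb_X1]
    rw [hX, hY, hZ, hc1, hc2, hc3]
    have := syz_I (uu : P2) vv
    linear_combination 2985984 ^ 2 * this
  · refine spans_FH.swap.of ⟨cc 20736⁻¹, 0, ?_⟩ ⟨0, cc (-1728)⁻¹, ?_⟩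
    · rw [hY]
      linear_combination pH * cc_unit (show (20736 : ℂ) ≠ 0 by norm_num)
    · rw [hZ]
      linear_combination pF * cc_unit (show (-1728 : ℂ) ≠ 0 by norm_num)
  · intro hfin hcard hdet
    have oT4 : orderOf eT = 4 := orderOf_eq_prime_pow (p := 2) (n := 1) eT_sq eT_four
    have o3o : orderOf (eD * eT) = 3 := by
      haveI : Fact (Nat.Prime 3) := ⟨Nat.prime_three⟩
      exact orderOf_eq_prime e3 e3'
    have o5o : orderOf eD = 5 := by
      haveI : Fact (Nat.Prime 5) := ⟨Nat.prime_five⟩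
      exact orderOf_eq_prime eD_five eD_ne
    have hz : oj * oj ∈ Subgroup.zpowers eT := by rw [oj_sq]; exact Subgroup.npow_mem_zpowers _ _
    have hHc : Nat.card (dic eT oj e2 hz) = 2 ^ 3 := by
      rw [card_dic (not_mem_zp e2 eT_sq), oT4]; norm_num
    have hHle : dic eT oj e2 hz ≤ SG (KGrp X Y Z) := dic_le mT mj
    have hDT := Subgroup.mul_mem _ mD mT
    have d1 : 8 ∣ Nat.card (SG (KGrp X Y Z)) := by
      have := Subgroup.card_dvd_of_le hHle
      rwa [hHc] at this
    have d2 : 3 ∣ Nat.card (SG (KGrp X Y Z)) := by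
      rw [← o3o, ← Nat.card_zpowers]
      exact Subgroup.card_dvd_of_le ((Subgroup.zpowers_le).mpr hDT)
    have d3 : 5 ∣ Nat.card (SG (KGrp X Y Z)) := by
      rw [← o5o, ← Nat.card_zpowers]
      exact Subgroup.card_dvd_of_le ((Subgroup.zpowers_le).mpr mD)
    refine E_fin hcard hdet ⟨osc, msc, osc_det⟩ (n := 120) rfl (by omega) (fun hc => ?_)
    refine E_main ?_ hHle hHc (by rw [hc]; decide) ?_
    · intro p hp h2 hpd
      rw [hc] at hpd ⊢
      rcases prime_odd_dvd_120 hp h2 hpd with rfl | rfl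
      · refine ⟨by decide, _, hDT, o3o, osc * eT * oj, ?_, ?_, e4⟩
        · rw [mul_assoc]; exact (msc' _ (Subgroup.mul_mem _ mT mj)).1
        · rw [mul_assoc]; exact (msc' _ (Subgroup.mul_mem _ mT mj)).2
      · exact ⟨by decide, _, mD, o5o, osc * oj, (msc' _ mj).1, (msc' _ mj).2, e5⟩
    · intro g hg
      have mc := msc' _ mT
      rcases dic_inv e2 e7 e8 hg with h | h
      · exact ⟨_, Subgroup.mul_mem _ mc.1 mj.1, by rw [det_mul_GL, mc.2, oj_det, mul_one], h⟩
      · exact ⟨_, mc.1, mc.2, h⟩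

end Klein

/-- Let `R` be a complete Kleinian singularity and `M`, `N` finitely generated
`R`-modules. Then `Êxt^i_R(M,N) ≅ Êxt^i_R(N,M)` for all `i ∈ ℤ`. In particular, if `M`
and `N` are maximal Cohen–Macaulay (depth `2`), then `Ext^i_R(M,N) ≅ Ext^i_R(N,M)` for
all `i > 0`. -/
theorem stmt_19 (f : MvPowerSeries (Fin 3) ℂ) (hf : IsKleinianPolynomial f)
    [IsLocalRing (KleinianRing f)]
    (M N : Type) [AddCommGroup M] [Module (KleinianRing f) M]
    [Module.Finite (KleinianRing f) M]
    [AddCommGroup N] [Module (KleinianRing f) N] [Module.Finite (KleinianRing f) N] :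
    (∀ (CM : CompleteResolution (KleinianRing f) (ModuleCat.of (KleinianRing f) M))
      (CN : CompleteResolution (KleinianRing f) (ModuleCat.of (KleinianRing f) N)) (i : ℤ),
      Nonempty ((TateExt (KleinianRing f) CM (ModuleCat.of (KleinianRing f) N) i) ≃ₗ[KleinianRing f]
        (TateExt (KleinianRing f) CN (ModuleCat.of (KleinianRing f) M) i))) ∧
    (moduleDepth (KleinianRing f) M = 2 → moduleDepth (KleinianRing f) N = 2 →
      ∀ i : ℕ, 0 < i →
        Nonempty ((ExtMod (KleinianRing f) i (ModuleCat.of (KleinianRing f) M)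
            (ModuleCat.of (KleinianRing f) N)) ≃ₗ[KleinianRing f]
          (ExtMod (KleinianRing f) i (ModuleCat.of (KleinianRing f) N)
            (ModuleCat.of (KleinianRing f) M)))) := by
  rcases hf with ⟨n, hn, rfl⟩ | ⟨n, hn, hf⟩ | rfl | rfl | rfl
  · exact Klein.k_main (Klein.khA n) (Klein.tau_A n hn) M N
  · obtain ⟨m, rfl⟩ : ∃ m, n = m + 2 := ⟨n - 2, by omega⟩
    have hf' : f = MvPowerSeries.X 0 ^ 2 + MvPowerSeries.X 1 ^ 2 * MvPowerSeries.X 2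
        + MvPowerSeries.X 2 ^ (m + 1) := hf
    subst hf'
    exact Klein.k_main (Klein.khD m) (Klein.tau_D m (by omega)) M N
  · exact Klein.k_main Klein.khE6 Klein.tau_E6 M N
  · exact Klein.k_main Klein.khE7 Klein.tau_E7 M N
  · exact Klein.k_main Klein.khE8 Klein.tau_E8 M N

end
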